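/- arXiv:math/0306126 — 6 statements merged into one kernel-verified Lean document; each statement's English description precedes it below -/
import Mathlib

section
/- Let k be an integral domain of characteristic 0, n an odd positive integer, X the generic n×n matrix over k[x_{ij}], and adj(X) its adjugate. Then there do not exist n×n matrices Y, Z over k[x_{ij}], neither of which is invertible over k[x_{ij}], with adj(X) = Y·Z. -/
universe u
set_option linter.unusedSectionVars false

namespace Berg

/-- The skew group ring of a commutative ring with involution. -/
@[ext] structure Sk (A : Type u) where
  re : A
  im : A

namespace Sk
variable {A : Type u} [CommRing A] [StarRing A]

instance : Zero (Sk A) := ⟨⟨0, 0⟩⟩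
instance : One (Sk A) := ⟨⟨1, 0⟩⟩
instance : Add (Sk A) := ⟨fun a b => ⟨a.re + b.re, a.im + b.im⟩⟩
instance : Neg (Sk A) := ⟨fun a => ⟨-a.re, -a.im⟩⟩
instance : Mul (Sk A) := ⟨fun a b => ⟨a.re * b.re + a.im * star b.im, a.re * b.im + a.im * star b.re⟩⟩
@[simp] theorem zero_re : (0 : Sk A).re = 0 := rfl
@[simp] theorem zero_im : (0 : Sk A).im = 0 := rfl
@[simp] theorem one_re : (1 : Sk A).re = 1 := rfl
@[simp] theorem one_im : (1 : Sk A).im = 0 := rfl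
@[simp] theorem add_re (a b : Sk A) : (a + b).re = a.re + b.re := rfl
@[simp] theorem add_im (a b : Sk A) : (a + b).im = a.im + b.im := rfl
@[simp] theorem neg_re (a : Sk A) : (-a).re = -a.re := rfl
@[simp] theorem neg_im (a : Sk A) : (-a).im = -a.im := rfl
@[simp] theorem mul_re (a b : Sk A) : (a * b).re = a.re * b.re + a.im * star b.im := rfl
@[simp] theorem mul_im (a b : Sk A) : (a * b).im = a.re * b.im + a.im * star b.re := rfl

instance : Ring (Sk A) where
  add_assoc a b c := by ext <;> simp [add_assoc]
  zero_add a := by ext <;> simp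
  add_zero a := by ext <;> simp
  add_comm a b := by ext <;> simp [add_comm]
  nsmul := nsmulRec
  zsmul := zsmulRec
  neg_add_cancel a := by ext <;> simp
  left_distrib a b c := by ext <;> simp <;> ring
  right_distrib a b c := by ext <;> simp <;> ring
  zero_mul a := by ext <;> simp
  mul_zero a := by ext <;> simp
  mul_assoc a b c := by ext <;> simp <;> ring
  one_mul a := by ext <;> simp
  mul_one a := by ext <;> simp

/-- inclusion of the base ring -/
def of : A →+* Sk A where
  toFun a := ⟨a, 0⟩
  map_zero' := rfl
  map_one' := rfl
  map_add' a b := by ext <;> simp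
  map_mul' a b := by ext <;> simp

/-- the involution as an element -/
def s : Sk A := ⟨0, 1⟩

@[simp] theorem of_re (a : A) : (of a).re = a := rfl
@[simp] theorem of_im (a : A) : (of a).im = 0 := rfl
@[simp] theorem s_re : (s : Sk A).re = 0 := rfl
@[simp] theorem s_im : (s : Sk A).im = 1 := rfl
theorem s_mul_s : (s : Sk A) * s = 1 := by ext <;> simp
theorem s_mul_of (a : A) : s * of a = of (star a) * s := by ext <;> simp
theorem eq_of (a : Sk A) : a = of a.re + of a.im * s := by ext <;> simp

instance : Module A (Sk A) := Module.compHom (Sk A) (of (A := A))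
theorem smul_def (a : A) (b : Sk A) : a • b = of a * b := rfl

instance : IsScalarTower A (Sk A) (Sk A) := ⟨fun a b c => by
  simp [smul_def, mul_assoc]⟩

theorem of_smul {M : Type*} [AddCommGroup M] [Module A M] [Module (Sk A) M] [IsScalarTower A (Sk A) M]
    (a : A) (m : M) : of a • m = a • m := by
  have : of a = a • (1 : Sk A) := by simp [smul_def]
  rw [this, smul_assoc, one_smul]

instance [IsNoetherianRing A] : IsNoetherian A (Sk A) := by
  let f : (A × A) →ₗ[A] Sk A :=
    { toFun := fun p => ⟨p.1, p.2⟩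
      map_add' := fun p q => rfl
      map_smul' := fun a p => by ext <;> simp [smul_def] }
  exact isNoetherian_of_surjective f (LinearMap.range_eq_top.2 fun b => ⟨(b.re, b.im), rfl⟩)

instance : Module.Finite A (Sk A) := by
  let f : (A × A) →ₗ[A] Sk A :=
    { toFun := fun p => ⟨p.1, p.2⟩
      map_add' := fun p q => rfl
      map_smul' := fun a p => by ext <;> simp [smul_def] }
  exact Module.Finite.of_surjective f fun b => ⟨(b.re, b.im), rfl⟩

instance [IsNoetherianRing A] : IsNoetherianRing (Sk A) :=
  isNoetherian_of_tower A inferInstance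

/-- Build a module over `Sk A` from an involution. -/
abbrev mkModule {M : Type*} [AddCommGroup M] [Module A M] (t : M →+ M)
    (ht : ∀ m, t (t m) = m) (hs : ∀ (a : A) m, t (a • m) = star a • t m) : Module (Sk A) M where
  smul b m := b.re • m + b.im • t m
  one_smul m := by change (1:A) • m + (0:A) • t m = m; simp
  mul_smul a b m := by
    change (a.re * b.re + a.im * star b.im) • m + (a.re * b.im + a.im * star b.re) • t m =
      a.re • (b.re • m + b.im • t m) + a.im • t (b.re • m + b.im • t m)
    rw [map_add, hs, hs, ht]; module
  smul_zero a := by change a.re • (0:M) + a.im • t 0 = 0; simp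
  smul_add a m m' := by
    change a.re • (m + m') + a.im • t (m + m') = a.re • m + a.im • t m + (a.re • m' + a.im • t m')
    rw [map_add]; module
  add_smul a b m := by
    change (a.re + b.re) • m + (a.im + b.im) • t m = a.re • m + a.im • t m + (b.re • m + b.im • t m)
    module
  zero_smul m := by change (0:A) • m + (0:A) • t m = 0; simp

instance : Module (Sk A) A :=
  mkModule (starRingEnd A).toAddMonoidHom (fun m => by simp) (fun a m => by simp [starRingEnd_apply])
theorem smul_A (b : Sk A) (a : A) : b • a = b.re * a + b.im * star a := rfl

instance : IsScalarTower A (Sk A) A := ⟨fun a b c => by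
  simp [smul_A, smul_def, mul_add, mul_assoc]⟩

/-- A map is linear over the skew ring if it is linear over A and commutes with s. -/
def mkLin {M N : Type*} [AddCommGroup M] [Module (Sk A) M] [AddCommGroup N] [Module (Sk A) N]
    (f : M → N) (hadd : ∀ a b, f (a + b) = f a + f b) (h1 : ∀ (a : A) m, f (of a • m) = of a • f m)
    (h2 : ∀ m, f ((s : Sk A) • m) = (s : Sk A) • f m) : M →ₗ[Sk A] N where
  toFun := f
  map_add' := hadd
  map_smul' b m := by
    rw [eq_of b, add_smul, mul_smul, hadd, h1, h1, h2, RingHom.id_apply, add_smul, mul_smul]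
@[simp] theorem mkLin_apply {M N : Type*} [AddCommGroup M] [Module (Sk A) M] [AddCommGroup N] [Module (Sk A) N]
    (f : M → N) (hadd h1 h2) (m : M) : mkLin (A := A) f hadd h1 h2 m = f m := rfl

/-- twist of scalars -/
def tw : Sk A →+* Sk A where
  toFun b := ⟨b.re, -b.im⟩
  map_zero' := by ext <;> simp
  map_one' := by ext <;> simp
  map_add' a b := by ext <;> simp; ring
  map_mul' a b := by ext <;> simp; ring
@[simp] theorem tw_of (a : A) : tw (of a) = of a := by ext <;> simp [tw]
@[simp] theorem tw_s : tw (s : Sk A) = - s := by ext <;> simp [tw]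
@[simp] theorem tw_tw (b : Sk A) : tw (tw b) = b := by ext <;> simp [tw]

end Sk

/-- Parity shift. -/
def Sh (M : Type*) := M

namespace Sh
variable {A : Type u} [CommRing A] [StarRing A] {M : Type*} 
instance [AddCommGroup M] : AddCommGroup (Sh M) := inferInstanceAs (AddCommGroup M)
instance {R : Type*} [CommRing R] [AddCommGroup M] [Module R M] : Module R (Sh M) := inferInstanceAs (Module R M)
instance [AddCommGroup M] [Module (Sk A) M] : Module (Sk A) (Sh M) :=
  Module.compHom (M := M) (Sk.tw (A := A))
/-- identity -/
def mk [AddCommGroup M] : M ≃+ Sh M := AddEquiv.refl M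
variable [AddCommGroup M]
/-- A-linear identity -/
def lin (R : Type*) [CommRing R] [Module R M] : M ≃ₗ[R] Sh M := LinearEquiv.refl R M
@[simp] theorem lin_apply (R : Type*) [CommRing R] [Module R M] (m : M) : lin R m = mk m := rfl
theorem smul_mk [Module (Sk A) M] (b : Sk A) (m : M) : b • mk m = mk (Sk.tw b • m) := rfl
@[simp] theorem mk_symm_smul [Module (Sk A) M] (b : Sk A) (m : Sh M) : mk.symm (b • m) = Sk.tw b • mk.symm m := rfl
@[simp] theorem of_smul_mk [Module (Sk A) M] (a : A) (m : M) : Sk.of a • mk m = mk (Sk.of a • m) := by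
  rw [smul_mk, Sk.tw_of]
@[simp] theorem s_smul_mk [Module (Sk A) M] (m : M) : (Sk.s : Sk A) • mk m = mk (-((Sk.s : Sk A) • m)) := by
  rw [smul_mk, Sk.tw_s, neg_smul]
instance [Module A M] [Module (Sk A) M] [IsScalarTower A (Sk A) M] : IsScalarTower A (Sk A) (Sh M) := ⟨fun a b m => by
  change Sk.tw (a • b) • (mk.symm m) = a • (Sk.tw b • (mk.symm m))
  rw [Sk.smul_def, map_mul, Sk.tw_of, mul_smul, Sk.of_smul]⟩
end Sh

end Berg

set_option linter.unusedSectionVars false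
namespace Berg
open Function

section SESs
variable {B : Type*} [Ring B] {M' M M'' : Type*} [AddCommGroup M'] [AddCommGroup M] [AddCommGroup M'']
  [Module B M'] [Module B M] [Module B M'']
/-- short exact sequences -/
structure SES (f : M' →ₗ[B] M) (g : M →ₗ[B] M'') : Prop where
  inj : Injective f
  exact : ∀ m, g m = 0 ↔ ∃ m', f m' = m
  surj : Surjective g

theorem SES.sub (N : Submodule B M) : SES N.subtype N.mkQ :=
  ⟨N.injective_subtype, fun m => by simp, N.mkQ_surjective⟩
theorem SES.ker (f : M →ₗ[B] M'') : SES (LinearMap.ker f).subtype f.rangeRestrict :=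
  ⟨Submodule.injective_subtype _, fun m => by simp [Subtype.ext_iff], f.surjective_rangeRestrict⟩
end SESs

namespace Sh
variable {A : Type u} [CommRing A] [StarRing A] {M M' : Type*} [AddCommGroup M] [AddCommGroup M']
  [Module (Sk A) M] [Module (Sk A) M']
/-- functoriality -/
def map (f : M →ₗ[Sk A] M') : Sh M →ₗ[Sk A] Sh M' where
  toFun m := mk (f (mk.symm m))
  map_add' a b := by simp
  map_smul' b m := by simp [smul_mk]
@[simp] theorem map_mk (f : M →ₗ[Sk A] M') (m : M) : map f (mk m) = mk (f m) := rfl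
@[elab_as_elim] theorem ind {p : Sh M → Prop} (h : ∀ m, p (mk m)) (m : Sh M) : p m := h m
/-- double shift -/
def dbl : M ≃ₗ[Sk A] Sh (Sh M) where
  toFun m := mk (mk m)
  invFun m := mk.symm (mk.symm m)
  left_inv m := rfl
  right_inv m := rfl
  map_add' a b := rfl
  map_smul' b m := by simp [smul_mk]
/-- functoriality -/
def mapEquiv (f : M ≃ₗ[Sk A] M') : Sh M ≃ₗ[Sk A] Sh M' :=
  { map f.toLinearMap with
    invFun := map f.symm.toLinearMap
    left_inv := fun m => congrArg mk (f.symm_apply_apply (mk.symm m))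
    right_inv := fun m => congrArg mk (f.apply_symm_apply (mk.symm m)) }
theorem map_SES {M'' : Type*} [AddCommGroup M''] [Module (Sk A) M''] {f : M →ₗ[Sk A] M'} {g : M' →ₗ[Sk A] M''}
    (h : SES f g) : SES (map f) (map g) := ⟨h.1, h.2, h.3⟩
instance [Module.Finite (Sk A) M] : Module.Finite (Sk A) (Sh M) := by
  obtain ⟨t, ht⟩ := Module.Finite.fg_top (R := Sk A) (M := M)
  refine ⟨⟨t, ?_⟩⟩
  rw [eq_top_iff]
  rintro m -
  induction m using Sh.ind with | _ m
  have : m ∈ Submodule.span (Sk A) (t : Set M) := ht ▸ trivial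
  induction this using Submodule.span_induction with
  | mem x hx => exact Submodule.subset_span hx
  | zero => exact zero_mem _
  | add x y _ _ h1 h2 => rw [map_add]; exact add_mem h1 h2
  | smul b x _ h => 
    have := Submodule.smul_mem (Submodule.span (Sk A) (t : Set M)  : Submodule (Sk A) (Sh M)) (Sk.tw b) h
    rwa [smul_mk, Sk.tw_tw] at this
end Sh

/-- The regular local set-up. -/
structure Setup (K A : Type u) [Field K] [CommRing A] [StarRing A] [Algebra K A] where
  x : ℕ → A
  N : ℕ
  star_x : ∀ i, star (x i) = - x i
  star_K : ∀ c : K, star (algebraMap K A c) = algebraMap K A c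
  decomp : ∀ a : A, ∃ c : K, ∃ g : ℕ → A, a = algebraMap K A c + ∑ i ∈ Finset.range N, x i * g i
  nonunit : ∀ i, i < N → ¬ IsUnit (x i)
  reg : ∀ (s : Finset ℕ) (i : ℕ) (a : A), (∀ j ∈ s, j < N) → i < N → i ∉ s →
    x i * a ∈ Ideal.span (x '' s) → a ∈ Ideal.span (x '' s)

variable {K A : Type u} [Field K] [CommRing A] [StarRing A] [Algebra K A]

/-- restriction to K -/
def Kr (K A : Type u) (M : Type*) [Field K] [CommRing A] [StarRing A] [Algebra K A] := M
instance {M : Type*} [AddCommGroup M] : AddCommGroup (Kr K A M) := inferInstanceAs (AddCommGroup M)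
instance {M : Type*} [AddCommGroup M] [Module (Sk A) M] : Module K (Kr K A M) :=
  Module.compHom M ((Sk.of (A := A)).comp (algebraMap K A))
/-- identity -/
def Kr.mk (K A : Type u) {M : Type*} [Field K] [CommRing A] [StarRing A] [Algebra K A]
  [AddCommGroup M] : M ≃+ Kr K A M := AddEquiv.refl M
theorem Kr.smul_mk {M : Type*} [AddCommGroup M] [Module (Sk A) M] (c : K) (m : M) :
  c • Kr.mk K A m = Kr.mk K A (Sk.of (algebraMap K A c) • m) := rfl

section
variable (S : Setup K A) 
/-- even part -/
def even (M : Type u) [AddCommGroup M] [Module (Sk A) M] : Submodule K (Kr K A M) where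
  carrier := {m | (Sk.s : Sk A) • (Kr.mk K A).symm m = (Kr.mk K A).symm m}
  add_mem' {a b} ha hb := by
    simp only [Set.mem_ofPred_eq, map_add, smul_add] at *
    rw [ha, hb]
  zero_mem' := by simp
  smul_mem' c m hm := by
    change (Sk.s : Sk A) • (Sk.of (algebraMap K A c) • (Kr.mk K A).symm m) = Sk.of (algebraMap K A c) • (Kr.mk K A).symm m
    simp only [Set.mem_ofPred_eq] at hm
    rw [← mul_smul, Sk.s_mul_of, S.star_K, mul_smul, hm]
variable {M M' M'' : Type u} [AddCommGroup M] [Module (Sk A) M] [AddCommGroup M'] [Module (Sk A) M']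
  [AddCommGroup M''] [Module (Sk A) M'']
theorem mem_even (m : M) : Kr.mk K A m ∈ even S M ↔ (Sk.s : Sk A) • m = m := Iff.rfl

/-- dimension of the even part -/
noncomputable def ev (M : Type u) [AddCommGroup M] [Module (Sk A) M] : ℤ := Module.finrank K (even S M)

/-- induced map on even parts -/
def evMap (f : M →ₗ[Sk A] M') : even S M →ₗ[K] even S M' where
  toFun m := ⟨Kr.mk K A (f ((Kr.mk K A).symm m.1)), by
    rw [mem_even, ← map_smul, (mem_even S ((Kr.mk K A).symm m.1)).1 m.2]⟩
  map_add' a b := by ext; simp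
  map_smul' c a := by
    ext
    change f (Sk.of (algebraMap K A c) • (Kr.mk K A).symm a.1) = Sk.of (algebraMap K A c) • f ((Kr.mk K A).symm a.1)
    rw [map_smul]

theorem ev_congr (e : M ≃ₗ[Sk A] M') : ev S M = ev S M' := by
  have : even S M ≃ₗ[K] even S M' := LinearEquiv.ofLinearMap (evMap S e.toLinearMap) (evMap S e.symm.toLinearMap)
    (by ext m; change e (e.symm m.1) = m.1; exact e.apply_symm_apply _)
    (by ext m; change e.symm (e m.1) = m.1; exact e.symm_apply_apply _)
  rw [ev, ev, this.finrank_eq]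

/-- finiteness and torsion condition -/
structure Good (j : ℕ) (M : Type u) [AddCommGroup M] [Module (Sk A) M] : Prop where
  fin : Module.Finite (Sk A) M
  kill : ∀ i, j ≤ i → i < S.N → ∀ m : M, Sk.of (S.x i) • m = 0

theorem Good.sub [IsNoetherianRing A] {S : Setup K A} {j : ℕ} (h : Good S j M') (f : M →ₗ[Sk A] M') (hf : Injective f) : Good S j M :=
  have := h.fin
  have : IsNoetherian (Sk A) M' := isNoetherian_of_isNoetherianRing_of_finite _ _
  have : IsNoetherian (Sk A) M := isNoetherian_of_injective f hf
  ⟨inferInstance, fun i hi hN m => hf (by rw [map_smul, h.kill i hi hN, map_zero])⟩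
theorem Good.quot {S : Setup K A} {j : ℕ} (h : Good S j M) (f : M →ₗ[Sk A] M') (hf : Surjective f) : Good S j M' :=
  have := h.fin
  ⟨Module.Finite.of_surjective f hf, fun i hi hN m => by
    obtain ⟨m, rfl⟩ := hf m
    rw [← map_smul, h.kill i hi hN, map_zero]⟩
theorem Good.sh {S : Setup K A} {j : ℕ} (h : Good S j M) : Good S j (Sh M) :=
  have := h.fin
  ⟨inferInstance, fun i hi hN m => by
    induction m using Sh.ind
    rw [Sh.of_smul_mk, h.kill i hi hN, map_zero]⟩

theorem Good.finK {S : Setup K A} (h : Good S 0 M) : Module.Finite K (Kr K A M) := by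
  have := h.fin
  obtain ⟨t, f, hf⟩ := Module.Finite.exists_fin' (Sk A) M
  have key : ∀ (a : A) (m : M), ∃ c : K, Sk.of a • m = (Kr.mk K A).symm (c • (Kr.mk K A m)) := by
    intro a m
    obtain ⟨c, g, rfl⟩ := S.decomp a
    refine ⟨c, ?_⟩
    rw [Kr.smul_mk, map_add, add_smul, map_sum, Finset.sum_smul]
    rw [Finset.sum_eq_zero, add_zero]
    · rfl
    · intro i hi
      rw [map_mul, mul_smul, h.kill i (Nat.zero_le _) (Finset.mem_range.1 hi)]
  choose c hc using key
  have : Submodule.span K (Set.range (fun i : Fin t => Kr.mk K A (f (Pi.single i 1))) ∪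
    Set.range (fun i : Fin t => Kr.mk K A ((Sk.s : Sk A) • f (Pi.single i 1)))) = ⊤ := by
    rw [eq_top_iff]
    rintro m -
    obtain ⟨b, hb⟩ := hf ((Kr.mk K A).symm m)
    have : m = ∑ i, (c (b i).re (f (Pi.single i 1)) • Kr.mk K A (f (Pi.single i 1)) +
       c (b i).im ((Sk.s : Sk A) • f (Pi.single i 1)) • Kr.mk K A ((Sk.s : Sk A) • f (Pi.single i 1))) := by
      apply (Kr.mk K A).symm.injective
      rw [← hb, map_sum]
      simp_rw [map_add, ← hc]
      conv_lhs => rw [pi_eq_sum_univ b, map_sum]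
      refine Finset.sum_congr rfl fun i _ => ?_
      have e : (fun j => if i = j then (1 : Sk A) else 0) = Pi.single i 1 := by
        ext j : 1
        simp [Pi.single_apply, eq_comm]
      rw [e, map_smul, smul_smul, ← add_smul, ← Sk.eq_of]
    rw [this]
    refine Submodule.sum_mem _ fun i _ => Submodule.add_mem _ (Submodule.smul_mem _ _ ?_) (Submodule.smul_mem _ _ ?_)
    · exact Submodule.subset_span (Or.inl ⟨i, rfl⟩)
    · exact Submodule.subset_span (Or.inr ⟨i, rfl⟩)
  exact ⟨(Submodule.fg_def).2 ⟨_, (Set.finite_range _).union (Set.finite_range _), this⟩⟩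

theorem ev_add [CharZero K] (h : Good S 0 M) {f : M' →ₗ[Sk A] M} {g : M →ₗ[Sk A] M''} (hs : SES f g) :
    ev S M = ev S M' + ev S M'' := by
  have := h.finK
  have h1 := LinearMap.finrank_range_add_finrank_ker (evMap S g)
  have h2 : LinearMap.range (evMap S g) = ⊤ := by
    rw [LinearMap.range_eq_top]
    rintro ⟨m, hm⟩
    obtain ⟨m0, h0⟩ := hs.surj ((Kr.mk K A).symm m)
    have hm' : (Sk.s : Sk A) • (Kr.mk K A).symm m = (Kr.mk K A).symm m := hm
    refine ⟨⟨(Kr.mk K A) (Sk.of (algebraMap K A (1/2)) • (m0 + (Sk.s : Sk A) • m0)), ?_⟩, ?_⟩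
    · rw [mem_even, smul_smul, Sk.s_mul_of, S.star_K, mul_smul, smul_add, smul_smul, Sk.s_mul_s, one_smul, add_comm]
    · ext
      change g (Sk.of (algebraMap K A (1/2)) • (m0 + (Sk.s : Sk A) • m0)) = m
      rw [map_smul, map_add, map_smul, h0, hm', ← two_smul (Sk A), smul_smul]
      have : Sk.of (algebraMap K A (1/2)) * (2 : Sk A) = 1 := by
        rw [← map_ofNat Sk.of 2, ← map_mul, ← map_ofNat (algebraMap K A) 2, ← map_mul]
        norm_num
      rw [this, one_smul]; rfl
  have h3 : Module.finrank K (LinearMap.ker (evMap S g)) = Module.finrank K (even S M') := by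
    have hr : LinearMap.range (evMap S f) = LinearMap.ker (evMap S g) := by
      ext ⟨m, hm⟩
      have hm' : (Sk.s : Sk A) • (Kr.mk K A).symm m = (Kr.mk K A).symm m := hm
      rw [LinearMap.mem_range, LinearMap.mem_ker]
      constructor
      · rintro ⟨m', hm'⟩
        rw [← hm']
        ext
        exact (hs.exact _).2 ⟨_, rfl⟩
      · intro h
        obtain ⟨m', hm2⟩ := (hs.exact ((Kr.mk K A).symm m)).1 (congrArg Subtype.val h)
        refine ⟨⟨Kr.mk K A m', ?_⟩, ?_⟩
        · rw [mem_even]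
          apply hs.inj
          rw [map_smul, hm2, hm']
        · ext; exact hm2
    rw [← hr]
    apply LinearMap.finrank_range_of_inj
    intro a b hab
    ext
    exact hs.inj (congrArg Subtype.val hab)
  rw [h2, finrank_top, h3] at h1
  simp only [ev, ← h1]
  push_cast; ring
end
end Berg

set_option linter.unusedSectionVars false
namespace Berg
open Function
variable {K A : Type u} [Field K] [CommRing A] [StarRing A] [Algebra K A]

/-- multiplication by an odd element -/
def od (a : A) (ha : star a = -a) (M : Type*) [AddCommGroup M] [Module (Sk A) M] : Sh M →ₗ[Sk A] M :=
  Sk.mkLin (fun m => Sk.of a • Sh.mk.symm m) (fun m m' => by simp) (fun b m => by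
    rw [Sh.mk_symm_smul, Sk.tw_of, smul_smul, smul_smul, ← map_mul, ← map_mul, mul_comm]) (fun m => by
    rw [Sh.mk_symm_smul, Sk.tw_s, smul_smul, smul_smul, Sk.s_mul_of, ha, map_neg, mul_neg, neg_mul])
@[simp] theorem od_mk (a : A) (ha : star a = -a) (M : Type*) [AddCommGroup M] [Module (Sk A) M] (m : M) :
  od a ha M (Sh.mk m) = Sk.of a • m := rfl

variable (S : Setup K A)

/-- Euler characteristic -/
noncomputable def chi : ℕ → (M : Type u) → [AddCommGroup M] → [Module (Sk A) M] → ℤ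
  | 0, M, _, _ => ev S M - ev S (Sh M)
  | j + 1, M, _, _ => chi j (M ⧸ LinearMap.range (od (S.x j) (S.star_x j) M)) - chi j (LinearMap.ker (od (S.x j) (S.star_x j) M))

variable {M M' M'' : Type u} [AddCommGroup M] [Module (Sk A) M] [AddCommGroup M'] [Module (Sk A) M']
  [AddCommGroup M''] [Module (Sk A) M'']

theorem od_nat (a : A) (ha : star a = -a) (f : M →ₗ[Sk A] M') (m : Sh M) :
    od a ha M' (Sh.map f m) = f (od a ha M m) := by
  induction m using Sh.ind with | _ m
  simp

theorem chi_congr (j : ℕ) : ∀ {M M' : Type u} [AddCommGroup M] [Module (Sk A) M] [AddCommGroup M'] [Module (Sk A) M']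
   (_ : M ≃ₗ[Sk A] M'), chi S j M = chi S j M' := by
  induction j with
  | zero =>
    intro M M' _ _ _ _ e
    rw [chi, chi, ev_congr S e, ev_congr S (Sh.mapEquiv e)]
  | succ j ih =>
    intro M M' _ _ _ _ e
    rw [chi, chi]
    congr 1
    · apply ih
      refine Submodule.Quotient.equiv _ _ e ?_
      ext m
      simp only [Submodule.mem_map, LinearMap.mem_range]
      constructor
      · rintro ⟨_, ⟨m, rfl⟩, rfl⟩
        exact ⟨Sh.map e.toLinearMap m, od_nat _ _ _ _⟩
      · rintro ⟨m, rfl⟩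
        refine ⟨_, ⟨Sh.map e.symm.toLinearMap m, rfl⟩, ?_⟩
        rw [od_nat]; exact e.apply_symm_apply _
    · apply ih
      refine LinearEquiv.ofSubmodules (Sh.mapEquiv e) _ _ ?_
      ext m
      simp only [Submodule.mem_map, LinearMap.mem_ker]
      constructor
      · rintro ⟨m, hm, rfl⟩
        have := od_nat (S.x j) (S.star_x j) e.toLinearMap m
        rw [hm, map_zero] at this
        exact this
      · intro hm
        refine ⟨Sh.map e.symm.toLinearMap m, ?_, ?_⟩
        · rw [od_nat, hm, map_zero]
        · exact e.apply_symm_apply _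

/-- connecting map -/
theorem exists_lift {B L P C : Type*} [Ring B] [AddCommGroup L] [AddCommGroup P] [AddCommGroup C] [Module B L] [Module B P]
  [Module B C] (β : L →ₗ[B] P) (hβ : Surjective β) (γ : L →ₗ[B] C) (h : ∀ l, β l = 0 → γ l = 0) :
  ∃ δ : P →ₗ[B] C, ∀ l, δ (β l) = γ l := by
  refine ⟨((LinearMap.ker β).liftQ γ h).comp (β.quotKerEquivOfSurjective hβ).symm.toLinearMap, fun l => ?_⟩
  have : (β.quotKerEquivOfSurjective hβ).symm (β l) = Submodule.Quotient.mk l := by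
    rw [LinearEquiv.symm_apply_eq]; rfl
  rw [LinearMap.comp_apply]
  erw [this]
  rfl

theorem goodstep_c [IsNoetherianRing A] {j : ℕ} (h : Good S (j+1) M) :
    Good S j (M ⧸ LinearMap.range (od (S.x j) (S.star_x j) M)) := by
  have h1 := h.quot (Submodule.mkQ (LinearMap.range (od (S.x j) (S.star_x j) M))) (Submodule.mkQ_surjective _)
  refine ⟨h1.fin, fun i hi hN m => ?_⟩
  rcases hi.eq_or_lt with rfl | hi
  · obtain ⟨m, rfl⟩ := Submodule.mkQ_surjective _ m
    rw [← map_smul, Submodule.mkQ_apply, Submodule.Quotient.mk_eq_zero]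
    exact ⟨Sh.mk m, rfl⟩
  · exact h1.kill i hi hN m
theorem goodstep_k [IsNoetherianRing A] {j : ℕ} (h : Good S (j+1) M) :
    Good S j (LinearMap.ker (od (S.x j) (S.star_x j) M)) := by
  have h1 := h.sh.sub (Submodule.subtype (LinearMap.ker (od (S.x j) (S.star_x j) M))) (Submodule.injective_subtype _)
  refine ⟨h1.fin, fun i hi hN m => ?_⟩
  rcases hi.eq_or_lt with rfl | hi
  · ext
    obtain ⟨m, hm⟩ := m
    induction m using Sh.ind with | _ m
    change Sk.of (S.x j) • Sh.mk m = 0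
    rw [Sh.of_smul_mk]
    exact hm
  · exact h1.kill i hi hN m

theorem chi_add [CharZero K] [IsNoetherianRing A] (j : ℕ) : ∀ {M M' M'' : Type u} [AddCommGroup M] [Module (Sk A) M] [AddCommGroup M'] [Module (Sk A) M']
  [AddCommGroup M''] [Module (Sk A) M''] (_ : Good S j M) {f : M' →ₗ[Sk A] M} {g : M →ₗ[Sk A] M''} (_ : SES f g),
    chi S j M = chi S j M' + chi S j M'' := by
  induction j with
  | zero =>
    intro M M' M'' _ _ _ _ _ _ h f g hs
    rw [chi, chi, chi, ev_add S h hs, ev_add S h.sh (Sh.map_SES hs)]; ring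
  | succ j ih =>
    intro M M' M'' _ _ _ _ _ _ h f g hs
    have hM' := h.sub f hs.inj
    have hM'' := h.quot g hs.surj
    set T := od (S.x j) (S.star_x j) M with hT
    set T' := od (S.x j) (S.star_x j) M' with hT'
    set T'' := od (S.x j) (S.star_x j) M'' with hT''
    have nf : ∀ m, T (Sh.map f m) = f (T' m) := od_nat _ _ _
    have ng : ∀ m, T'' (Sh.map g m) = g (T m) := od_nat _ _ _
    have sf := Sh.map_SES hs
    -- kernels
    let κ : LinearMap.ker T' →ₗ[Sk A] LinearMap.ker T :=
      ((Sh.map f).comp (LinearMap.ker T').subtype).codRestrict _ (fun m => by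
        have := m.2
        rw [LinearMap.mem_ker] at this ⊢
        simp only [LinearMap.comp_apply, Submodule.subtype_apply]
        rw [nf, this, map_zero])
    let α : LinearMap.ker T →ₗ[Sk A] LinearMap.ker T'' :=
      ((Sh.map g).comp (LinearMap.ker T).subtype).codRestrict _ (fun m => by
        have := m.2
        rw [LinearMap.mem_ker] at this ⊢
        simp only [LinearMap.comp_apply, Submodule.subtype_apply]
        rw [ng, this, map_zero])
    let c1 : (M' ⧸ LinearMap.range T') →ₗ[Sk A] (M ⧸ LinearMap.range T) :=
      Submodule.mapQ _ _ f (by rintro _ ⟨m, rfl⟩; exact ⟨Sh.map f m, nf m⟩)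
    let c2 : (M ⧸ LinearMap.range T) →ₗ[Sk A] (M'' ⧸ LinearMap.range T'') :=
      Submodule.mapQ _ _ g (by rintro _ ⟨m, rfl⟩; exact ⟨Sh.map g m, ng m⟩)
    let L : Submodule (Sk A) (Sh M) := LinearMap.ker (T''.comp (Sh.map g))
    let β : L →ₗ[Sk A] LinearMap.ker T'' := ((Sh.map g).comp L.subtype).codRestrict _ (fun m => m.2)
    have hβ : Surjective β := by
      rintro ⟨m, hm⟩
      obtain ⟨m, rfl⟩ := sf.surj m
      exact ⟨⟨m, hm⟩, rfl⟩
    have hLf : ∀ l : L, ∃ m', f m' = T l := fun l => by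
      rw [← hs.exact, ← ng]; exact l.2
    let fe := LinearEquiv.ofInjective f hs.inj
    let γ0 : L →ₗ[Sk A] LinearMap.range f := (T.comp L.subtype).codRestrict _ (fun l => hLf l)
    let γ : L →ₗ[Sk A] (M' ⧸ LinearMap.range T') := (Submodule.mkQ _).comp (fe.symm.toLinearMap.comp γ0)
    have hγ : ∀ (l : L) m', f m' = T l → γ l = Submodule.Quotient.mk m' := by
      intro l m' h
      change Submodule.Quotient.mk (fe.symm (γ0 l)) = _
      congr 1
      rw [LinearEquiv.symm_apply_eq]
      ext
      exact h.symm
    obtain ⟨δ, hδ⟩ := exists_lift β hβ γ (fun l hl => by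
      obtain ⟨m', hm'⟩ := (sf.exact l.1).1 (congrArg Subtype.val hl)
      rw [hγ l (T' m') (by rw [← nf, hm'])]
      rw [Submodule.Quotient.mk_eq_zero]
      exact ⟨m', rfl⟩)
    -- the exact sequences
    have e1 : SES κ α.rangeRestrict := by
      refine ⟨fun a b hab => ?_, fun m => ?_, LinearMap.surjective_rangeRestrict _⟩
      · ext; exact sf.inj (congrArg Subtype.val hab)
      · constructor
        · intro hm
          have hm2 := congrArg Subtype.val (congrArg Subtype.val hm)
          obtain ⟨m', hm'⟩ := (sf.exact m.1).1 hm2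
          refine ⟨⟨m', ?_⟩, by ext; exact hm'⟩
          rw [LinearMap.mem_ker]
          apply hs.inj
          rw [← nf, hm', map_zero]
          exact m.2
        · rintro ⟨m', rfl⟩
          ext
          exact (sf.exact _).2 ⟨_, rfl⟩
    have e2 : SES (LinearMap.range α).subtype δ.rangeRestrict := by
      refine ⟨Submodule.injective_subtype _, fun m => ?_, LinearMap.surjective_rangeRestrict _⟩
      obtain ⟨l, rfl⟩ := hβ m
      obtain ⟨m', hm'⟩ := hLf l
      constructor
      · intro h
        have h2 : δ (β l) = 0 := congrArg Subtype.val h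
        rw [hδ, hγ l m' hm', Submodule.Quotient.mk_eq_zero] at h2
        obtain ⟨m2, rfl⟩ := h2
        rw [← nf] at hm'
        refine ⟨⟨_, ⟨⟨l.1 - Sh.map f m2, ?_⟩, rfl⟩⟩, ?_⟩
        · rw [LinearMap.mem_ker, map_sub, hm', sub_self]
        · ext
          change Sh.map g (l.1 - Sh.map f m2) = Sh.map g l.1
          rw [map_sub, (sf.exact (Sh.map f m2)).2 ⟨_, rfl⟩, sub_zero]
      · rintro ⟨⟨_, ⟨m, rfl⟩⟩, hm⟩
        ext
        change δ (β l) = 0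
        rw [← hm]
        let l' : L := ⟨m.1, by
          change T'' (Sh.map g m.1) = 0
          rw [ng, show T m.1 = 0 from m.2, map_zero]⟩
        change δ (β l') = 0
        rw [hδ, hγ l' 0]
        · rfl
        · rw [map_zero]; exact m.2.symm
    have e3 : SES (LinearMap.range δ).subtype c1.rangeRestrict := by
      refine ⟨Submodule.injective_subtype _, fun m => ?_, LinearMap.surjective_rangeRestrict _⟩
      obtain ⟨m, rfl⟩ := Submodule.mkQ_surjective _ m
      constructor
      · intro h
        have h2 : c1 (Submodule.Quotient.mk m) = 0 := congrArg Subtype.val h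
        change Submodule.Quotient.mk (f m) = _ at h2
        rw [Submodule.Quotient.mk_eq_zero] at h2
        obtain ⟨m2, hm2⟩ := h2
        let l : L := ⟨m2, by
          change T'' (Sh.map g m2) = 0
          rw [ng, hm2]
          exact (hs.exact _).2 ⟨_, rfl⟩⟩
        refine ⟨⟨δ (β l), ⟨_, rfl⟩⟩, ?_⟩
        change δ (β l) = _
        rw [hδ, hγ l m hm2.symm]; rfl
      · rintro ⟨⟨_, ⟨k, rfl⟩⟩, hm⟩
        obtain ⟨l, rfl⟩ := hβ k
        obtain ⟨m', hm'⟩ := hLf l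
        ext
        change c1 (Submodule.mkQ _ m) = 0
        rw [← hm]
        change c1 (δ (β l)) = 0
        rw [hδ, hγ l m' hm']
        change Submodule.Quotient.mk (f m') = _
        rw [Submodule.Quotient.mk_eq_zero, hm']
        exact ⟨_, rfl⟩
    have e4 : SES (LinearMap.range c1).subtype c2 := by
      refine ⟨Submodule.injective_subtype _, fun m => ?_, fun m => ?_⟩
      · obtain ⟨m, rfl⟩ := Submodule.mkQ_surjective _ m
        constructor
        · intro h
          change Submodule.Quotient.mk (g m) = _ at h
          rw [Submodule.Quotient.mk_eq_zero] at h
          obtain ⟨m2, hm2⟩ := h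
          obtain ⟨m2, rfl⟩ := sf.surj m2
          rw [ng, ← sub_eq_zero, ← map_sub, hs.exact] at hm2
          obtain ⟨m', hm'⟩ := hm2
          refine ⟨⟨_, ⟨Submodule.Quotient.mk (-m'), rfl⟩⟩, ?_⟩
          change Submodule.Quotient.mk (f (-m')) = Submodule.Quotient.mk m
          rw [Submodule.Quotient.eq, map_neg, hm']
          exact ⟨-m2, by rw [map_neg]; abel⟩
        · rintro ⟨⟨_, ⟨m', rfl⟩⟩, hm⟩
          obtain ⟨m', rfl⟩ := Submodule.mkQ_surjective _ m'
          rw [← hm]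
          change Submodule.Quotient.mk (g (f m')) = _
          rw [(hs.exact (f m')).2 ⟨_, rfl⟩]; rfl
      · obtain ⟨m, rfl⟩ := Submodule.mkQ_surjective _ m
        obtain ⟨m, rfl⟩ := hs.surj m
        exact ⟨Submodule.Quotient.mk m, rfl⟩
    have r1 := ih (goodstep_k S h) e1
    have r2 := ih (goodstep_k S hM'') e2
    have r3 := ih (goodstep_c S hM') e3
    have r4 := ih (goodstep_c S h) e4
    rw [chi, chi, chi]
    linarith

theorem chi_succ (j : ℕ) {C D : Type u} [AddCommGroup C] [Module (Sk A) C] [AddCommGroup D] [Module (Sk A) D]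
    (c : M →ₗ[Sk A] C) (hc : Surjective c) (hc2 : ∀ m, c m = 0 ↔ ∃ m', m = Sk.of (S.x j) • m')
    (i : D →ₗ[Sk A] Sh M) (hi : Injective i) (hi2 : ∀ m, (∃ d, i d = Sh.mk m) ↔ Sk.of (S.x j) • m = 0) :
    chi S (j+1) M = chi S j C - chi S j D := by
  rw [chi]
  congr 1
  · apply chi_congr
    refine (Submodule.quotEquivOfEq _ (LinearMap.ker c) ?_).trans (c.quotKerEquivOfSurjective hc)
    ext m
    rw [LinearMap.mem_ker, hc2]
    constructor
    · rintro ⟨m', h⟩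
      exact ⟨Sh.mk.symm m', h.symm⟩
    · rintro ⟨m', h⟩
      exact ⟨Sh.mk m', h.symm⟩
  · apply chi_congr
    refine LinearEquiv.symm ((LinearEquiv.ofInjective i hi).trans (LinearEquiv.ofEq _ _ ?_))
    ext m
    induction m using Sh.ind with | _ m
    rw [LinearMap.mem_ker, od_mk, ← hi2]
    rfl

theorem chi_sh (j : ℕ) : ∀ {M : Type u} [AddCommGroup M] [Module (Sk A) M], chi S j (Sh M) = - chi S j M := by
  induction j with
  | zero =>
    intro M _ _
    rw [chi, chi, ← ev_congr S Sh.dbl]; ring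
  | succ j ih =>
    intro M _ _
    have h0 := SES.sub (LinearMap.range (od (S.x j) (S.star_x j) M))
    rw [chi_succ S j (M := Sh M) (Sh.map (Submodule.mkQ (LinearMap.range (od (S.x j) (S.star_x j) M))))
      (Sh.map_SES h0).surj ?_ (Sh.map (LinearMap.ker (od (S.x j) (S.star_x j) M)).subtype)
      (Submodule.injective_subtype _), ih, ih, chi]
    · ring
    · intro m
      induction m using Sh.ind with | _ m
      constructor
      · rintro ⟨d, hd⟩
        induction d using Sh.ind with | _ d
        have h1 : d.1 = Sh.mk m := hd
        have h2 := d.2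
        rw [h1, LinearMap.mem_ker, od_mk] at h2
        rw [Sh.of_smul_mk, h2, map_zero]
      · intro h
        rw [Sh.of_smul_mk] at h
        exact ⟨Sh.mk ⟨Sh.mk m, h⟩, rfl⟩
    · intro m
      induction m using Sh.ind with | _ m
      rw [Sh.map_mk]
      change Submodule.mkQ (LinearMap.range (od (S.x j) (S.star_x j) M)) m = 0 ↔ _
      rw [Submodule.mkQ_apply, Submodule.Quotient.mk_eq_zero]
      constructor
      · rintro ⟨m', h⟩
        induction m' using Sh.ind with | _ m'
        exact ⟨Sh.mk m', by rw [Sh.of_smul_mk, ← h]; rfl⟩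
      · rintro ⟨m', h⟩
        induction m' using Sh.ind with | _ m'
        rw [Sh.of_smul_mk] at h
        exact ⟨Sh.mk m', h.symm⟩

theorem chi_killed (j : ℕ) (h : ∀ i < j, ∀ m : M, Sk.of (S.x i) • m = 0) : (2 : ℤ) ^ j ∣ chi S j M := by
  suffices ∃ z : ℤ, ∀ i ≤ j, chi S i M = 2 ^ i * z by
    obtain ⟨z, hz⟩ := this
    exact ⟨z, hz j le_rfl⟩
  refine ⟨chi S 0 M, fun i hi => ?_⟩
  induction i with
  | zero => simp
  | succ i ih =>
    rw [chi_succ S i (LinearMap.id : M →ₗ[Sk A] M) surjective_id ?_ (LinearMap.id : Sh M →ₗ[Sk A] Sh M) injective_id ?_,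
      chi_sh, ih (by omega)]
    · ring
    · intro m
      simp [h i hi]
    · intro m
      simp [h i hi]

theorem chi_subsingleton (j : ℕ) : ∀ {M : Type u} [AddCommGroup M] [Module (Sk A) M] [Subsingleton M], chi S j M = 0 := by
  intro M _ _ _
  have e : M ≃ₗ[Sk A] Sh M := 
    { toFun := Sh.mk, invFun := Sh.mk.symm, left_inv := fun _ => rfl, right_inv := fun _ => rfl, map_add' := fun _ _ => rfl,
      map_smul' := fun _ _ => Subsingleton.elim (α := M) _ _ }
  have := chi_congr S j e
  rw [chi_sh] at this
  linarith
end Berg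

set_option linter.unusedSectionVars false
namespace Berg
open Function
variable {K A : Type u} [Field K] [CommRing A] [StarRing A] [Algebra K A] (S : Setup K A)

theorem Sk.of_smul_A (a b : A) : Sk.of a • b = a * b := by simp [Sk.smul_A]
theorem Sk.s_smul_A (b : A) : (Sk.s : Sk A) • b = star b := by simp [Sk.smul_A]

/-- partial ideals -/
def Jsub (j : ℕ) : Submodule (Sk A) A where
  carrier := {a | a ∈ Ideal.span (S.x '' (Finset.Ico j S.N))}
  add_mem' ha hb := (Ideal.span (S.x '' (Finset.Ico j S.N))).add_mem ha hb
  zero_mem' := (Ideal.span (S.x '' (Finset.Ico j S.N))).zero_mem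
  smul_mem' b a ha := by
    simp only [Set.mem_ofPred_eq] at *
    rw [Sk.smul_A]
    refine add_mem (Ideal.mul_mem_left _ _ ha) (Ideal.mul_mem_left _ _ ?_)
    induction ha using Submodule.span_induction with
    | mem x hx =>
      obtain ⟨i, hi, rfl⟩ := hx
      rw [S.star_x]
      exact neg_mem (Ideal.subset_span ⟨i, hi, rfl⟩)
    | zero => simp
    | add x y _ _ h1 h2 => rw [star_add]; exact add_mem h1 h2
    | smul c x _ h => rw [smul_eq_mul, star_mul']; exact Ideal.mul_mem_left _ _ h
theorem mem_Jsub (j : ℕ) (a : A) : a ∈ Jsub S j ↔ a ∈ Ideal.span (S.x '' (Finset.Ico j S.N)) := Iff.rfl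

theorem Jsub_succ (j : ℕ) (hj : j < S.N) (a : A) : a ∈ Jsub S j ↔ ∃ b, ∃ c ∈ Jsub S (j+1), a = S.x j * b + c := by
  rw [mem_Jsub]
  have : S.x '' (Finset.Ico j S.N) = insert (S.x j) (S.x '' (Finset.Ico (j+1) S.N)) := by
    rw [← Set.image_insert_eq]
    congr 1
    ext i
    simp
    omega
  rw [this, Ideal.mem_span_insert]
  simp only [mem_Jsub, mul_comm]

variable [CharZero K] [IsNoetherianRing A] [IsLocalRing A]

theorem span_ne_top : Ideal.span (S.x '' (Finset.Ico 0 S.N)) ≠ ⊤ := by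
  intro h
  have : Ideal.span (S.x '' (Finset.Ico 0 S.N)) ≤ IsLocalRing.maximalIdeal A := by
    rw [Ideal.span_le]
    rintro _ ⟨i, hi, rfl⟩
    simp at hi
    exact S.nonunit i hi
  rw [h, top_le_iff] at this
  exact Ideal.IsPrime.ne_top' this

theorem chi_base : chi S 0 (A ⧸ Jsub S 0) = 1 := by
  have h1 : ∀ m : A ⧸ Jsub S 0, ∃ c : K, m = Submodule.Quotient.mk (algebraMap K A c) := by
    intro m
    obtain ⟨a, rfl⟩ := Submodule.mkQ_surjective _ m
    obtain ⟨c, g, rfl⟩ := S.decomp a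
    refine ⟨c, ?_⟩
    rw [Submodule.mkQ_apply, Submodule.Quotient.eq, add_sub_cancel_left, mem_Jsub]
    refine sum_mem fun i hi => Ideal.mul_mem_right _ _ (Ideal.subset_span ⟨i, by simpa using hi, rfl⟩)
  have h2 : ∀ m : A ⧸ Jsub S 0, (Sk.s : Sk A) • m = m := by
    intro m
    obtain ⟨c, rfl⟩ := h1 m
    rw [← Submodule.Quotient.mk_smul, Sk.s_smul_A, S.star_K]
  have h3 : (Submodule.Quotient.mk 1 : A ⧸ Jsub S 0) ≠ 0 := by
    rw [Ne, Submodule.Quotient.mk_eq_zero, mem_Jsub, ← Ideal.eq_top_iff_one]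
    exact span_ne_top S
  have e1 : ev S (A ⧸ Jsub S 0) = 1 := by
    rw [ev]
    norm_cast
    refine finrank_eq_one (⟨Kr.mk K A (Submodule.Quotient.mk 1), (mem_even S _).2 (h2 _)⟩ : even S (A ⧸ Jsub S 0)) ?_ ?_
    · intro h
      exact h3 (congrArg Subtype.val h)
    · rintro ⟨w, hw⟩
      obtain ⟨c, hc⟩ := h1 ((Kr.mk K A).symm w)
      refine ⟨c, ?_⟩
      ext
      change c • Kr.mk K A (Submodule.Quotient.mk 1) = w
      rw [Kr.smul_mk, ← Submodule.Quotient.mk_smul, Sk.of_smul_A, mul_one, ← hc]; rfl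
  have h4 : ∀ m : A ⧸ Jsub S 0, (Sk.s : Sk A) • Sh.mk m = Sh.mk m → m = 0 := by
    intro m hm
    rw [Sh.s_smul_mk, h2] at hm
    have h5 := Sh.mk.injective hm
    rw [neg_eq_iff_add_eq_zero, ← two_smul (Sk A)] at h5
    have : Sk.of (algebraMap K A (1/2)) * (2 : Sk A) = 1 := by
      rw [← map_ofNat Sk.of 2, ← map_mul, ← map_ofNat (algebraMap K A) 2, ← map_mul]
      norm_num
    have h6 := congrArg (fun z => Sk.of (algebraMap K A (1/2)) • z) h5
    simp only [smul_smul, smul_zero] at h6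
    rwa [this, one_smul] at h6
  have e2 : ev S (Sh (A ⧸ Jsub S 0)) = 0 := by
    rw [ev]
    norm_cast
    have : Subsingleton (even S (Sh (A ⧸ Jsub S 0))) := by
      refine subsingleton_of_forall_eq 0 ?_
      rintro ⟨w, hw⟩
      ext
      exact h4 _ hw
    exact Module.finrank_zero_of_subsingleton
  rw [chi, e1, e2]; rfl

theorem chi_Jsub (j : ℕ) (hj : j ≤ S.N) : chi S j (A ⧸ Jsub S j) = 1 := by
  induction j with
  | zero => exact chi_base S
  | succ j ih =>
    rw [chi_succ S j (C := A ⧸ Jsub S j) (D := PUnit.{u+1}) 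
      (Submodule.mapQ _ _ LinearMap.id (fun a ha => (Jsub_succ S j hj a).2 ⟨0, a, ha, by simp⟩)) ?_ ?_ 0
      (fun _ _ _ => rfl) ?_, ih (by omega), chi_subsingleton, sub_zero]
    · intro m
      obtain ⟨a, rfl⟩ := Submodule.mkQ_surjective _ m
      exact ⟨Submodule.Quotient.mk a, rfl⟩
    · intro m
      obtain ⟨a, rfl⟩ := Submodule.mkQ_surjective _ m
      change Submodule.Quotient.mk a = _ ↔ _
      rw [Submodule.Quotient.mk_eq_zero, Jsub_succ S j hj]
      constructor
      · rintro ⟨b, c, hc, rfl⟩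
        refine ⟨Submodule.Quotient.mk b, ?_⟩
        rw [← Submodule.Quotient.mk_smul, Submodule.mkQ_apply, Submodule.Quotient.eq, Sk.of_smul_A]
        simpa using hc
      · rintro ⟨b, hb⟩
        obtain ⟨b, rfl⟩ := Submodule.mkQ_surjective _ b
        rw [← map_smul, Submodule.mkQ_apply, Submodule.mkQ_apply, Submodule.Quotient.eq, Sk.of_smul_A] at hb
        exact ⟨b, _, hb, by ring⟩
    · intro m
      obtain ⟨a, rfl⟩ := Submodule.mkQ_surjective _ m
      constructor
      · rintro ⟨d, hd⟩
        have : 0 = (Jsub S (j+1)).mkQ a := hd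
        rw [← this, smul_zero]
      · intro h
        refine ⟨0, ?_⟩
        rw [← map_smul, Submodule.mkQ_apply, Submodule.Quotient.mk_eq_zero, Sk.of_smul_A, mem_Jsub] at h
        have h2 := S.reg (Finset.Ico (j+1) S.N) j a (by simp) hj (by simp) h
        rw [map_zero, Submodule.mkQ_apply, (Submodule.Quotient.mk_eq_zero _).2 ((mem_Jsub S _ _).2 h2), map_zero]

theorem chi_A : chi S S.N A = 1 := by
  rw [← chi_Jsub S S.N le_rfl]
  apply chi_congr
  refine (Submodule.quotEquivOfEqBot _ ?_).symm
  rw [eq_bot_iff]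
  intro a ha
  rw [mem_Jsub] at ha
  simpa using ha

theorem good_N (M : Type u) [AddCommGroup M] [Module (Sk A) M] [h : Module.Finite (Sk A) M] : Good S S.N M :=
  ⟨h, fun i h1 h2 => by omega⟩

instance : Module.Finite (Sk A) A := Module.Finite.of_restrictScalars_finite A (Sk A) A

variable {M M' M'' : Type u} [AddCommGroup M] [Module (Sk A) M] [AddCommGroup M'] [Module (Sk A) M']
  [AddCommGroup M''] [Module (Sk A) M'']

theorem chiN_add [Module.Finite (Sk A) M] {f : M' →ₗ[Sk A] M} {g : M →ₗ[Sk A] M''} (h : SES f g) :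
   chi S S.N M = chi S S.N M' + chi S S.N M'' := chi_add S _ (good_N S M) h

theorem chiN_prod [Module.Finite (Sk A) M] [Module.Finite (Sk A) M'] : chi S S.N (M × M') = chi S S.N M + chi S S.N M' :=
  chiN_add S (f := LinearMap.inl (Sk A) M M') (g := LinearMap.snd (Sk A) M M') 
   ⟨LinearMap.inl_injective, fun m => by
     constructor
     · intro h; exact ⟨m.1, Prod.ext rfl h.symm⟩
     · rintro ⟨a, rfl⟩; rfl, LinearMap.snd_surjective⟩

/-- Free super module -/
abbrev Fr (A : Type u) (a b : ℕ) := (Fin a → A) × (Fin b → Sh A)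

theorem finite_iff_A [Module A M] [IsScalarTower A (Sk A) M] : Module.Finite (Sk A) M ↔ Module.Finite A M :=
  ⟨fun _ => Module.Finite.trans (Sk A) M, fun _ => Module.Finite.of_restrictScalars_finite A (Sk A) M⟩
end Berg

set_option linter.unusedSectionVars false
namespace Berg
open Function
variable {K A : Type u} [Field K] [CommRing A] [StarRing A] [Algebra K A] (S : Setup K A)
  [CharZero K] [IsNoetherianRing A] [IsLocalRing A]

/-- the quadratic form -/
def qq (n : ℕ) : A := ∑ i ∈ Finset.range n, S.x (2*i) * S.x (2*i+1)

theorem star_qq (n : ℕ) : star (qq S n) = qq S n := by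
  rw [qq, star_sum]
  refine Finset.sum_congr rfl fun i _ => ?_
  rw [star_mul', S.star_x, S.star_x]; ring

variable {M M' M'' : Type u} [AddCommGroup M] [Module (Sk A) M] [AddCommGroup M'] [Module (Sk A) M']
  [AddCommGroup M''] [Module (Sk A) M'']

/-- Clifford data -/
structure Cliff (j : ℕ) (W : Type u) [AddCommGroup W] [Module (Sk A) W] where
  U : W →+ W
  lin : ∀ (a : A) w, U (Sk.of a • w) = Sk.of a • U w
  odd : ∀ w, U ((Sk.s : Sk A) • w) = - ((Sk.s : Sk A) • U w)
  sq : ∀ w, U (U w) = Sk.of (qq S j) • w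
  h : ∀ i < 2 * j, ∃ h : W →+ W, (∀ (a : A) w, h (Sk.of a • w) = Sk.of a • h w) ∧
    ∀ w, U (h w) + h (U w) = Sk.of (S.x i) • w

/-- scalar additive map -/
def sc (a : A) (W : Type u) [AddCommGroup W] [Module (Sk A) W] : W →+ W := DistribSMul.toAddMonoidHom W (Sk.of a)
@[simp] theorem sc_apply (a : A) (w : M) : sc a M w = Sk.of a • w := rfl

theorem of_comm (a b : A) (w : M) : Sk.of a • Sk.of b • w = Sk.of b • Sk.of a • w := by
  rw [smul_smul, smul_smul, ← map_mul, ← map_mul, mul_comm]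

/-- inductive step -/
def Cliff.step {j : ℕ} (c : Cliff S j M) : Cliff S (j+1) (M × M) where
  U := { toFun := fun p => (c.U p.1 + Sk.of (S.x (2*j)) • p.2, Sk.of (S.x (2*j+1)) • p.1 - c.U p.2)
         map_zero' := by simp
         map_add' := fun p p' => by
          ext
          · simp; abel
          · simp; abel }
  lin a w := by
    ext
    · simp [c.lin, of_comm a]
    · simp [c.lin, of_comm a, smul_sub]
  odd w := by
    have h : ∀ i (m : M), Sk.of (S.x i) • (Sk.s : Sk A) • m = - ((Sk.s : Sk A) • Sk.of (S.x i) • m) := by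
      intro i m
      rw [smul_smul, smul_smul, Sk.s_mul_of, S.star_x, map_neg, neg_mul, neg_smul, neg_neg]
    ext
    · simp [c.odd, h]; abel
    · simp [c.odd, h, smul_sub]; abel
  sq w := by
    have : qq S (j+1) = qq S j + S.x (2*j) * S.x (2*j+1) := by rw [qq, Finset.sum_range_succ]; rfl
    ext
    · simp only [AddMonoidHom.coe_mk, ZeroHom.coe_mk, map_add, c.sq, c.lin, smul_sub, this, Prod.smul_fst, Prod.fst_add, add_smul, map_mul, mul_smul]
      abel
    · simp only [AddMonoidHom.coe_mk, ZeroHom.coe_mk, map_sub, c.sq, c.lin, smul_sub, this, Prod.smul_snd, Prod.snd_add, add_smul, map_mul, mul_smul, smul_add, map_add, of_comm (S.x (2*j+1))]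
      abel
  h i hi := by
    rcases (by omega : i < 2 * j ∨ i = 2*j ∨ i = 2*j+1) with hi | rfl | rfl
    · obtain ⟨h, h1, h2⟩ := c.h i hi
      refine ⟨{ toFun := fun p => (h p.1, - h p.2), map_zero' := (by simp), map_add' := (fun p p' => by
                  ext
                  · simp
                  · simp; abel) }, fun a w => ?_, fun w => ?_⟩
      · ext <;> simp [h1]
      · ext
        · simp [h1, ← h2]
          abel
        · simp [h1, ← h2]
          abel
    · refine ⟨{ toFun := fun p => (0, p.1), map_zero' := (by simp), map_add' := (fun p p' => by simp) }, fun a w => ?_, fun w => ?_⟩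
      · ext <;> simp
      · ext <;> simp
    · refine ⟨{ toFun := fun p => (p.2, 0), map_zero' := (by simp), map_add' := (fun p p' => by simp) }, fun a w => ?_, fun w => ?_⟩
      · ext <;> simp
      · ext <;> simp

theorem exists_cliff [Module.Finite (Sk A) M] (j : ℕ) : ∃ (W : Type u) (_ : AddCommGroup W) (_ : Module (Sk A) W),
    Module.Finite (Sk A) W ∧ chi S S.N W = 2 ^ j * chi S S.N M ∧
    (∀ c : A, (∀ m : M, Sk.of c • m = 0) → ∀ w : W, Sk.of c • w = 0) ∧ Nonempty (Cliff S j W) := by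
  induction j with
  | zero =>
    exact ⟨M, inferInstance, inferInstance, inferInstance, by simp, fun c h => h, ⟨⟨0, by simp, by simp, by simp [qq], by simp⟩⟩⟩
  | succ j ih =>
    obtain ⟨W, _, _, _, h1, h2, ⟨c⟩⟩ := ih
    refine ⟨W × W, inferInstance, inferInstance, inferInstance, ?_, fun c h w => ?_, ⟨c.step⟩⟩
    · rw [chiN_prod, h1]; ring
    · ext
      · exact h2 c h _
      · exact h2 c h _

theorem chi_qkill [Module.Finite (Sk A) M] (n : ℕ) (hN : S.N = 2 * n) (hq : ∀ m : M, Sk.of (qq S n) • m = 0) :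
    (2:ℤ) ^ n ∣ chi S S.N M := by
  obtain ⟨W, _, _, _, h1, h2, ⟨c⟩⟩ := exists_cliff S (M := M) n
  have hq := h2 _ hq
  let U1 : W →ₗ[Sk A] Sh W := Sk.mkLin (fun w => Sh.mk (c.U w)) (by simp) (fun a m => by simp [c.lin]) (fun m => by simp [c.odd])
  let U2 : Sh W →ₗ[Sk A] W := Sk.mkLin (fun w => c.U (Sh.mk.symm w)) (by simp) (fun a m => by simp [c.lin]) (fun m => by simp [c.odd])
  let P : Submodule (Sk A) W := LinearMap.ker U1
  let R : Submodule (Sk A) W := LinearMap.range U2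
  have hRP : R ≤ P := by
    rintro _ ⟨w, rfl⟩
    change Sh.mk (c.U (c.U (Sh.mk.symm w))) = 0
    rw [c.sq, hq, map_zero]
  have e1 : SES P.subtype ((Sh.map U2.rangeRestrict).comp (Sh.dbl (A := A) (M := W)).toLinearMap) := by
    refine ⟨Submodule.injective_subtype _, fun m => ?_, ?_⟩
    · constructor
      · intro h
        have h3 : c.U m = 0 := congrArg Subtype.val h
        exact ⟨⟨m, h3⟩, rfl⟩
      · rintro ⟨m, rfl⟩
        exact Subtype.ext (m.2 : c.U m.1 = 0)
    · rw [LinearMap.coe_comp]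
      exact Surjective.comp (LinearMap.surjective_rangeRestrict U2 : _) (LinearEquiv.surjective _)
  have e2 := SES.sub (R.comap P.subtype)
  have i1 : Module.Finite (Sk A) P := (good_N S W).sub P.subtype (Submodule.injective_subtype _) |>.fin
  have r1 := chiN_add S e1
  have r2 := chiN_add S e2
  rw [chi_sh] at r1
  rw [chi_congr S _ (Submodule.comapSubtypeEquivOfLe hRP)] at r2
  have r3 := chi_killed S (M := P ⧸ R.comap P.subtype) S.N (by
    intro i hi m
    obtain ⟨m, rfl⟩ := Submodule.mkQ_surjective _ m
    rw [← map_smul, Submodule.mkQ_apply, Submodule.Quotient.mk_eq_zero]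
    obtain ⟨h, -, h2⟩ := c.h i (hN ▸ hi)
    have h4 := h2 m.1
    rw [show c.U m.1 = 0 from m.2, map_zero, add_zero] at h4
    exact ⟨Sh.mk (h m.1), h4⟩)
  obtain ⟨z, hz⟩ := r3
  refine ⟨z, ?_⟩
  have h5 : (2:ℤ)^n * chi S S.N M = 2^n * (2^n * z) := by
    rw [← h1, ← mul_assoc, ← pow_add, ← two_mul, ← hN, ← hz]
    linarith
  exact mul_left_cancel₀ (by positivity) h5

theorem chi_qkill_pow (n : ℕ) (hN : S.N = 2 * n) (t : ℕ) : ∀ {M : Type u} [AddCommGroup M] [Module (Sk A) M] [Module.Finite (Sk A) M]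
   (_ : ∀ m : M, Sk.of (qq S n ^ t) • m = 0), (2:ℤ) ^ n ∣ chi S S.N M := by
  induction t with
  | zero =>
    intro M _ _ _ h
    have : Subsingleton M := subsingleton_of_forall_eq 0 (fun m => by simpa using h m)
    rw [chi_subsingleton]; exact dvd_zero _
  | succ t ih =>
    intro M _ _ _ h
    let Q : M →ₗ[Sk A] M := Sk.mkLin (fun m => Sk.of (qq S n) • m) (by simp) (fun a m => by rw [of_comm]) (fun m => by
      rw [smul_smul, smul_smul, Sk.s_mul_of, star_qq])
    have e := SES.ker Q
    rw [chiN_add S e]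
    have i1 : Module.Finite (Sk A) (LinearMap.ker Q) := (good_N S M).sub (LinearMap.ker Q).subtype (Submodule.injective_subtype _) |>.fin
    have i2 : Module.Finite (Sk A) (LinearMap.range Q) := (good_N S M).sub (LinearMap.range Q).subtype (Submodule.injective_subtype _) |>.fin
    refine dvd_add (chi_qkill S n hN ?_) (ih ?_)
    · rintro ⟨m, hm⟩
      ext
      exact hm
    · rintro ⟨_, ⟨m, rfl⟩⟩
      ext
      change Sk.of (qq S n ^ t) • Sk.of (qq S n) • m = 0
      rw [smul_smul, ← map_mul, ← pow_succ, h]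

/-- multiplication by an even element -/
def qm (Q : A) (hQ : star Q = Q) (M : Type u) [AddCommGroup M] [Module (Sk A) M] : M →ₗ[Sk A] M :=
  Sk.mkLin (fun m => Sk.of Q • m) (by simp) (fun a m => by rw [of_comm]) (fun m => by
      rw [smul_smul, smul_smul, Sk.s_mul_of, hQ])
@[simp] theorem qm_apply (Q : A) (hQ : star Q = Q) (m : M) : qm Q hQ M m = Sk.of Q • m := rfl

/-- isogeny -/
def Iso (Q : A) (M M' : Type u) [AddCommGroup M] [Module (Sk A) M] [AddCommGroup M'] [Module (Sk A) M'] : Prop :=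
  ∃ (f : M →ₗ[Sk A] M') (g : M' →ₗ[Sk A] M) (t : ℕ), (∀ m, g (f m) = Sk.of (Q ^ t) • m) ∧ (∀ m, f (g m) = Sk.of (Q ^ t) • m)

theorem Iso.symm {Q : A} (h : Iso Q M M') : Iso Q M' M := by
  obtain ⟨f, g, t, h1, h2⟩ := h
  exact ⟨g, f, t, h2, h1⟩
theorem Iso.trans {Q : A} (h : Iso Q M M') (h' : Iso Q M' M'') : Iso Q M M'' := by
  obtain ⟨f, g, t, h1, h2⟩ := h
  obtain ⟨f', g', t', h1', h2'⟩ := h'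
  refine ⟨f'.comp f, g.comp g', t' + t, fun m => ?_, fun m => ?_⟩
  · rw [LinearMap.comp_apply, LinearMap.comp_apply, h1', map_smul, h1, smul_smul, ← map_mul, pow_add]
  · rw [LinearMap.comp_apply, LinearMap.comp_apply, h2, map_smul, h2', smul_smul, ← map_mul, add_comm, pow_add]
theorem Iso.of_equiv {Q : A} (e : M ≃ₗ[Sk A] M') : Iso Q M M' := ⟨e, e.symm, 0, by simp, by simp⟩
theorem star_pow_fix {Q : A} (hQ : star Q = Q) (t : ℕ) : star (Q ^ t) = Q ^ t := by rw [star_pow, hQ]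
theorem Iso.prod {P P' : Type u} [AddCommGroup P] [Module (Sk A) P] [AddCommGroup P'] [Module (Sk A) P'] {Q : A} (hQ : star Q = Q)
    (h : Iso Q M M') (h' : Iso Q P P') : Iso Q (M × P) (M' × P') := by
  obtain ⟨f, g, t, h1, h2⟩ := h
  obtain ⟨f', g', t', h1', h2'⟩ := h'
  refine ⟨((qm (Q ^ t') (star_pow_fix hQ t') M').comp f).prodMap ((qm (Q ^ t) (star_pow_fix hQ t) P').comp f'), g.prodMap g', 
    t + t', fun m => ?_, fun m => ?_⟩
  · refine Prod.ext ?_ ?_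
    · change g (Sk.of (Q ^ t') • f m.1) = Sk.of (Q ^ (t + t')) • m.1
      rw [map_smul, h1, smul_smul, ← map_mul, ← pow_add, add_comm]
    · change g' (Sk.of (Q ^ t) • f' m.2) = Sk.of (Q ^ (t + t')) • m.2
      rw [map_smul, h1', smul_smul, ← map_mul, ← pow_add]
  · refine Prod.ext ?_ ?_
    · change Sk.of (Q ^ t') • f (g m.1) = Sk.of (Q ^ (t + t')) • m.1
      rw [h2, smul_smul, ← map_mul, ← pow_add, add_comm]
    · change Sk.of (Q ^ t) • f' (g' m.2) = Sk.of (Q ^ (t + t')) • m.2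
      rw [h2', smul_smul, ← map_mul, ← pow_add]

theorem Iso.chi {n : ℕ} (hN : S.N = 2 * n) [Module.Finite (Sk A) M] [Module.Finite (Sk A) M'] (h : Iso (qq S n) M M') :
    (2 : ℤ) ^ n ∣ chi S S.N M - chi S S.N M' := by
  obtain ⟨f, g, t, h1, h2⟩ := h
  have r1 := chiN_add S (SES.ker f)
  have r2 := chiN_add S (SES.sub (LinearMap.range f))
  have i1 : Module.Finite (Sk A) (LinearMap.ker f) := (good_N S M).sub (LinearMap.ker f).subtype (Submodule.injective_subtype _) |>.fin
  have r3 := chi_qkill_pow S n hN t (M := LinearMap.ker f) (by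
    rintro ⟨m, hm⟩
    ext
    change Sk.of (qq S n ^ t) • m = 0
    rw [← h1, show f m = 0 from hm, map_zero])
  have r4 := chi_qkill_pow S n hN t (M := M' ⧸ LinearMap.range f) (by
    intro m
    obtain ⟨m, rfl⟩ := Submodule.mkQ_surjective _ m
    rw [← map_smul, Submodule.mkQ_apply, Submodule.Quotient.mk_eq_zero, ← h2]
    exact ⟨_, rfl⟩)
  rw [r1, r2]
  obtain ⟨y, hy⟩ := r3
  obtain ⟨z, hz⟩ := r4
  refine ⟨y - z, ?_⟩
  rw [mul_sub]
  linarith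
end Berg

set_option linter.unusedSectionVars false
namespace Berg
open Function

section basic
variable {A : Type u} [CommRing A] [StarRing A] {ι : Type} 

/-- graded free module -/
def Fx (A : Type u) {ι : Type} (_ε : ι → ℤˣ) : Type u := ι → A
variable {ε : ι → ℤˣ}
instance : AddCommGroup (Fx A ε) := inferInstanceAs (AddCommGroup (ι → A))
instance : Module A (Fx A ε) := inferInstanceAs (Module A (ι → A))
instance [Finite ι] : Module.Finite A (Fx A ε) := inferInstanceAs (Module.Finite A (ι → A))
instance [Finite ι] : Module.Free A (Fx A ε) := inferInstanceAs (Module.Free A (ι → A))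

/-- star on it -/
def Fx.t : Fx A ε →+ Fx A ε where
  toFun p i := ε i • star (p i)
  map_zero' := by funext i; change ε i • star (0 : A) = 0; simp
  map_add' p q := by funext i; change ε i • star (p i + q i) = ε i • star (p i) + ε i • star (q i); simp [smul_add]

theorem unit_cases (e : ℤˣ) : e = 1 ∨ e = -1 := Int.units_eq_one_or e

instance : Module (Sk A) (Fx A ε) := Sk.mkModule Fx.t
  (fun p => by
    funext i
    change ε i • star (ε i • star (p i)) = p i
    rcases unit_cases (ε i) with h | h <;> rw [h] <;> simp [Units.smul_def])
  (fun a p => by funext i; change ε i • star (a * p i) = star a * ε i • star (p i); rw [mul_smul_comm, star_mul'])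
theorem Fx.smul_apply (b : Sk A) (p : Fx A ε) (i : ι) : (b • p) i = b.re * p i + b.im * (ε i • star (p i)) := rfl
theorem Fx.of_smul (a : A) (p : Fx A ε) (i : ι) : (Sk.of a • p) i = a * p i := by simp [Fx.smul_apply]
theorem Fx.s_smul (p : Fx A ε) (i : ι) : ((Sk.s : Sk A) • p) i = ε i • star (p i) := by simp [Fx.smul_apply]
@[ext] theorem Fx.ext {p q : Fx A ε} (h : ∀ i, p i = q i) : p = q := funext h
@[simp] theorem Fx.add_apply (p q : Fx A ε) (i : ι) : (p + q) i = p i + q i := rfl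
@[simp] theorem Fx.zero_apply (i : ι) : (0 : Fx A ε) i = 0 := rfl
theorem Fx.asmul_apply (a : A) (p : Fx A ε) (i : ι) : (a • p) i = a * p i := rfl
instance : IsScalarTower A (Sk A) (Fx A ε) := ⟨fun a b p => by
  ext i
  simp [Sk.smul_def, Fx.smul_apply, Fx.asmul_apply]; ring⟩
instance [Finite ι] : Module.Finite (Sk A) (Fx A ε) := Module.Finite.of_restrictScalars_finite A (Sk A) _

variable {M N : Type u} [AddCommGroup M] [Module (Sk A) M] [AddCommGroup N] [Module (Sk A) N]

theorem sk_usmul (b : Sk A) (e : ℤˣ) (m : M) : b • e • m = e • b • m := by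
  rcases unit_cases e with h | h <;> rw [h] <;> simp [Units.smul_def]

variable [Fintype ι]
/-- map out of a free module -/
def frMap (e : ι → M) (he : ∀ i, (Sk.s : Sk A) • e i = ε i • e i) : Fx A ε →ₗ[Sk A] M :=
  Sk.mkLin (fun p => ∑ i, Sk.of (p i) • e i)
    (fun p q => by simp [add_smul, Finset.sum_add_distrib])
    (fun a p => by simp [Fx.of_smul, Finset.smul_sum, mul_smul])
    (fun p => by
      simp only [Fx.s_smul, Finset.smul_sum]
      refine Finset.sum_congr rfl fun i _ => ?_
      rw [smul_smul, Sk.s_mul_of, mul_smul, he, sk_usmul]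
      rcases unit_cases (ε i) with h | h <;> rw [h] <;> simp [Units.smul_def])
@[simp] theorem frMap_apply (e : ι → M) (he : ∀ i, (Sk.s : Sk A) • e i = ε i • e i) (p : Fx A ε) :
   frMap e he p = ∑ i, Sk.of (p i) • e i := rfl

variable [DecidableEq ι]
/-- basis -/
def bas (i : ι) : Fx A ε := fun j => if j = i then 1 else 0
theorem s_bas (i : ι) : (Sk.s : Sk A) • (bas i : Fx A ε) = ε i • bas i := by
  have : ∀ j, (ε i • (bas i : Fx A ε)) j = ε i • (bas i : Fx A ε) j := by
    intro j
    rcases unit_cases (ε i) with h | h <;> rw [h] <;> simp [Units.smul_def]; rfl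
  ext j
  rw [Fx.s_smul, this, bas]
  split_ifs with h <;> simp [h]
theorem sum_bas (p : Fx A ε) : p = ∑ i, Sk.of (p i) • (bas i : Fx A ε) := by
  ext j
  have : ∀ (f : ι → Fx A ε), (∑ i, f i) j = ∑ i, f i j := fun f => Finset.sum_apply (M := fun _ => A) j _ f
  rw [this]
  refine Eq.trans ?_ (Finset.sum_eq_single j ?_ ?_).symm
  · simp [Fx.of_smul, bas]
  · intro b _ hb; simp [Fx.of_smul, bas, hb.symm]
  · simp
theorem map_eq (f : Fx A ε →ₗ[Sk A] M) (p) : f p = ∑ i, Sk.of (p i) • f (bas i) := by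
  conv_lhs => rw [sum_bas p]
  simp
end basic

variable {K A : Type u} [Field K] [CommRing A] [StarRing A] [Algebra K A] (S : Setup K A)
  [CharZero K] [IsNoetherianRing A] [IsLocalRing A]
variable {M M' F : Type u} [AddCommGroup M] [Module (Sk A) M] [AddCommGroup M'] [Module (Sk A) M']
  [AddCommGroup F] [Module (Sk A) F]

theorem s_smul_s (m : M) : (Sk.s : Sk A) • (Sk.s : Sk A) • m = m := by rw [smul_smul, Sk.s_mul_s, one_smul]

/-- one half -/
def hf (K A : Type u) [Field K] [CommRing A] [StarRing A] [Algebra K A] : A := algebraMap K A (1/2)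
theorem star_hf (S : Setup K A) : star (hf K A) = hf K A := S.star_K _
theorem hf_two (m : M) : Sk.of (hf K A) • (m + m) = m := by
  rw [smul_add, ← add_smul, ← map_add, hf, ← map_add]
  norm_num
theorem s_hf (S : Setup K A) (m : M) : (Sk.s : Sk A) • Sk.of (hf K A) • m = Sk.of (hf K A) • (Sk.s : Sk A) • m := by
  rw [smul_smul, Sk.s_mul_of, star_hf S, mul_smul]

theorem proj_lift (S : Setup K A) {ι : Type} [Fintype ι] {ε : ι → ℤˣ} (f : M →ₗ[Sk A] M') (hf' : Surjective f) (π : Fx A ε →ₗ[Sk A] M') :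
    ∃ π' : Fx A ε →ₗ[Sk A] M, ∀ p, f (π' p) = π p := by
  classical
  have : ∀ i, ∃ y : M, (Sk.s : Sk A) • y = ε i • y ∧ f y = π (bas i) := by
    intro i
    obtain ⟨y, hy⟩ := hf' (π (bas i))
    refine ⟨Sk.of (hf K A) • (y + ε i • (Sk.s : Sk A) • y), ?_, ?_⟩
    · have key : (Sk.s : Sk A) • (y + ε i • (Sk.s : Sk A) • y) = ε i • (y + ε i • (Sk.s : Sk A) • y) := by
        rw [smul_add, sk_usmul, s_smul_s, smul_add, smul_smul, Int.units_mul_self, one_smul, add_comm]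
      rw [s_hf S, key, sk_usmul]
    · have : f (ε i • (Sk.s : Sk A) • y) = π (bas i) := by
        have h : f (ε i • (Sk.s : Sk A) • y) = ε i • (Sk.s : Sk A) • f y := by
          rw [← map_smul]
          rcases unit_cases (ε i) with h | h <;> rw [h] <;> simp [Units.smul_def]
        rw [h, hy, ← map_smul, s_bas]
        have h : ∀ e : ℤˣ, ∀ m, π (e • m) = e • π m := by
          intro e m
          rcases unit_cases e with h | h <;> rw [h] <;> simp [Units.smul_def]
        rw [h, smul_smul, Int.units_mul_self, one_smul]
      rw [map_smul, map_add, hy, this, hf_two]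
  choose e he1 he2 using this
  refine ⟨frMap e he1, fun p => ?_⟩
  rw [map_eq π, frMap_apply, map_sum]
  simp [he2]

/-- surjective covers of given size -/
def Cov (A : Type u) [CommRing A] [StarRing A] (M : Type u) [AddCommGroup M] [Module (Sk A) M] (c : ℕ) : Prop :=
  ∃ (ι : Type) (_ : Fintype ι) (ε : ι → ℤˣ) (e : ι → M) (he : ∀ i, (Sk.s : Sk A) • e i = ε i • e i),
   Fintype.card ι = c ∧ Surjective (frMap (A := A) e he)

theorem exists_cov (_S : Setup K A) [h : Module.Finite (Sk A) M] : ∃ c, Cov A M c := by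
  obtain ⟨t, g, hg⟩ := Module.Finite.exists_fin (R := Sk A) (M := M)
  refine ⟨_, Fin t × ℤˣ, inferInstance, fun i => i.2, fun i => g i.1 + i.2 • (Sk.s : Sk A) • g i.1, ?_, rfl, ?_⟩
  · rintro ⟨i, e⟩
    simp only
    rw [smul_add, sk_usmul, s_smul_s, smul_add, smul_smul, Int.units_mul_self, one_smul, add_comm]
  · rw [← LinearMap.range_eq_top, eq_top_iff, ← hg, Submodule.span_le]
    rintro _ ⟨i, rfl⟩
    generalize hF : frMap (A := A) (fun i : Fin t × ℤˣ => g i.1 + i.2 • (Sk.s : Sk A) • g i.1) _ = F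
    have h1 : ∀ e : ℤˣ, F (bas (i, e)) = g i + e • (Sk.s : Sk A) • g i := by
      intro e
      rw [← hF, frMap_apply, Finset.sum_eq_single (i, e)]
      · simp [bas]
      · intro b _ hb; simp [bas, hb]
      · simp
    refine ⟨Sk.of (hf K A) • (bas (i,1) + bas (i,-1)), ?_⟩
    rw [map_smul, map_add, h1, h1]
    conv_rhs => rw [← hf_two (K := K) (A := A) (g i)]
    congr 1
    simp [Units.smul_def]
    abel

/-- minimal covers -/
theorem exists_min (S : Setup K A) [h : Module.Finite (Sk A) M] : ∃ (ι : Type) (_ : Fintype ι) (ε : ι → ℤˣ) (f : Fx A ε →ₗ[Sk A] M),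
    Surjective f ∧ ∀ p, f p = 0 → ∀ i, ¬ IsUnit (p i) := by
  classical
  have h := exists_cov S (M := M)
  obtain ⟨ι, _, ε, e, he, hc, hs⟩ := Nat.find_spec h
  refine ⟨ι, inferInstance, ε, frMap e he, hs, fun p hp i hi => ?_⟩
  have hmin := Nat.find_min h (m := Fintype.card {j // j ≠ i}) (by
    rw [← hc]; exact Fintype.card_subtype_lt (x := i) (by simp))
  apply hmin
  refine ⟨{j // j ≠ i}, inferInstance, fun j => ε j, fun j => e j, fun j => he j, rfl, ?_⟩
  rw [← LinearMap.range_eq_top, eq_top_iff]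
  generalize hF : frMap (A := A) (fun j : {j // j ≠ i} => e j) _ = F
  have h1 : ∀ j, j ≠ i → e j ∈ LinearMap.range F := by
    intro j hj
    refine ⟨bas ⟨j, hj⟩, ?_⟩
    rw [← hF, frMap_apply, Finset.sum_eq_single ⟨j, hj⟩]
    · simp [bas]
    · intro b _ hb; simp [bas, hb]
    · simp
  have h2 : e i ∈ LinearMap.range F := by
    obtain ⟨u, hu⟩ := hi
    rw [frMap_apply, ← Finset.add_sum_erase _ _ (Finset.mem_univ i), ← hu] at hp
    have : e i = Sk.of (↑u⁻¹ : A) • Sk.of (u : A) • e i := by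
      rw [smul_smul, ← map_mul]; simp
    rw [this]
    apply Submodule.smul_mem
    rw [eq_neg_of_add_eq_zero_left hp]
    refine neg_mem (sum_mem fun j hj => Submodule.smul_mem _ _ (h1 j (Finset.ne_of_mem_erase hj)))
  intro m _
  obtain ⟨p, rfl⟩ := hs m
  rw [frMap_apply]
  refine sum_mem fun j hj => Submodule.smul_mem _ _ ?_
  by_cases hj : j = i
  · rw [hj]; exact h2
  · exact h1 j hj

/-- membership in the partial ideal times M -/
def inI (l : ℕ) (m : M) : Prop := ∃ g : ℕ → M, m = ∑ i ∈ Finset.range l, Sk.of (S.x i) • g i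
/-- regular sequence -/
def Reg (l : ℕ) (M : Type u) [AddCommGroup M] [Module (Sk A) M] : Prop :=
  ∀ j < l, ∀ m : M, inI S j (Sk.of (S.x j) • m) → inI S j m

theorem R1 (f : F →ₗ[Sk A] M) (hf : Surjective f) (l : ℕ) : ∀ (_ : Reg S l M) (y : F) (_ : f y = 0) (_ : inI S l y),
   ∃ g : ℕ → F, (∀ i, f (g i) = 0) ∧ y = ∑ i ∈ Finset.range l, Sk.of (S.x i) • g i := by
  induction l with
  | zero => 
    rintro - y - ⟨g, rfl⟩
    exact ⟨0, by simp, by simp⟩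
  | succ l ih =>
    rintro hR y hy ⟨g, hg⟩
    rw [Finset.sum_range_succ] at hg
    have h1 : inI S l (f (g l)) := by
      apply hR l (by omega)
      rw [hg, map_add, map_sum, map_smul] at hy
      refine ⟨fun i => - f (g i), ?_⟩
      rw [← neg_eq_of_add_eq_zero_right hy]
      simp
    obtain ⟨h, hh⟩ := h1
    choose k hk using fun i => hf (h i)
    have hz : f (g l - ∑ i ∈ Finset.range l, Sk.of (S.x i) • k i) = 0 := by
      rw [map_sub, hh, map_sum]; simp [hk]
    obtain ⟨g', hg1, hg2⟩ := ih (fun j hj => hR j (by omega)) (y - Sk.of (S.x l) • (g l - ∑ i ∈ Finset.range l, Sk.of (S.x i) • k i))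
      (by rw [map_sub, hy, map_smul, hz]; simp) 
      ⟨fun i => g i + Sk.of (S.x l) • k i, by
        rw [hg]
        simp only [smul_add, smul_sub, Finset.sum_add_distrib, Finset.smul_sum, of_comm (S.x l)]
        abel⟩
    refine ⟨fun i => if i = l then (g l - ∑ i ∈ Finset.range l, Sk.of (S.x i) • k i) else g' i, ?_, ?_⟩
    · intro i
      beta_reduce
      split_ifs
      · exact hz
      · exact hg1 i
    · beta_reduce
      rw [Finset.sum_range_succ, if_pos rfl, ← sub_eq_iff_eq_add, hg2]
      refine Finset.sum_congr rfl fun i hi => ?_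
      rw [if_neg]
      simp at hi; omega

theorem R2 (f : F →ₗ[Sk A] M) (hf : Surjective f) (l : ℕ) (h1 : Reg S l M) (h2 : Reg S (l+1) F) :
    Reg S (l+1) (LinearMap.ker f) := by
  rintro j hj ⟨m, hm⟩ ⟨g, hg⟩
  have hg' : Sk.of (S.x j) • m = _ := congrArg (LinearMap.ker f).subtype hg
  rw [map_sum] at hg'
  have h3 := h2 j hj m ⟨fun i => (g i : F), hg'⟩
  obtain ⟨g', hg1, hg2⟩ := R1 S f hf j (fun i hi => h1 i (by omega)) m hm h3
  exact ⟨fun i => ⟨g' i, hg1 i⟩, by ext; simp [hg2]⟩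

theorem R3 [Module.Finite (Sk A) F] (f : F →ₗ[Sk A] M) (hf : Surjective f) (h1 : Reg S S.N M)
   (h2 : ∀ y, f y = 0 → inI S S.N y) (y : F) (hy : f y = 0) : y = 0 := by
  let _ : Module A F := Module.compHom F (Sk.of (A := A))
  have : IsScalarTower A (Sk A) F := ⟨fun a b m => by
    change (Sk.of a * b) • m = Sk.of a • b • m
    rw [mul_smul]⟩
  have : Module.Finite A F := finite_iff_A.1 inferInstance
  have : IsNoetherian A F := isNoetherian_of_isNoetherianRing_of_finite A F
  let P : Submodule A F := (LinearMap.ker f).restrictScalars A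
  have hP : P = ⊥ := by
    apply Submodule.eq_bot_of_le_smul_of_le_jacobson_bot (IsLocalRing.maximalIdeal A) P (IsNoetherian.noetherian P)
    · intro m hm
      obtain ⟨g, hg1, hg2⟩ := R1 S f hf S.N h1 m hm (h2 m hm)
      rw [hg2]
      refine sum_mem fun i hi => ?_
      rw [Sk.of_smul]
      exact Submodule.smul_mem_smul (S.nonunit i (by simpa using hi)) (hg1 i)
    · rw [IsLocalRing.jacobson_eq_maximalIdeal _ bot_ne_top]
  have : y ∈ P := hy
  rw [hP] at this
  exact this

theorem inI_Fx {ι : Type} {ε : ι → ℤˣ} (l : ℕ) (p : Fx A ε) : inI S l p ↔ ∀ i, p i ∈ Ideal.span (S.x '' (Finset.range l)) := by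
  have hs : ∀ (f : ℕ → Fx A ε) (s : Finset ℕ) i, (∑ k ∈ s, f k) i = ∑ k ∈ s, f k i := fun f s i => Finset.sum_apply (M := fun _ => A) i _ f
  constructor
  · rintro ⟨g, rfl⟩ i
    rw [hs]
    refine sum_mem fun k hk => ?_
    rw [Fx.of_smul]
    exact Ideal.mul_mem_right _ _ (Ideal.subset_span ⟨k, hk, rfl⟩)
  · intro h
    have : ∀ i, ∃ g : ℕ → A, p i = ∑ k ∈ Finset.range l, S.x k * g k := by
      intro i
      have h1 := h i
      revert h1
      generalize p i = a
      intro h2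
      induction h2 using Submodule.span_induction with
      | mem x hx =>
        obtain ⟨k, hk, rfl⟩ := hx
        exact ⟨fun j => if j = k then 1 else 0, by simp at hk; simp [hk]⟩
      | zero => exact ⟨0, by simp⟩
      | add x y _ _ h1 h2 =>
        obtain ⟨g1, rfl⟩ := h1
        obtain ⟨g2, rfl⟩ := h2
        exact ⟨g1 + g2, by simp [mul_add, Finset.sum_add_distrib]⟩
      | smul c x _ h =>
        obtain ⟨g1, rfl⟩ := h
        exact ⟨fun k => c * g1 k, by simp [Finset.mul_sum, mul_left_comm]⟩
    choose g hg using this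
    refine ⟨fun k i => g i k, ?_⟩
    ext i
    rw [hs, hg]
    exact Finset.sum_congr rfl fun k _ => (Fx.of_smul (S.x k) (show Fx A ε from fun i => g i k) i).symm

theorem Reg_Fx {ι : Type} {ε : ι → ℤˣ} (l : ℕ) (hl : l ≤ S.N) : Reg S l (Fx A ε) := by
  intro j hj p hp
  rw [inI_Fx] at *
  intro i
  have h := hp i
  rw [Fx.of_smul] at h
  exact S.reg _ j _ (by simp; omega) (by omega) (by simp) h

theorem nonunit_mem (a : A) (ha : ¬ IsUnit a) : a ∈ Ideal.span (S.x '' (Finset.range S.N)) := by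
  obtain ⟨c, g, rfl⟩ := S.decomp a
  have h1 : ∑ i ∈ Finset.range S.N, S.x i * g i ∈ Ideal.span (S.x '' (Finset.range S.N)) :=
    sum_mem fun i hi => Ideal.mul_mem_right _ _ (Ideal.subset_span ⟨i, hi, rfl⟩)
  by_cases hc : c = 0
  · simpa [hc] using h1
  · exfalso
    have hle : Ideal.span (S.x '' (Finset.range S.N)) ≤ IsLocalRing.maximalIdeal A := by
      rw [Ideal.span_le]
      rintro _ ⟨i, hi, rfl⟩
      simp at hi
      exact S.nonunit i hi
    have h2 := hle h1
    have h3 : algebraMap K A c ∈ IsLocalRing.maximalIdeal A := by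
      have := sub_mem ((IsLocalRing.mem_maximalIdeal _).2 ha) h2
      simpa using this
    exact h3 ((IsUnit.mk0 c hc).map (algebraMap K A))

theorem free_of_reg [Module.Finite (Sk A) M] (h : Reg S S.N M) : 
    ∃ (ι : Type) (_ : Fintype ι) (ε : ι → ℤˣ), Nonempty (M ≃ₗ[Sk A] Fx A ε) := by
  obtain ⟨ι, _, ε, f, hf, hm⟩ := exists_min S (M := M)
  refine ⟨ι, inferInstance, ε, ⟨(LinearEquiv.ofBijective f ⟨?_, hf⟩).symm⟩⟩
  rw [← LinearMap.ker_eq_bot, LinearMap.ker_eq_bot']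
  exact R3 S f hf h (fun y hy => (inI_Fx S _ _).2 fun i => nonunit_mem S _ (hm y hy i))

/-- Q-projective -/
def QP (Q : A) (M : Type u) [AddCommGroup M] [Module (Sk A) M] : Prop :=
  ∃ (ι : Type) (_ : Fintype ι) (ε : ι → ℤˣ) (i : M →ₗ[Sk A] Fx A ε) (π : Fx A ε →ₗ[Sk A] M) (t : ℕ),
    ∀ m, π (i m) = Sk.of (Q ^ t) • m

/-- sum of free modules -/
def Fx.sum {ι ι' : Type} (ε : ι → ℤˣ) (ε' : ι' → ℤˣ) : (Fx A ε × Fx A ε') ≃ₗ[Sk A] Fx A (Sum.elim ε ε') where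
  toFun p := Sum.elim p.1 p.2
  invFun p := (fun i => p (Sum.inl i), fun i => p (Sum.inr i))
  left_inv p := rfl
  right_inv p := by ext (i | i) <;> rfl
  map_add' p q := by ext (i | i) <;> rfl
  map_smul' b q := by ext (i | i) <;> rfl

theorem stably_free {Q : A} (hQ : star Q = Q) (k : ℕ) : ∀ (M : Type u) [AddCommGroup M] [Module (Sk A) M] [Module.Finite (Sk A) M]
    (_ : QP Q M) (_ : ∃ l, l + k = S.N ∧ Reg S l M), ∃ (ι : Type) (_ : Fintype ι) (ε : ι → ℤˣ) (ι' : Type) (_ : Fintype ι') (ε' : ι' → ℤˣ),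
      Iso Q (M × Fx A ε) (Fx A ε') := by
  induction k with
  | zero =>
    intro M _ _ _ hM ⟨l, hl, hR⟩
    obtain rfl : l = S.N := by omega
    obtain ⟨ι, _, ε, ⟨e⟩⟩ := free_of_reg S hR
    refine ⟨Empty, inferInstance, Empty.elim, ι, inferInstance, ε, e.toLinearMap ∘ₗ LinearMap.fst _ _ _, LinearMap.inl _ _ _ ∘ₗ e.symm.toLinearMap, 0, ?_, ?_⟩
    · rintro ⟨m, p⟩
      ext
      · simp
      · rename_i i; exact i.elim
    · intro m; simp
  | succ k ih =>
    intro M _ _ _ ⟨ι1, _, ε1, i, π, t, hi⟩ ⟨l, hl, hR⟩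
    obtain ⟨ι, _, ε, f, hf, -⟩ := exists_min S (M := M)
    obtain ⟨π', hπ'⟩ := proj_lift S f hf π
    have hg : ∀ m, f (π' (i m)) = Sk.of (Q ^ t) • m := fun m => by rw [hπ', hi]
    have hq : star (Q ^ t) = Q ^ t := star_pow_fix hQ t
    have : Module.Finite (Sk A) (LinearMap.ker f) := Module.IsNoetherian.finite _ _
    let G : Fx A ε →ₗ[Sk A] (LinearMap.ker f × M) := LinearMap.prod 
      (LinearMap.codRestrict (LinearMap.ker f) (qm (Q^t) hq (Fx A ε) - π' ∘ₗ i ∘ₗ f) (fun x => by simp [hg])) f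
    let H : (LinearMap.ker f × M) →ₗ[Sk A] Fx A ε := LinearMap.coprod (LinearMap.ker f).subtype (π' ∘ₗ i)
    have hHG : ∀ x, H (G x) = Sk.of (Q^t) • x := by intro x; simp [H, G]
    have hGH : ∀ x, G (H x) = Sk.of (Q^t) • x := by
      rintro ⟨⟨x, hx⟩, m⟩
      have hx' : f x = 0 := hx
      ext1
      · ext1
        simp [H, G, hg, hx']
      · simp [H, G, hg, hx']
    have hI : Iso Q (LinearMap.ker f × M) (Fx A ε) := ⟨H, G, t, hGH, hHG⟩
    obtain ⟨ι2, _, ε2, ι3, _, ε3, h2⟩ := ih (LinearMap.ker f) ⟨ι, inferInstance, ε, (LinearMap.ker f).subtype, LinearMap.fst _ _ _ ∘ₗ G, t, fun m => by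
        have := hGH (m, 0)
        have h3 : H (m, 0) = m := by simp [H]
        rw [h3] at this
        simp [this]⟩ ⟨l+1, by omega, R2 S f hf l hR (Reg_Fx S _ (by omega))⟩
    refine ⟨ι3, inferInstance, ε3, _, inferInstance, Sum.elim ε ε2, ?_⟩
    refine Iso.trans (Iso.prod hQ (Iso.of_equiv (LinearEquiv.refl (Sk A) M)) h2.symm) ?_
    refine Iso.trans (Iso.of_equiv (LinearEquiv.prodAssoc (Sk A) M (LinearMap.ker f) (Fx A ε2)).symm) ?_
    refine Iso.trans (Iso.prod hQ (Iso.trans (Iso.of_equiv (LinearEquiv.prodComm (Sk A) _ _)) hI) (Iso.of_equiv (LinearEquiv.refl (Sk A) _))) ?_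
    exact Iso.of_equiv (Fx.sum ε ε2)

theorem stably_free' (S : Setup K A) {Q : A} (hQ : star Q = Q) [Module.Finite (Sk A) M] (h : QP Q M) :
   ∃ (ι : Type) (_ : Fintype ι) (ε : ι → ℤˣ) (ι' : Type) (_ : Fintype ι') (ε' : ι' → ℤˣ),
      Iso Q (M × Fx A ε) (Fx A ε') := stably_free S hQ S.N M h ⟨0, by simp, fun j hj => by omega⟩
end Berg

set_option linter.unusedSectionVars false
namespace Berg
open Function

section basic
variable {A : Type u} [CommRing A] [StarRing A]
variable {M N : Type u} [AddCommGroup M] [Module A M] [Module (Sk A) M] [IsScalarTower A (Sk A) M]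
 [AddCommGroup N] [Module A N] [Module (Sk A) N] [IsScalarTower A (Sk A) N]

theorem s_asmul (a : A) (m : M) : (Sk.s : Sk A) • a • m = star a • (Sk.s : Sk A) • m := by
  rw [← Sk.of_smul, smul_smul, Sk.s_mul_of, mul_smul, Sk.of_smul]

/-- alternating forms -/
def Alt (A : Type u) [CommRing A] (k : ℕ) (M : Type u) [AddCommGroup M] [Module A M] : Type u := M [⋀^Fin k]→ₗ[A] A
variable {k : ℕ}
instance : AddCommGroup (Alt A k M) := inferInstanceAs (AddCommGroup (M [⋀^Fin k]→ₗ[A] A))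
instance : Module A (Alt A k M) := inferInstanceAs (Module A (M [⋀^Fin k]→ₗ[A] A))
/-- the value -/
def Alt.ev (f : Alt A k M) (v : Fin k → M) : A := (show M [⋀^Fin k]→ₗ[A] A from f) v
theorem Alt.ext {f g : Alt A k M} (h : ∀ v, f.ev v = g.ev v) : f = g := AlternatingMap.ext h
theorem Alt.add_ev (f g : Alt A k M) (v) : (f + g).ev v = f.ev v + g.ev v := rfl
theorem Alt.zero_ev (v) : (0 : Alt A k M).ev v = 0 := rfl
theorem Alt.smul_ev (a : A) (f : Alt A k M) (v) : (a • f).ev v = a * f.ev v := rfl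

theorem s_update (v : Fin k → M) [DecidableEq (Fin k)] (i : Fin k) (x : M) : (fun j => (Sk.s : Sk A) • update v i x j) = update (fun j => (Sk.s : Sk A) • v j) i ((Sk.s : Sk A) • x) := by
  funext j
  by_cases h : j = i
  · subst h; simp
  · simp [h]

/-- the involution -/
def Alt.tt (f : M [⋀^Fin k]→ₗ[A] A) : M [⋀^Fin k]→ₗ[A] A where
  toFun v := star (f (fun i => (Sk.s : Sk A) • v i))
  map_update_add' v i x y := by
    rw [s_update, s_update, s_update, smul_add, f.map_update_add, star_add]
  map_update_smul' v i a x := by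
    rw [s_update, s_update, s_asmul, f.map_update_smul, smul_eq_mul, star_mul', star_star, smul_eq_mul]
  map_eq_zero_of_eq' v i j h hij := by
    rw [f.map_eq_zero_of_eq _ (by rw [h]) hij, star_zero]
/-- the involution, bundled -/
def Alt.t : Alt A k M →+ Alt A k M where
  toFun f := Alt.tt f
  map_zero' := AlternatingMap.ext fun v => star_zero A
  map_add' f g := AlternatingMap.ext fun v => star_add _ _
theorem Alt.t_ev (f : Alt A k M) (v) : (Alt.t f).ev v = star (f.ev (fun i => (Sk.s : Sk A) • v i)) := rfl
instance : Module (Sk A) (Alt A k M) := Sk.mkModule Alt.t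
  (fun f => Alt.ext fun v => by rw [Alt.t_ev, Alt.t_ev, star_star]; simp only [smul_smul, Sk.s_mul_s, one_smul]) 
  (fun a f => Alt.ext fun v => by simp [Alt.t_ev, Alt.smul_ev])
theorem Alt.sk_smul (b : Sk A) (f : Alt A k M) : b • f = b.re • f + b.im • Alt.t f := rfl
theorem Alt.s_ev (f : Alt A k M) (v) : ((Sk.s : Sk A) • f).ev v = star (f.ev (fun i => (Sk.s : Sk A) • v i)) := by
  rw [Alt.sk_smul]; simp [Alt.t_ev]
instance : IsScalarTower A (Sk A) (Alt A k M) := ⟨fun a b f => by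
  rw [Alt.sk_smul, Alt.sk_smul]
  simp [Sk.smul_def, mul_smul]⟩

instance [IsNoetherianRing A] [IsLocalRing A] [h : Module.Finite (Sk A) M] : Module.Finite (Sk A) (Alt A k M) := by
  have h : Module.Finite A M := finite_iff_A.1 h
  rw [finite_iff_A]
  obtain ⟨t, f, hf⟩ := Module.Finite.exists_fin' A M
  have h1 : Module.Finite A ((Fin t → A) [⋀^Fin k]→ₗ[A] A) := by
    have : IsNoetherian A (MultilinearMap A (fun _ : Fin k => (Fin t → A)) A) := isNoetherian_of_isNoetherianRing_of_finite _ _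
    refine Module.Finite.of_injective (AlternatingMap.toMultilinearMapLM (S := A)) AlternatingMap.coe_multilinearMap_injective
  have : IsNoetherian A ((Fin t → A) [⋀^Fin k]→ₗ[A] A) := isNoetherian_of_isNoetherianRing_of_finite _ _
  exact Module.Finite.of_injective ({ toFun := fun g => AlternatingMap.compLinearMap g f, map_add' := fun _ _ => rfl, map_smul' := fun _ _ => rfl } : (M [⋀^Fin k]→ₗ[A] A) →ₗ[A] ((Fin t → A) [⋀^Fin k]→ₗ[A] A)) (AlternatingMap.compLinearMap_injective f hf)

/-- pull-back, auxiliary -/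
def Alt.pull' (k : ℕ) (f : M →ₗ[Sk A] N) (φ : Alt A k N) : Alt A k M :=
  AlternatingMap.compLinearMap φ (f.restrictScalars A)
/-- pull-back -/
def Alt.pull (k : ℕ) (f : M →ₗ[Sk A] N) : Alt A k N →ₗ[Sk A] Alt A k M :=
  Sk.mkLin (fun φ => Alt.pull' k f φ)
   (fun φ ψ => rfl) (fun a φ => by rw [Sk.of_smul, Sk.of_smul]; rfl)
   (fun φ => Alt.ext fun v => by
     rw [Alt.s_ev]
     change ((Sk.s : Sk A) • φ).ev (fun i => f (v i)) = star (φ.ev (fun i => f ((Sk.s : Sk A) • v i)))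
     rw [Alt.s_ev]
     simp)
theorem Alt.pull_ev (f : M →ₗ[Sk A] N) (φ : Alt A k N) (v) : (Alt.pull k f φ).ev v = φ.ev (fun i => f (v i)) := rfl

/-- pull-back, equivalence -/
def Alt.congr (k : ℕ) (f : M ≃ₗ[Sk A] N) : Alt A k N ≃ₗ[Sk A] Alt A k M :=
  LinearEquiv.ofLinearMap (Alt.pull k f.toLinearMap) (Alt.pull k f.symm.toLinearMap)
   (LinearMap.ext fun φ => Alt.ext fun v => by simp [Alt.pull_ev]) (LinearMap.ext fun φ => Alt.ext fun v => by simp [Alt.pull_ev])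

theorem Alt.ev_smul (a : A) (φ : Alt A k M) (v : Fin k → M) : φ.ev (fun i => a • v i) = a ^ k * φ.ev v := by
  have := MultilinearMap.map_smul_univ φ.toMultilinearMap (fun _ => a) v
  simp only [Finset.prod_const, Finset.card_univ, Fintype.card_fin] at this
  exact this

theorem Iso.alt {Q : A} (h : Iso Q M N) (k : ℕ) : Iso Q (Alt A k M) (Alt A k N) := by
  obtain ⟨f, g, t, h1, h2⟩ := h
  refine ⟨Alt.pull k g, Alt.pull k f, t * k, fun φ => Alt.ext fun v => ?_, fun φ => Alt.ext fun v => ?_⟩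
  · simp only [Alt.pull_ev, h1, Sk.of_smul, Alt.ev_smul, Alt.smul_ev, pow_mul]
  · simp only [Alt.pull_ev, h2, Sk.of_smul, Alt.ev_smul, Alt.smul_ev, pow_mul]

/-- Alt^0 -/
noncomputable def Alt.zero : Alt A 0 M ≃ₗ[Sk A] A := LinearEquiv.ofBijective
  (Sk.mkLin (fun φ => φ.ev ![]) (fun φ ψ => rfl) (fun a φ => by rw [Sk.of_smul, Sk.of_smul]; rfl) (fun φ => by
    rw [Alt.s_ev, Sk.s_smul_A]; congr 2; exact Subsingleton.elim _ _))
  ⟨fun φ ψ h => Alt.ext fun v => by rw [Subsingleton.elim v ![]]; exact h,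
   fun a => ⟨AlternatingMap.constOfIsEmpty A M (Fin 0) a, rfl⟩⟩

theorem Alt.vanish [IsDomain A] [IsNoetherianRing A] [IsLocalRing A] [h : Module.Finite (Sk A) M] (hk : Module.finrank A M < k) : Subsingleton (Alt A k M) := by
  have h : Module.Finite A M := finite_iff_A.1 h
  refine subsingleton_of_forall_eq 0 fun φ => Alt.ext fun v => ?_
  refine AlternatingMap.map_linearDependent (K := A) (M := M) (N := A) φ v ?_
  intro hv
  have := hv.fintype_card_le_finrank
  simp at this; omega

variable {e : ℤˣ}
/-- rank one free module -/
abbrev F1 (A : Type u) (e : ℤˣ) := Fx A (fun _ : Unit => e)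

/-- interior product -/
def Alt.int (φ : Alt A (k+1) (M × F1 A e)) : Alt A k M :=
  AlternatingMap.compLinearMap (AlternatingMap.curryLeft φ (0, bas ())) (LinearMap.inl A M (F1 A e))
theorem Alt.int_ev (φ : Alt A (k+1) (M × F1 A e)) (v) : φ.int.ev v = φ.ev (Matrix.vecCons (0, bas ()) fun i => (v i, 0)) := rfl

theorem F1_eq (p : F1 A e) : p = p () • bas () := by
  ext i; simp [Fx.asmul_apply, bas]

theorem Alt.alternating_eq (φ : Alt A k (M × F1 A e)) (h : ∀ w i, w i = (0, bas ()) → φ.ev w = 0) (v : Fin k → M × F1 A e) :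
    φ.ev v = φ.ev (fun i => ((v i).1, 0)) := by
  classical
  have : ∀ s : Finset (Fin k), φ.ev (s.piecewise v (fun i => ((v i).1, 0))) = φ.ev (fun i => ((v i).1, 0)) := by
    intro s
    induction s using Finset.induction_on with
    | empty => simp
    | insert i s hi ih =>
      rw [Finset.piecewise_insert]
      have h1 : v i = ((v i).1, 0) + ((v i).2 ()) • (0, bas ()) := by
        ext1
        · simp
        · simp [← F1_eq]
      have h2 := AlternatingMap.map_update_add φ (s.piecewise v (fun i => ((v i).1, 0))) i ((v i).1, 0) ((v i).2 () • (0, bas ()))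
      have h3 := AlternatingMap.map_update_smul φ (s.piecewise v (fun i => ((v i).1, 0))) i ((v i).2 ()) (0, bas ())
      rw [← h1, h3] at h2
      refine h2.trans ?_
      have h4 := h (update (s.piecewise v (fun i => ((v i).1, 0))) i (0, bas ())) i (by simp)
      have h5 : update (s.piecewise v (fun i => ((v i).1, 0))) i ((v i).1, 0) = s.piecewise v (fun i => ((v i).1, 0)) := by
        rw [update_eq_self_iff]; simp [hi]
      rw [h5]
      change φ.ev _ + _ • φ.ev _ = _
      rw [h4, ih]; simp
  rw [← this Finset.univ]; simp

theorem Alt.bij : Bijective (fun φ : Alt A (k+1) (M × F1 A e) => (Alt.pull (k+1) (LinearMap.inl (Sk A) M (F1 A e)) φ, φ.int)) := by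
  constructor
  · intro φ ψ h
    rw [Prod.mk.injEq] at h
    rw [← sub_eq_zero]
    obtain ⟨h1, h2⟩ := h
    have h1' : ∀ v : Fin (k+1) → M, (φ - ψ).ev (fun i => (v i, 0)) = 0 := by
      intro v
      have := congrArg (fun z => Alt.ev z v) h1
      exact sub_eq_zero.2 this
    have h2' : ∀ v : Fin k → M, (φ - ψ).ev (Matrix.vecCons (0, bas ()) fun i => (v i, 0)) = 0 := by
      intro v
      have := congrArg (fun z => Alt.ev z v) h2
      exact sub_eq_zero.2 this
    generalize φ - ψ = θ at *
    have h3 : ∀ w, θ.ev (Matrix.vecCons (0, bas ()) w) = 0 := by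
      intro w
      have := Alt.alternating_eq (AlternatingMap.curryLeft θ (0, bas ()) : Alt A k (M × F1 A e)) (by
        intro w i hw
        exact AlternatingMap.map_eq_zero_of_eq θ (Matrix.vecCons (0, bas ()) w) (i := 0) (j := i.succ) (by simp [hw]) (Fin.succ_ne_zero i).symm) w
      refine this.trans (h2' _)
    refine Alt.ext fun v => ?_
    rw [Alt.alternating_eq θ ?_ v]
    · exact h1' _
    · intro w i hw
      have h4 := AlternatingMap.map_perm θ w (Equiv.swap 0 i)
      have h5 : w ∘ (Equiv.swap 0 i) = Matrix.vecCons (0, bas ()) (Matrix.vecTail (w ∘ (Equiv.swap 0 i))) := by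
        rw [← hw]
        have := (Matrix.cons_head_tail (w ∘ (Equiv.swap 0 i))).symm
        simpa [Matrix.vecHead] using this
      have h6 := h3 (Matrix.vecTail (w ∘ (Equiv.swap 0 i)))
      rw [← h5] at h6
      have h7 : 0 = Equiv.Perm.sign (Equiv.swap 0 i) • θ.ev w := h6.symm.trans h4
      rcases unit_cases (Equiv.Perm.sign (Equiv.swap 0 i)) with h8 | h8 <;> rw [h8] at h7 <;> simpa [Units.smul_def] using h7.symm
  · rintro ⟨α, β⟩
    let L : (M × F1 A e) →ₗ[A] (M × F1 A e) [⋀^Fin k]→ₗ[A] A :=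
      { toFun := fun p => p.2 () • AlternatingMap.compLinearMap β (LinearMap.fst A M (F1 A e))
        map_add' := fun p q => by simp [add_smul]
        map_smul' := fun a p => by simp [Fx.asmul_apply, mul_smul] }
    have hL : ∀ p w, L p w = p.2 () * β.ev (fun i => (w i).1) := fun p w => rfl
    let γ : Alt A (k+1) (M × F1 A e) := AlternatingMap.alternatizeUncurryFin L
    have hγ : ∀ v, γ.ev v = ∑ i : Fin (k+1), (-1 : ℤ) ^ (i : ℕ) • L (v i) (i.removeNth v) := fun v =>
      AlternatingMap.alternatizeUncurryFin_apply L v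
    refine ⟨Alt.pull (k+1) (LinearMap.fst (Sk A) M (F1 A e)) α + γ, ?_⟩
    ext1
    · refine Alt.ext fun v => ?_
      change α.ev v + γ.ev (fun i => (v i, 0)) = α.ev v
      rw [hγ]; simp [hL]
    · refine Alt.ext fun v => ?_
      rw [Alt.int_ev, Alt.add_ev, Alt.pull_ev, hγ, Fin.sum_univ_succ]
      have : α.ev (fun i => (LinearMap.fst (Sk A) M (F1 A e)) (Matrix.vecCons (0, bas ()) (fun i => (v i, 0)) i)) = 0 := 
        AlternatingMap.map_coord_zero α 0 (by simp)
      rw [this]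
      simp [hL, bas]
theorem Alt.int_add (φ ψ : Alt A (k+1) (M × F1 A e)) : (φ + ψ).int = φ.int + ψ.int := rfl
theorem Alt.int_smul (a : A) (φ : Alt A (k+1) (M × F1 A e)) : (Sk.of a • φ).int = Sk.of a • φ.int := by
  rw [Sk.of_smul, Sk.of_smul]; rfl
theorem Alt.int_s (φ : Alt A (k+1) (M × F1 A e)) : ((Sk.s : Sk A) • φ).int = e • (Sk.s : Sk A) • φ.int := by
  refine Alt.ext fun v => ?_
  rw [Alt.int_ev, Alt.s_ev]
  have h0 : (fun i => (Sk.s : Sk A) • (Matrix.vecCons (0, bas ()) (fun i => (v i, 0)) : Fin (k+1) → M × F1 A e) i) =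
      Matrix.vecCons (e • (0, bas ())) (fun i => ((Sk.s : Sk A) • v i, 0)) := by
    funext i
    refine Fin.cases ?_ (fun i => ?_) i
    · simp [s_bas]
    · simp
  rw [h0]
  have h1 : ∀ w, φ.ev (Matrix.vecCons (e • (0, bas ())) w) = e • φ.ev (Matrix.vecCons (0, bas ()) w) := by
    intro w
    have := map_zsmul (AlternatingMap.curryLeft φ) (e : ℤ) (0, bas ())
    have h2 := congrArg (fun f => f w) this
    exact h2
  have h3 : ∀ (f : Alt A k M) v, (e • f).ev v = e • f.ev v := by
    intro f v
    rcases unit_cases e with h | h <;> rw [h] <;> simp [Units.smul_def]; rfl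
  rw [h1, h3, Alt.s_ev, Alt.int_ev]
  rcases unit_cases e with h | h <;> rw [h] <;> simp [Units.smul_def]
end basic

variable {K A : Type u} [Field K] [CommRing A] [StarRing A] [Algebra K A] (S : Setup K A)
  [CharZero K] [IsNoetherianRing A] [IsLocalRing A]
variable {M N : Type u} [AddCommGroup M] [Module A M] [Module (Sk A) M] [IsScalarTower A (Sk A) M]
 [AddCommGroup N] [Module A N] [Module (Sk A) N] [IsScalarTower A (Sk A) N] [Module.Finite (Sk A) M] [Module.Finite (Sk A) N]

theorem chi_alt_succ (k : ℕ) (e : ℤˣ) : chi S S.N (Alt A (k+1) (M × F1 A e)) = chi S S.N (Alt A (k+1) M) + e * chi S S.N (Alt A k M) := by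
  rcases unit_cases e with rfl | rfl
  · have := chi_congr S S.N (LinearEquiv.ofBijective (LinearMap.prod (Alt.pull (k+1) (LinearMap.inl (Sk A) M (F1 A 1)))
      (Sk.mkLin (fun φ => φ.int) Alt.int_add Alt.int_smul (fun φ => by rw [Alt.int_s]; simp))) Alt.bij)
    rw [this, chiN_prod]; simp
  · have := chi_congr S S.N (LinearEquiv.ofBijective (LinearMap.prod (Alt.pull (k+1) (LinearMap.inl (Sk A) M (F1 A (-1))))
      (Sk.mkLin (fun φ => Sh.mk φ.int) (fun φ ψ => by rw [Alt.int_add, map_add]) (fun a φ => by rw [Alt.int_smul, Sh.of_smul_mk]) (fun φ => by rw [Alt.int_s]; simp [Units.smul_def]))) (Alt.bij (e := -1)))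
    rw [this, chiN_prod, chi_sh]; simp

theorem chi_alt_zero : chi S S.N (Alt A 0 M) = 1 := by
  rw [chi_congr S S.N Alt.zero, chi_A]

/-- generating function -/
noncomputable def PP (M : Type u) [AddCommGroup M] [Module A M] [Module (Sk A) M] [IsScalarTower A (Sk A) M] : PowerSeries ℤ :=
  PowerSeries.mk fun k => chi S S.N (Alt A k M)

theorem PP_congr (f : M ≃ₗ[Sk A] N) : PP S M = PP S N := by
  ext k
  rw [PP, PP, PowerSeries.coeff_mk, PowerSeries.coeff_mk, chi_congr S S.N (Alt.congr k f)]

theorem PP_F1 (e : ℤˣ) : PP S (M × F1 A e) = (1 + (e : PowerSeries ℤ) * PowerSeries.X) * PP S M := by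
  ext k
  cases k with
  | zero => simp [PP, chi_alt_zero, add_mul, mul_assoc]
  | succ k => 
    have : (e : PowerSeries ℤ) = PowerSeries.C (e : ℤ) := by simp
    rw [add_mul, map_add, this, mul_assoc, PowerSeries.coeff_C_mul, PowerSeries.coeff_succ_X_mul, one_mul]
    simp [PP, chi_alt_succ]

/-- reindexing -/
def Fx.reindex {ι ι' : Type} (f : ι' ≃ ι) (ε : ι → ℤˣ) : Fx A ε ≃ₗ[Sk A] Fx A (fun i => ε (f i)) where
  toFun p i := p (f i)
  invFun p i := p (f.symm i)
  left_inv p := by ext i; simp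
  right_inv p := by ext i; simp
  map_add' p q := rfl
  map_smul' b p := rfl
/-- splitting -/
def Fx.split {m : ℕ} (ε : Fin (m+1) → ℤˣ) : Fx A ε ≃ₗ[Sk A] (Fx A (fun i => ε (Fin.succ i)) × F1 A (ε 0)) where
  toFun p := (fun i => p i.succ, fun _ => p 0)
  invFun p := Fin.cases (p.2 ()) p.1
  left_inv p := by ext i; refine Fin.cases ?_ (fun i => ?_) i <;> rfl
  right_inv p := rfl
  map_add' p q := rfl
  map_smul' b p := rfl

theorem PP_Fx {ι : Type} [Fintype ι] (ε : ι → ℤˣ) : PP S (M × Fx A ε) = (∏ i, (1 + (ε i : PowerSeries ℤ) * PowerSeries.X)) * PP S M := by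
  have key : ∀ (m : ℕ) (ε : Fin m → ℤˣ), PP S (M × Fx A ε) = (∏ i, (1 + (ε i : PowerSeries ℤ) * PowerSeries.X)) * PP S M := by
    intro m
    induction m with
    | zero =>
      intro ε
      rw [← PP_congr S (M := M) (LinearEquiv.ofBijective (LinearMap.inl (Sk A) M (Fx A ε)) ⟨LinearMap.inl_injective, ?_⟩)]
      · simp
      · rintro ⟨m, p⟩
        exact ⟨m, by ext1; · rfl
                     · ext i; exact i.elim0⟩
    | succ m ih =>
      intro ε
      rw [PP_congr S ((LinearEquiv.refl (Sk A) M).prodCongr (Fx.split ε)), PP_congr S (LinearEquiv.prodAssoc (Sk A) M _ _).symm,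
        PP_F1, ih, Fin.prod_univ_succ]
      ring
  rw [PP_congr S ((LinearEquiv.refl (Sk A) M).prodCongr (Fx.reindex (Fintype.equivFin ι).symm ε)), key]
  congr 1
  exact Equiv.prod_comp (Fintype.equivFin ι).symm (fun i => (1 + (ε i : PowerSeries ℤ) * PowerSeries.X))

theorem PP_deg [IsDomain A] (k : ℕ) (hk : Module.finrank A M < k) : PowerSeries.coeff k (PP S M) = 0 := by
  have := Alt.vanish (A := A) (M := M) hk
  rw [PP, PowerSeries.coeff_mk, chi_subsingleton]

theorem PP_zero : PP S PUnit.{u+1} = 1 := by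
  ext k
  cases k with
  | zero => simp [PP, chi_alt_zero]
  | succ k =>
    have : Subsingleton (Alt A (k+1) PUnit.{u+1}) := subsingleton_of_forall_eq 0 fun φ => Alt.ext fun v => 
      AlternatingMap.map_coord_zero φ 0 rfl
    rw [PP, PowerSeries.coeff_mk, chi_subsingleton]; simp [PowerSeries.coeff_one]

theorem PP_free {ι : Type} [Fintype ι] (ε : ι → ℤˣ) : PP S (Fx A ε) = ∏ i, (1 + (ε i : PowerSeries ℤ) * PowerSeries.X) := by
  rw [PP_congr S (N := PUnit.{u+1} × Fx A ε) (LinearEquiv.ofBijective (LinearMap.inr (Sk A) PUnit.{u+1} (Fx A ε)) ⟨LinearMap.inr_injective, ?_⟩), PP_Fx, PP_zero, mul_one]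
  rintro ⟨m, p⟩
  exact ⟨p, rfl⟩

theorem PP_iso {n : ℕ} (hN : S.N = 2 * n) (h : Iso (qq S n) M N) :
   (PP S M).map (Int.castRingHom (ZMod (2^n))) = (PP S N).map (Int.castRingHom (ZMod (2^n))) := by
  ext k
  rw [PowerSeries.coeff_map, PowerSeries.coeff_map, PP, PP, PowerSeries.coeff_mk, PowerSeries.coeff_mk]
  have := Iso.chi S hN (h.alt k)
  rw [eq_intCast, eq_intCast, ← sub_eq_zero, ← Int.cast_sub, ZMod.intCast_zmod_eq_zero_iff_dvd]
  exact_mod_cast this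
end Berg

set_option linter.unusedSectionVars false
namespace Berg
section
open Polynomial
variable {R : Type*} [CommRing R]

theorem reflect_add_pow (a : ℕ) : reflect a ((1 + X : R[X]) ^ a) = (1 + X) ^ a ∧ ((1 + X : R[X]) ^ a).natDegree ≤ a := by
  have h1 : (1 + X : R[X]).natDegree ≤ 1 := by
    compute_degree
  have h2 : ((1 + X : R[X]) ^ a).natDegree ≤ a := by
    simpa using natDegree_pow_le_of_le a h1
  refine ⟨?_, h2⟩
  induction a with
  | zero => simp
  | succ a ih =>
    have h3 : ((1 + X : R[X]) ^ a).natDegree ≤ a := by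
      simpa using natDegree_pow_le_of_le a h1
    rw [pow_succ, reflect_mul _ _ h3 h1, ih h3, reflect_add]
    congr 1
    rw [← C_1, reflect_C, ← pow_one (X : R[X]), reflect_monomial]
    simp [add_comm]

theorem reflect_sub_pow (a : ℕ) : reflect a ((1 - X : R[X]) ^ a) = (-1) ^ a * (1 - X) ^ a ∧ ((1 - X : R[X]) ^ a).natDegree ≤ a := by
  have h1 : (1 - X : R[X]).natDegree ≤ 1 := by compute_degree
  have h2 : ((1 - X : R[X]) ^ a).natDegree ≤ a := by
    simpa using natDegree_pow_le_of_le a h1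
  refine ⟨?_, h2⟩
  induction a with
  | zero => simp
  | succ a ih =>
    have h3 : ((1 - X : R[X]) ^ a).natDegree ≤ a := by
      simpa using natDegree_pow_le_of_le a h1
    rw [pow_succ, reflect_mul _ _ h3 h1, ih h3, reflect_sub]
    have : reflect 1 (1 : R[X]) - reflect 1 X = -(1 - X) := by
      rw [← C_1, reflect_C, ← pow_one (X : R[X]), reflect_monomial]
      simp
    rw [this]; ring

theorem reg_pm (a b : ℕ) {f g : R[X]} (h : (1 + X) ^ a * (1 - X) ^ b * f = (1 + X) ^ a * (1 - X) ^ b * g) : f = g := by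
  have h1 : IsRegular (1 + X : R[X]) := by
    rw [add_comm]; exact (monic_X_add_C (1 : R)).isRegular
  have h2 : IsRegular (1 - X : R[X]) := by
    have : (1 - X : R[X]) = - (X - C 1) := by simp
    rw [this]
    have := (monic_X_sub_C (1 : R)).isRegular
    refine ⟨fun x y hxy => this.1 ?_, fun x y hxy => this.2 ?_⟩
    · have h : -(X - C 1) * x = -(X - C 1) * y := hxy
      show (X - C 1) * x = (X - C 1) * y
      linear_combination -h
    · have h : x * -(X - C 1) = y * -(X - C 1) := hxy
      show x * (X - C 1) = y * (X - C 1)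
      linear_combination -h
  exact ((h1.pow a).mul (h2.pow b)).1 h

/-- the reflected equation -/
theorem refl_eq (r a b c d : ℕ) (hr : r + (a + b) = c + d) (p : R[X]) (hp : p.natDegree ≤ r)
    (e : (1 + X) ^ a * (1 - X) ^ b * p = (1 + X) ^ c * (1 - X) ^ d) : (-1) ^ b * reflect r p = (-1) ^ d * p := by
  have h1 := congrArg (reflect (r + (a + b))) e
  rw [mul_comm, reflect_mul _ _ hp (natDegree_mul_le_of_le (reflect_add_pow a).2 (reflect_sub_pow b).2),
    reflect_mul _ _ (reflect_add_pow a).2 (reflect_sub_pow b).2, hr, reflect_mul _ _ (reflect_add_pow c).2 (reflect_sub_pow d).2,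
    (reflect_add_pow a).1, (reflect_add_pow c).1, (reflect_sub_pow b).1, (reflect_sub_pow d).1] at h1
  apply reg_pm a b
  rw [mul_left_comm ((1+X)^c), ← e] at h1
  linear_combination h1

theorem two_eval (r b d : ℕ) (p : R[X]) (hp : p.natDegree ≤ r) (h : (-1) ^ b * reflect r p = (-1) ^ d * p) (ho : Odd (r + b + d)) :
    2 * p.eval (-1) = 0 := by
  have : Invertible (-1 : R) := ⟨-1, by simp, by simp⟩
  have h1 := eval₂_reflect_mul_pow (RingHom.id R) (-1 : R) r p hp
  have h2 : ⅟ (-1 : R) = -1 := by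
    rw [invOf_eq_right_inv]; simp
  rw [h2] at h1
  have h1' : eval (-1) (reflect r p) * (-1) ^ r = eval (-1) p := h1
  have h3 := congrArg (eval (-1)) h
  simp only [eval_mul, eval_pow, eval_neg, eval_one] at h3
  have h4 : ((-1 : R)) ^ b * ((-1) ^ b) = 1 := by rw [← mul_pow]; simp
  have h5 : ((-1 : R)) ^ d * ((-1) ^ d) = 1 := by rw [← mul_pow]; simp
  have h6 : (-1 : R) ^ r * (-1) ^ b * (-1) ^ d = -1 := by rw [← pow_add, ← pow_add, ho.neg_one_pow]
  have h7 : eval (-1) p = - eval (-1) p := by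
    calc eval (-1) p = (eval (-1) (reflect r p) * ((-1) ^ b * (-1)^b)) * (-1) ^ r := by rw [h4, mul_one, h1']
      _ = ((-1) ^ b * eval (-1) (reflect r p)) * ((-1)^b * (-1) ^ r) := by ring
      _ = ((-1 : R) ^ r * (-1) ^ b * (-1) ^ d) * eval (-1) p := by rw [h3]; ring
      _ = _ := by rw [h6]; ring
  linear_combination h7

theorem even_eval (n : ℕ) (hn : 0 < n) (r a b c d : ℕ) (hr1 : 1 ≤ r) (hr : r + (a + b) = c + d) (p : (ZMod (2^n))[X])
    (e : (1 + X) ^ a * (1 - X) ^ b * p = (1 + X) ^ c * (1 - X) ^ d) : ∃ w, p.eval (-1) = 2 * w := by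
  let φ : ZMod (2^n) →+* ZMod 2 := ZMod.castHom (dvd_pow_self 2 hn.ne') (ZMod 2)
  have h1 := congrArg (Polynomial.map φ) e
  simp only [Polynomial.map_mul, Polynomial.map_pow, Polynomial.map_add, Polynomial.map_sub, Polynomial.map_one, map_X] at h1
  have h2 : (1 - X : (ZMod 2)[X]) = 1 + X := by
    have : (2 : (ZMod 2)[X]) = 0 := by 
      exact CharTwo.two_eq_zero
    linear_combination (-X) * this
  rw [h2, ← pow_add, ← pow_add, ← hr, add_comm r, pow_add _ (a+b)] at h1
  have h3 : Polynomial.map φ p = (1 + X) ^ r := by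
    apply reg_pm (a+b) 0
    simpa using h1
  have h4 : φ (p.eval (-1)) = 0 := by
    rw [← eval_map_apply, h3, map_neg, map_one, eval_pow, eval_add, eval_one, eval_X, add_neg_cancel,
      zero_pow (by omega)]
  have h5 : ∀ z : ZMod (2^n), φ z = 0 → ∃ w, z = 2 * w := by
    intro z hz
    obtain ⟨m, rfl⟩ := ZMod.intCast_surjective z
    rw [map_intCast, ZMod.intCast_zmod_eq_zero_iff_dvd] at hz
    obtain ⟨w, hw⟩ := hz
    exact ⟨w, by rw [hw]; push_cast; ring⟩
  exact h5 _ h4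

theorem arith (n r s a b c d : ℕ) (hn : Odd n) (hr : 1 ≤ r) (hs : 1 ≤ s) (hrs : r + s + 1 = n) (h : r + (a + b) = c + d)
    (p p' : (ZMod (2^n))[X]) (hp : p.natDegree ≤ r) (hp' : p'.natDegree ≤ s)
    (e1 : (1 + X) ^ a * (1 - X) ^ b * p = (1 + X) ^ c * (1 - X) ^ d)
    (e2 : (1 + X) ^ c * (1 - X) ^ (d + 1) * p' = (1 + X) ^ (n + a) * (1 - X) ^ b) : False := by
  obtain ⟨w, hw⟩ := even_eval n (by omega) r a b c d hr h p e1
  obtain ⟨w', hw'⟩ := even_eval n (by omega) s c (d+1) (n+a) b hs (by omega) p' e2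
  have f1 := refl_eq r a b c d h p hp e1
  have f2 := refl_eq s c (d+1) (n+a) b (by omega) p' hp' e2
  have hz : p.eval (-1) * p'.eval (-1) = 0 := by
    rcases Nat.even_or_odd (r + b + d) with ho | ho
    · have := two_eval s (d+1) b p' hp' f2 (by
        rw [Nat.odd_iff] at *; rw [Nat.even_iff] at ho; omega)
      rw [hw]; linear_combination w * this
    · have := two_eval r b d p hp f1 ho
      rw [hw']; linear_combination w' * this
  have h1 : (1 - X) * (p * p') = (1 + X) ^ n := by
    apply reg_pm a b
    calc _ = ((1 + X) ^ a * (1 - X) ^ b * p) * ((1 - X) * p') := by ring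
      _ = (1 + X) ^ c * (1 - X) ^ (d + 1) * p' := by rw [e1]; ring
      _ = _ := by rw [e2]; ring
  have h2 : ((2 : (ZMod (2^n))[X])) ^ n = 0 := by
    have : ((2 : (ZMod (2^n))[X])) ^ n = C ((2^n : ℕ) : ZMod (2^n)) := by
      rw [map_natCast, Nat.cast_pow, Nat.cast_ofNat]
    rw [this, ZMod.natCast_self, C_0]
  have h3 := (Commute.all (1 + X : (ZMod (2^n))[X]) 2).geom_sum₂_mul n
  rw [h2, sub_zero, ← h1] at h3
  have h4 : p * p' = - ∑ i ∈ Finset.range n, (1 + X) ^ i * 2 ^ (n - 1 - i) := by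
    apply reg_pm 0 1
    linear_combination -h3
  have h5 := congrArg (eval (-1)) h4
  rw [eval_mul, hz, eval_neg, eval_finsetSum, Finset.sum_eq_single 0] at h5
  · simp at h5
    have h6 : ((2 ^ (n-1) : ℕ) : ZMod (2^n)) = 0 := by push_cast; exact h5
    rw [ZMod.natCast_eq_zero_iff] at h6
    have := Nat.pow_dvd_pow_iff_le_right (x := 2) (by norm_num) |>.1 h6
    omega
  · intro i _ hi
    simp [hi]
  · intro h; simp at h; omega
end
end Berg

set_option linter.unusedSectionVars false
namespace Berg
open Function
section
variable {A : Type u} [CommRing A] [IsDomain A] [IsNoetherianRing A] [IsLocalRing A]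

theorem finrank_prod_dom (M M' : Type u) [AddCommGroup M] [Module A M] [AddCommGroup M'] [Module A M']
    [Module.Finite A M] [Module.Finite A M'] : Module.finrank A (M × M') = Module.finrank A M + Module.finrank A M' := by
  have h := Submodule.finrank_quotient_add_finrank (LinearMap.ker (LinearMap.snd A M M'))
  rw [((LinearMap.snd A M M').quotKerEquivOfSurjective LinearMap.snd_surjective).finrank_eq,
    LinearMap.ker_snd, LinearMap.finrank_range_of_inj LinearMap.inl_injective] at h
  omega

variable [StarRing A] {M N : Type u} [AddCommGroup M] [Module A M] [Module (Sk A) M] [IsScalarTower A (Sk A) M]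
 [AddCommGroup N] [Module A N] [Module (Sk A) N] [IsScalarTower A (Sk A) N]

theorem Iso.rank_le {Q : A} (hQ : Q ≠ 0) [Module.Finite A N] [Module.IsTorsionFree A M] (h : Iso Q M N) :
    Module.finrank A M ≤ Module.finrank A N := by
  obtain ⟨f, g, t, h1, -⟩ := h
  refine LinearMap.finrank_le_finrank_of_injective (f := (f.restrictScalars A)) ?_
  intro m m' hm
  have h2 : g (f m) = g (f m') := congrArg g hm
  rw [h1, h1, Sk.of_smul, Sk.of_smul] at h2
  exact smul_right_injective M (pow_ne_zero t hQ) h2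

theorem Iso.rank_eq {Q : A} (hQ : Q ≠ 0) [Module.Finite A M] [Module.Finite A N] [Module.IsTorsionFree A M] [Module.IsTorsionFree A N]
    (h : Iso Q M N) : Module.finrank A M = Module.finrank A N := le_antisymm (h.rank_le hQ) (h.symm.rank_le hQ)

instance {ι : Type} {ε : ι → ℤˣ} : Module.IsTorsionFree A (Fx A ε) := inferInstanceAs (Module.IsTorsionFree A (ι → A))

theorem Fx.finrank {ι : Type} [Fintype ι] (ε : ι → ℤˣ) : Module.finrank A (Fx A ε) = Fintype.card ι :=
  Module.finrank_fintype_fun_eq_card A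

end

theorem prod_eps {R : Type*} [CommRing R] {ι : Type} [Fintype ι] (ε : ι → ℤˣ) : ∃ a b : ℕ, a + b = Fintype.card ι ∧
    PowerSeries.map (Int.castRingHom R) (∏ i, (1 + (ε i : PowerSeries ℤ) * PowerSeries.X)) =
      (((1 + Polynomial.X) ^ a * (1 - Polynomial.X) ^ b : Polynomial R) : PowerSeries R) := by
  classical
  rw [← Finset.card_univ]
  induction (Finset.univ : Finset ι) using Finset.induction_on with
  | empty => exact ⟨0, 0, by simp, by simp⟩
  | insert i s hi ih =>
    obtain ⟨a, b, h1, h2⟩ := ih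
    rw [Finset.card_insert_of_notMem hi, Finset.prod_insert hi, map_mul, h2]
    rcases unit_cases (ε i) with h | h
    · refine ⟨a+1, b, by omega, ?_⟩
      rw [h]; push_cast; simp; ring
    · refine ⟨a, b+1, by omega, ?_⟩
      rw [h]; simp; ring

theorem poly_of {R : Type*} [CommRing R] (f : PowerSeries R) (r : ℕ) (h : ∀ k, r < k → PowerSeries.coeff k f = 0) :
    ∃ p : Polynomial R, p.natDegree ≤ r ∧ (p : PowerSeries R) = f := by
  refine ⟨PowerSeries.trunc (r+1) f, ?_, ?_⟩
  · have := PowerSeries.natDegree_trunc_lt f r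
    omega
  · ext k
    rw [Polynomial.coeff_coe, PowerSeries.coeff_trunc]
    split_ifs with hk
    · rfl
    · exact (h k (by omega)).symm

variable {K A : Type u} [Field K] [CommRing A] [StarRing A] [Algebra K A] (S : Setup K A)
  [CharZero K] [IsNoetherianRing A] [IsLocalRing A] [IsDomain A]
variable {M N : Type u} [AddCommGroup M] [Module A M] [Module (Sk A) M] [IsScalarTower A (Sk A) M]
 [AddCommGroup N] [Module A N] [Module (Sk A) N] [IsScalarTower A (Sk A) N] [Module.Finite (Sk A) M] [Module.Finite (Sk A) N]

theorem core_mod {n : ℕ} (hn : Odd n) (hN : S.N = 2 * n) (hq : qq S n ≠ 0) [Module.IsTorsionFree A M] [Module.IsTorsionFree A N]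
    [Nontrivial M] [Nontrivial N] (h1 : QP (qq S n) M)
    (h2 : Iso (qq S n) (Fx A (fun _ : Fin n => 1)) (M × (N × F1 A (-1)))) : False := by
  have fM : Module.Finite A M := finite_iff_A.1 inferInstance
  have fN : Module.Finite A N := finite_iff_A.1 inferInstance
  obtain ⟨ι, _, ε, ι', _, ε', h3⟩ := stably_free' S (star_qq S n) h1
  have h4 : Iso (qq S n) (Fx A (fun _ : Fin n => 1) × Fx A ε) (N × Fx A (Sum.elim ε' (fun _ : Unit => -1))) := by
    refine (Iso.prod (star_qq S n) h2 (Iso.of_equiv (LinearEquiv.refl (Sk A) (Fx A ε)))).trans ?_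
    have e1 : ((M × (N × F1 A (-1))) × Fx A ε) ≃ₗ[Sk A] ((M × Fx A ε) × (N × F1 A (-1))) :=
      { toFun := fun p => ((p.1.1, p.2), p.1.2)
        invFun := fun p => ((p.1.1, p.2), p.1.2)
        left_inv := fun p => rfl
        right_inv := fun p => rfl
        map_add' := fun _ _ => rfl
        map_smul' := fun _ _ => rfl }
    refine (Iso.of_equiv e1).trans ?_
    refine (Iso.prod (star_qq S n) h3 (Iso.of_equiv (LinearEquiv.refl (Sk A) _))).trans ?_
    have e2 : (Fx A ε' × (N × F1 A (-1))) ≃ₗ[Sk A] (N × (Fx A ε' × F1 A (-1))) :=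
      { toFun := fun p => (p.2.1, (p.1, p.2.2))
        invFun := fun p => (p.2.1, (p.1, p.2.2))
        left_inv := fun p => rfl
        right_inv := fun p => rfl
        map_add' := fun _ _ => rfl
        map_smul' := fun _ _ => rfl }
    refine (Iso.of_equiv e2).trans ?_
    exact Iso.prod (star_qq S n) (Iso.of_equiv (LinearEquiv.refl (Sk A) _)) (Iso.of_equiv (Fx.sum ε' _))
  have r1 := h2.rank_eq hq
  have r2 := h3.rank_eq hq
  rw [finrank_prod_dom, finrank_prod_dom, Fx.finrank, Fx.finrank, Fintype.card_fin, Fintype.card_unit] at r1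
  rw [finrank_prod_dom, Fx.finrank, Fx.finrank] at r2
  have p1 := PP_iso S hN h3
  have p2 := PP_iso S hN h4
  rw [PP_Fx, PP_free, map_mul] at p1
  rw [PP_Fx, PP_free, PP_Fx, map_mul, map_mul, Fintype.prod_sum_type, map_mul] at p2
  obtain ⟨a, b, hab, e1⟩ := prod_eps (R := ZMod (2^n)) ε
  obtain ⟨c, d, hcd, e2⟩ := prod_eps (R := ZMod (2^n)) ε'
  obtain ⟨p, hp, hp'⟩ := poly_of (PowerSeries.map (Int.castRingHom (ZMod (2^n))) (PP S M)) (Module.finrank A M) (fun k hk => by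
    rw [PowerSeries.coeff_map, PP_deg S k hk, map_zero])
  obtain ⟨p', hp2, hp2'⟩ := poly_of (PowerSeries.map (Int.castRingHom (ZMod (2^n))) (PP S N)) (Module.finrank A N) (fun k hk => by
    rw [PowerSeries.coeff_map, PP_deg S k hk, map_zero])
  have pM : 0 < Module.finrank A M := Module.finrank_pos
  have pN : 0 < Module.finrank A N := Module.finrank_pos
  refine arith n (Module.finrank A M) (Module.finrank A N) a b c d hn pM pN (by omega) (by omega) p p' hp hp2 ?_ ?_
  · apply Polynomial.coe_injective
    rw [Polynomial.coe_mul, ← e1, hp', p1, e2]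
  · apply Polynomial.coe_injective
    simp only [Sum.elim_inl, Sum.elim_inr, ← hp2', e1, e2] at p2
    rw [pow_succ, ← mul_assoc, Polynomial.coe_mul, Polynomial.coe_mul]
    have q1 : PowerSeries.map (Int.castRingHom (ZMod (2^n))) (∏ _x : Unit, (1 + (((-1 : ℤˣ) : ℤ) : PowerSeries ℤ) * PowerSeries.X)) =
      ((1 - Polynomial.X : Polynomial (ZMod (2^n))) : PowerSeries (ZMod (2^n))) := by
      simp; ring
    have q2 : PowerSeries.map (Int.castRingHom (ZMod (2^n))) (∏ _x : Fin n, (1 + (((1 : ℤˣ) : ℤ) : PowerSeries ℤ) * PowerSeries.X)) =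
      (((1 + Polynomial.X)^n : Polynomial (ZMod (2^n))) : PowerSeries (ZMod (2^n))) := by
      simp
    rw [q1, q2] at p2
    rw [← p2, ← Polynomial.coe_mul]
    congr 1; ring
end Berg

set_option linter.unusedSectionVars false
set_option linter.unusedSimpArgs false
namespace Berg
open Function
section
variable {A : Type u} [CommRing A] [StarRing A] 

/-- underlying function -/
def matFun {ι ι' : Type} [Fintype ι] {ε : ι → ℤˣ} (ε' : ι' → ℤˣ) (B : Matrix ι' ι A) (p : Fx A ε) : Fx A ε' :=
  fun i => ∑ j, B i j * p j
theorem matFun_apply {ι ι' : Type} [Fintype ι] {ε : ι → ℤˣ} (ε' : ι' → ℤˣ) (B : Matrix ι' ι A) (p : Fx A ε) (i) :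
  matFun ε' B p i = ∑ j, B i j * p j := rfl

/-- equivariant matrix as a linear map -/
def matLin {ι ι' : Type} [Fintype ι] {ε : ι → ℤˣ} {ε' : ι' → ℤˣ} (B : Matrix ι' ι A)
    (h : ∀ i j, star (B i j) = (ε' i * ε j) • B i j) : Fx A ε →ₗ[Sk A] Fx A ε' :=
  Sk.mkLin (matFun ε' B)
    (fun p q => by
      ext i
      simp only [Fx.add_apply, mul_add, Finset.sum_add_distrib, matFun_apply])
    (fun a p => by
      ext i
      simp only [Fx.of_smul, Finset.mul_sum, matFun_apply]
      exact Finset.sum_congr rfl fun j _ => by ring)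
    (fun p => by
      ext i
      rw [Fx.s_smul, matFun_apply, matFun_apply]
      rw [star_sum, Finset.smul_sum]
      refine Finset.sum_congr rfl fun j _ => ?_
      rw [Fx.s_smul, star_mul', h]
      rcases unit_cases (ε j) with h1 | h1 <;> rcases unit_cases (ε' i) with h2 | h2 <;> simp [h1, h2])

variable {ι ι' ι'' : Type} [Fintype ι] [Fintype ι'] [Fintype ι''] {ε : ι → ℤˣ} {ε' : ι' → ℤˣ} {ε'' : ι'' → ℤˣ}
theorem matLin_apply (B : Matrix ι' ι A)
    (h : ∀ i j, star (B i j) = (ε' i * ε j) • B i j) (p : Fx A ε) (i) : matLin B h p i = ∑ j, B i j * p j := rfl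

theorem matLin_comp (B : Matrix ι'' ι' A) (C : Matrix ι' ι A) (D : Matrix ι'' ι A)
    (h : ∀ i j, star (B i j) = (ε'' i * ε' j) • B i j) (h' : ∀ i j, star (C i j) = (ε' i * ε j) • C i j)
    (hD : B * C = D) (p : Fx A ε) (i) :
    matLin B h (matLin C h' p) i = ∑ j, D i j * p j := by
  rw [← hD]
  simp only [matLin_apply, Finset.mul_sum, Matrix.mul_apply, Finset.sum_mul]
  rw [Finset.sum_comm]
  exact Finset.sum_congr rfl fun j _ => Finset.sum_congr rfl fun _ _ => by ring

theorem matLin_comp0 (B : Matrix ι'' ι' A) (C : Matrix ι' ι A)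
    (h : ∀ i j, star (B i j) = (ε'' i * ε' j) • B i j) (h' : ∀ i j, star (C i j) = (ε' i * ε j) • C i j)
    (hD : B * C = 0) (p : Fx A ε) :
    matLin B h (matLin C h' p) = 0 := by
  ext i
  rw [matLin_comp B C 0 h h' hD, Fx.zero_apply]
  simp

theorem matLin_compa (B : Matrix ι'' ι' A) (C : Matrix ι' ι A) (D : Matrix ι'' ι A) (a : A)
    (h : ∀ i j, star (B i j) = (ε'' i * ε' j) • B i j) (h' : ∀ i j, star (C i j) = (ε' i * ε j) • C i j)
    (h'' : ∀ i j, star (D i j) = (ε'' i * ε j) • D i j)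
    (hD : B * C = a • D) (p : Fx A ε) :
    matLin B h (matLin C h' p) = a • matLin D h'' p := by
  ext i
  rw [matLin_comp B C (a • D) h h' hD, Fx.asmul_apply, matLin_apply D h'', Finset.mul_sum]
  exact Finset.sum_congr rfl fun j _ => by simp [mul_assoc]

theorem matLin_zero [DecidableEq ι] (B : Matrix ι' ι A) (h : ∀ i j, star (B i j) = (ε' i * ε j) • B i j) (h0 : matLin B h = 0) : B = 0 := by
  ext i j
  have h1 : matLin B h (bas j) = 0 := by rw [h0]; rfl
  have h2 : matLin B h (bas j) i = 0 := by rw [h1]; rfl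
  rw [matLin_apply] at h2
  simpa [bas] using h2
end

variable {K A : Type u} [Field K] [CommRing A] [StarRing A] [Algebra K A] (S : Setup K A)
  [CharZero K] [IsNoetherianRing A] [IsLocalRing A] [IsDomain A]

theorem core_mat {n : ℕ} (hn : Odd n) (hN : S.N = 2 * n) (hq : qq S n ≠ 0) (E : Matrix (Fin n) (Fin n) A)
    (hstar : ∀ i j, star (E i j) = E i j) (u : Matrix (Fin n) Unit A) (v : Matrix Unit (Fin n) A)
    (hu : ∀ i j, star (u i j) = - u i j) (hv : ∀ i j, star (v i j) = - v i j)
    (huv : v * u = qq S n • 1) (m : ℕ) (hE : E * E = (qq S n) ^ m • E) (hEu : E * u = (qq S n) ^ m • u)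
    (g1 : E ≠ (qq S n) ^ m • 1) (g2 : qq S n • E ≠ u * (v * E)) : False := by
  set q := qq S n with hqd
  have hsq : star q = q := star_qq S n
  set c := q ^ m with hc
  have hsc : star c = c := by rw [hc, star_pow, hsq]
  have hqc : q * c = q ^ (m+1) := by rw [pow_succ]; ring
  clear_value c
  let e1 : Matrix (Fin n) (Fin n) A := q • E - u * (v * E)
  let e2 : Matrix (Fin n) (Fin n) A := q • (c • 1 - E)
  let vE := v * E
  have hvE : ∀ i j, star (vE i j) = - vE i j := by
    intro i j
    simp only [vE, Matrix.mul_apply, star_sum, ← Finset.sum_neg_distrib]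
    refine Finset.sum_congr rfl fun i _ => ?_
    rw [star_mul', hstar, hv]; ring
  have s1 : ∀ i j, star (e1 i j) = e1 i j := by
    intro i j
    show star (q * E i j - (u * vE) i j) = q * E i j - (u * vE) i j
    simp only [Matrix.mul_apply, star_sub, star_mul', hsq, hstar, star_sum, hvE, hu]
    simp
  have s2 : ∀ i j, star (e2 i j) = e2 i j := by
    intro i j
    simp only [e2, Matrix.sub_apply, Matrix.smul_apply, smul_eq_mul, star_sub, star_mul', hsq, hsc, hstar, Matrix.one_apply]
    split_ifs <;> simp
  have hEE' : ∀ {l : Type} (W : Matrix (Fin n) l A), E * (E * W) = c • (E * W) := fun W => by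
    rw [← Matrix.mul_assoc, hE, Matrix.smul_mul]
  have hEu' : ∀ {l : Type} (W : Matrix Unit l A), E * (u * W) = c • (u * W) := fun W => by
    rw [← Matrix.mul_assoc, hEu, Matrix.smul_mul]
  have huv' : ∀ {l : Type} (W : Matrix Unit l A), v * (u * W) = q • W := fun W => by
    rw [← Matrix.mul_assoc, huv, Matrix.smul_mul, Matrix.one_mul]
  let F := Fx A (fun _ : Fin n => (1 : ℤˣ))
  let L1 : F →ₗ[Sk A] F := matLin e1 (fun i j => by rw [s1]; simp)
  let L2 : F →ₗ[Sk A] F := matLin e2 (fun i j => by rw [s2]; simp)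
  let T : F →ₗ[Sk A] F1 A (-1) := matLin vE (fun i j => by rw [hvE]; simp)
  let U : F1 A (-1) →ₗ[Sk A] F := matLin u (fun i j => by rw [hu]; simp)
  have b11 : ∀ p, L1 (L1 p) = (q * c) • L1 p := fun p => matLin_compa _ _ _ _ _ _ _ (by
    simp only [e1, Matrix.mul_assoc, Matrix.sub_mul, Matrix.mul_sub, Matrix.smul_mul, Matrix.mul_smul, hE, hEu, huv, hEE', hEu', huv', mul_one]
    module) p
  have b22 : ∀ p, L2 (L2 p) = (q * c) • L2 p := fun p => matLin_compa _ _ _ _ _ _ _ (by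
    simp only [e2, Matrix.mul_assoc, Matrix.sub_mul, Matrix.mul_sub, Matrix.smul_mul, Matrix.mul_smul, hE, hEu, huv, hEE', hEu', huv', Matrix.mul_one, Matrix.one_mul]
    module) p
  have b12 : ∀ p, L1 (L2 p) = 0 := fun p => matLin_comp0 _ _ _ _ (by
    simp only [e1, e2, Matrix.mul_assoc, Matrix.sub_mul, Matrix.mul_sub, Matrix.smul_mul, Matrix.mul_smul, hE, hEu, huv, hEE', hEu', huv', Matrix.mul_one, Matrix.one_mul]
    module) p
  have b21 : ∀ p, L2 (L1 p) = 0 := fun p => matLin_comp0 _ _ _ _ (by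
    simp only [e1, e2, Matrix.mul_assoc, Matrix.sub_mul, Matrix.mul_sub, Matrix.smul_mul, Matrix.mul_smul, hE, hEu, huv, hEE', hEu', huv', Matrix.mul_one, Matrix.one_mul]
    module) p
  have b1 : ∀ p, L1 (U p) = 0 := fun p => matLin_comp0 _ _ _ _ (by
    simp only [e1, e2, Matrix.mul_assoc, Matrix.sub_mul, Matrix.mul_sub, Matrix.smul_mul, Matrix.mul_smul, hE, hEu, huv, hEE', hEu', huv', Matrix.mul_one, Matrix.one_mul]
    module) p
  have b2 : ∀ p, L2 (U p) = 0 := fun p => matLin_comp0 _ _ _ _ (by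
    simp only [e1, e2, Matrix.mul_assoc, Matrix.sub_mul, Matrix.mul_sub, Matrix.smul_mul, Matrix.mul_smul, hE, hEu, huv, hEE', hEu', huv', Matrix.mul_one, Matrix.one_mul]
    module) p
  have t1 : ∀ p, T (L1 p) = 0 := fun p => matLin_comp0 _ _ _ _ (by
    simp only [vE, e1, e2, Matrix.mul_assoc, Matrix.sub_mul, Matrix.mul_sub, Matrix.smul_mul, Matrix.mul_smul, hE, hEu, huv, hEE', hEu', huv', Matrix.mul_one, Matrix.one_mul]
    module) p
  have t2 : ∀ p, T (L2 p) = 0 := fun p => matLin_comp0 _ _ _ _ (by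
    simp only [vE, e1, e2, Matrix.mul_assoc, Matrix.sub_mul, Matrix.mul_sub, Matrix.smul_mul, Matrix.mul_smul, hE, hEu, huv, hEE', hEu', huv', Matrix.mul_one, Matrix.one_mul]
    module) p
  have tu : ∀ p, T (U p) = (q * c) • p := by
    intro p
    ext i
    have := matLin_comp (A := A) (ε := fun _ : Unit => -1) (ε' := fun _ : Fin n => 1) (ε'' := fun _ : Unit => -1) vE u ((q * c) • 1) (fun i j => by rw [hvE]; simp) (fun i j => by rw [hu]; simp) (by
      simp only [vE, Matrix.mul_assoc, hEu, Matrix.mul_smul, huv]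
      module) p i
    refine this.trans ?_
    rw [Fx.asmul_apply]
    simp
  have tot : ∀ p, L1 p + (L2 p + U (T p)) = (q * c) • p := by
    intro p
    ext i
    have := matLin_comp (A := A) (ε := fun _ : Fin n => 1) (ε'' := fun _ : Fin n => 1) (ε' := fun _ : Unit => -1) u vE _ (fun i j => by rw [hu]; simp) (fun i j => by rw [hvE]; simp) rfl p i
    have h0 : e1 + e2 + u * vE = (q * c) • 1 := by
      simp only [e1, e2, vE]; module
    have h1 : (L1 p + (L2 p + U (T p))) i = ∑ j, (e1 + e2 + u * vE) i j * p j := by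
      simp only [Matrix.add_apply, add_mul, Finset.sum_add_distrib]
      rw [← this]
      rw [add_assoc]
      rfl
    rw [h1, h0, Fx.asmul_apply]
    simp [Matrix.one_apply]
  have n1 : Nontrivial (LinearMap.range L1) := by
    rw [Submodule.nontrivial_iff_ne_bot, Ne, LinearMap.range_eq_bot]
    intro h
    apply g2
    rw [← sub_eq_zero]
    exact matLin_zero _ _ h
  have n2 : Nontrivial (LinearMap.range L2) := by
    rw [Submodule.nontrivial_iff_ne_bot, Ne, LinearMap.range_eq_bot]
    intro h
    apply g1
    rw [eq_comm, ← sub_eq_zero]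
    have h0 : e2 = 0 := matLin_zero _ _ h
    exact (smul_eq_zero.1 h0).resolve_left hq
  refine core_mod S hn hN hq (M := LinearMap.range L1) (N := LinearMap.range L2) ?_ ?_
  · refine ⟨Fin n, inferInstance, fun _ => 1, (LinearMap.range L1).subtype, L1.rangeRestrict, m+1, ?_⟩
    rintro ⟨_, p, rfl⟩
    apply Subtype.ext
    show L1 (L1 p) = Sk.of (q^(m+1)) • L1 p
    rw [b11, Sk.of_smul, hqc]
  · refine ⟨L1.rangeRestrict.prod (L2.rangeRestrict.prod T), (LinearMap.range L1).subtype.coprod ((LinearMap.range L2).subtype.coprod U), m+1, ?_, ?_⟩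
    · intro p
      show L1 p + (L2 p + U (T p)) = _
      rw [tot, Sk.of_smul, hqc]
    · rintro ⟨⟨_, p, rfl⟩, ⟨_, p', rfl⟩, t⟩
      rw [Sk.of_smul, ← hqc]
      refine Prod.ext (Subtype.ext ?_) (Prod.ext (Subtype.ext ?_) ?_)
      · show L1 (L1 p + (L2 p' + U t)) = (q * c) • L1 p
        rw [map_add, map_add, b11, b12, b1]; simp
      · show L2 (L1 p + (L2 p' + U t)) = (q * c) • L2 p'
        rw [map_add, map_add, b21, b22, b2]; simp
      · show T (L1 p + (L2 p' + U t)) = (q * c) • t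
        rw [map_add, map_add, t1, t2, tu]; simp
end Berg

set_option linter.unusedSectionVars false
namespace Berg
section detlemma
open MvPolynomial
variable {L : Type*} [Field L] {n : ℕ}

/-- evaluation of a polynomial at a matrix -/
noncomputable def mev {k R : Type*} [CommRing k] [CommRing R] [Algebra k R] (M : Matrix (Fin n) (Fin n) R) (f : MvPolynomial (Fin n × Fin n) k) : R :=
  aeval (fun p => M p.1 p.2) f

section
variable {k R R' : Type*} [CommRing k] [CommRing R] [Algebra k R] [CommRing R'] [Algebra k R']
theorem mev_mul (M : Matrix (Fin n) (Fin n) R) (f g : MvPolynomial (Fin n × Fin n) k) : mev M (f * g) = mev M f * mev M g := map_mul _ _ _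
theorem mev_pow (M : Matrix (Fin n) (Fin n) R) (f : MvPolynomial (Fin n × Fin n) k) (N : ℕ) : mev M (f ^ N) = mev M f ^ N := map_pow _ _ _
theorem mev_C (M : Matrix (Fin n) (Fin n) R) (c : k) : mev M (C c) = algebraMap k R c := aeval_C _ _
theorem mev_X (M : Matrix (Fin n) (Fin n) R) (i j) : mev M (X (i, j) : MvPolynomial (Fin n × Fin n) k) = M i j := aeval_X _ _
theorem mev_map (φ : R →ₐ[k] R') (M : Matrix (Fin n) (Fin n) R) (f : MvPolynomial (Fin n × Fin n) k) : φ (mev M f) = mev (M.map φ) f := by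
  rw [mev, mev, ← AlgHom.comp_apply, comp_aeval]; rfl
theorem mev_det (M : Matrix (Fin n) (Fin n) R) : mev M (Matrix.mvPolynomialX (Fin n) (Fin n) k).det = M.det := by
  rw [mev, AlgHom.map_det]
  congr 1
  ext i j; simp [Matrix.mvPolynomialX]
theorem mev_gen (f : MvPolynomial (Fin n × Fin n) k) : mev (Matrix.mvPolynomialX (Fin n) (Fin n) k) f = f := by
  rw [mev]; exact aeval_X_left_apply f
theorem mev_ev' (Q : Matrix (Fin n) (Fin n) R) (M : Matrix (Fin n) (Fin n) (MvPolynomial (Fin n × Fin n) k)) (f : MvPolynomial (Fin n × Fin n) k) :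
    mev Q (mev M f) = mev (M.map (fun x => mev Q x)) f := by
  have h := mev_map (aeval (fun p => Q p.1 p.2) : MvPolynomial (Fin n × Fin n) k →ₐ[k] R) M f
  have e : ∀ x : MvPolynomial (Fin n × Fin n) k, (aeval (fun p => Q p.1 p.2) : MvPolynomial (Fin n × Fin n) k →ₐ[k] R) x = mev Q x := fun x => rfl
  rw [e] at h
  rw [h]
  congr 1
theorem mev_ev (Q M : Matrix (Fin n) (Fin n) (MvPolynomial (Fin n × Fin n) k)) (f : MvPolynomial (Fin n × Fin n) k) :
    mev Q (mev M f) = mev (M.map (fun x => mev Q x)) f := mev_ev' Q M f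
end

theorem poly_lem {F : Type*} [Field F] (h k : Polynomial F) (e : F) (he : e ≠ 0) (N : ℕ) (hk : h * k = Polynomial.C e * Polynomial.X ^ N)
    (h0 : h.eval 0 ≠ 0) : h.eval 1 = h.eval 0 := by
  have h1 : h ∣ Polynomial.X ^ N := by
    have : Associated (Polynomial.C e * Polynomial.X ^ N) (Polynomial.X ^ N) :=
      associated_unit_mul_left _ _ (Polynomial.isUnit_C.2 he.isUnit)
    exact (Dvd.intro _ hk).trans this.dvd
  obtain ⟨d, -, hd⟩ := (dvd_prime_pow Polynomial.prime_X N).1 h1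
  have : d = 0 := by
    by_contra hne
    apply h0
    obtain ⟨w, hw⟩ := hd.symm.dvd
    rw [hw]; simp [hne]
  subst this
  rw [pow_zero, associated_one_iff_isUnit, Polynomial.isUnit_iff] at hd
  obtain ⟨r, -, rfl⟩ := hd
  simp

theorem lemQ {F : Type*} [Field F] [Algebra L F] (f g : MvPolynomial (Fin n × Fin n) L) (c : L) (hc : c ≠ 0) (N : ℕ)
    (hfg : f * g = C c * (Matrix.mvPolynomialX (Fin n) (Fin n) L).det ^ N) (M : Matrix (Fin n) (Fin n) (Polynomial F))
    (e : F) (he : e ≠ 0) (a : ℕ) (hM : M.det = Polynomial.C e * Polynomial.X ^ a)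
    (h0 : mev (M.map (Polynomial.eval 0)) f ≠ 0) : mev (M.map (Polynomial.eval 1)) f = mev (M.map (Polynomial.eval 0)) f := by
  have key : ∀ x : F, mev (M.map (Polynomial.eval x)) f = (mev M f).eval x := by
    intro x
    exact (mev_map ((Polynomial.aeval x : Polynomial F →ₐ[F] F).restrictScalars L) M f).symm
  rw [key] at h0
  rw [key, key]
  have h1 := congrArg (mev M) hfg
  rw [mev_mul, mev_mul, mev_pow, mev_det, mev_C, hM] at h1
  refine poly_lem (mev M f) (mev M g) (algebraMap L F c * e ^ N) (mul_ne_zero (by simpa using hc) (pow_ne_zero _ he)) (a * N) ?_ h0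
  rw [h1, mul_pow, ← pow_mul, Polynomial.C_mul, Polynomial.C_pow, IsScalarTower.algebraMap_apply L F (Polynomial F), mul_assoc]
  rfl

theorem lemD (f g : MvPolynomial (Fin n × Fin n) L) (c : L) (hc : c ≠ 0) (N : ℕ)
    (hfg : f * g = C c * (Matrix.mvPolynomialX (Fin n) (Fin n) L).det ^ N) (W : Matrix (Fin n) (Fin n) L) (i : Fin n)
    (hW : W i = 0) (hf : mev W f ≠ 0) : ∃ a, f = C a := by
  let B := MvPolynomial (Fin n × Fin n) L
  let F := FractionRing B
  let T : Matrix (Fin n) (Fin n) B := Matrix.mvPolynomialX (Fin n) (Fin n) L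
  have inj : Function.Injective (algebraMap B F) := IsFractionRing.injective B F
  let al : B →ₐ[L] F := IsScalarTower.toAlgHom L B F
  have f0 : f ≠ 0 := by rintro rfl; exact hf (map_zero _)
  let TF : Matrix (Fin n) (Fin n) (Polynomial F) := T.map (fun x => Polynomial.C (algebraMap B F x))
  have hTF : TF.det = Polynomial.C (algebraMap B F T.det) := by
    rw [RingHom.map_det, RingHom.map_det]; rfl
  have hd : algebraMap B F T.det ≠ 0 := by
    rw [Ne, map_eq_zero_iff _ inj]; exact Matrix.det_mvPolynomialX_ne_zero _ _
  -- (1)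
  have s1 : mev (T.updateRow i 0) f = f := by
    have n0 : mev (T.updateRow i 0) f ≠ 0 := by
      intro h
      apply hf
      have := congrArg (mev W) h
      rw [mev_ev'] at this
      have e : (T.updateRow i 0).map (fun x => mev W x) = W := by
        ext p q
        rw [Matrix.map_apply, Matrix.updateRow_apply]
        split_ifs with hp
        · rw [hp, hW]; exact map_zero _
        · exact mev_X W p q
      rw [e] at this
      rw [this]; exact map_zero _
    have h := lemQ (F := F) f g c hc N hfg (TF.updateRow i ((Polynomial.X : Polynomial F) • TF i)) (algebraMap B F T.det) hd 1 (by
      rw [Matrix.det_updateRow_smul, Matrix.updateRow_eq_self, hTF]; ring)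
    have e0 : (TF.updateRow i ((Polynomial.X : Polynomial F) • TF i)).map (Polynomial.eval 0) = (T.updateRow i 0).map al := by
      ext p q
      simp only [Matrix.map_apply, Matrix.updateRow_apply]
      split_ifs with hp
      · simp
      · simp [TF, al]
    have e1 : (TF.updateRow i ((Polynomial.X : Polynomial F) • TF i)).map (Polynomial.eval 1) = T.map al := by
      ext p q
      simp only [Matrix.map_apply, Matrix.updateRow_apply]
      split_ifs with hp
      · simp [TF, al, hp]
      · simp [TF, al]
    rw [e0, e1, ← mev_map, ← mev_map, mev_gen] at h
    exact (inj (h (by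
      intro h'; apply n0; apply inj; rw [map_zero]; exact h'))).symm
  have s1' : ∀ Q : Matrix (Fin n) (Fin n) B, mev (Q.updateRow i 0) f = mev Q f := by
    intro Q
    have := congrArg (mev Q) s1
    rw [mev_ev] at this
    rw [← this]
    congr 1
    ext p q : 1
    rw [Matrix.map_apply, Matrix.updateRow_apply, Matrix.updateRow_apply]
    split_ifs with hp
    · exact (map_zero _).symm
    · exact (mev_X Q p q).symm
  have s2 : ∀ j, j ≠ i → mev (T.updateRow j (T j + T i)) f = f := by
    intro j hj
    have h := lemQ (F := F) f g c hc N hfg (TF.updateRow j (TF j + (Polynomial.X : Polynomial F) • TF i)) (algebraMap B F T.det) hd 0 (by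
      rw [Matrix.det_updateRow_add_smul_self _ hj, hTF]; ring)
    have e0 : (TF.updateRow j (TF j + (Polynomial.X : Polynomial F) • TF i)).map (Polynomial.eval 0) = T.map al := by
      ext p q
      simp only [Matrix.map_apply, Matrix.updateRow_apply]
      split_ifs with hp
      · simp [TF, al, hp]
      · simp [TF, al]
    have e1 : (TF.updateRow j (TF j + (Polynomial.X : Polynomial F) • TF i)).map (Polynomial.eval 1) = (T.updateRow j (T j + T i)).map al := by
      ext p q
      simp only [Matrix.map_apply, Matrix.updateRow_apply]
      split_ifs with hp
      · simp [TF, al]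
      · simp [TF, al]
    rw [e0, e1, ← mev_map, ← mev_map, mev_gen] at h
    exact (inj (h (by
      intro h'; apply f0; apply inj; rw [map_zero]; exact h')))
  have s2' : ∀ j, j ≠ i → ∀ Q : Matrix (Fin n) (Fin n) B, mev (Q.updateRow j (Q j + Q i)) f = mev Q f := by
    intro j hj Q
    have := congrArg (mev Q) (s2 j hj)
    rw [mev_ev] at this
    rw [← this]
    congr 1
    ext p q : 1
    rw [Matrix.map_apply, Matrix.updateRow_apply, Matrix.updateRow_apply]
    split_ifs with hp
    · rw [Pi.add_apply, Pi.add_apply]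
      have := map_add (aeval (fun p => Q p.1 p.2) : B →ₐ[L] B) (T j q) (T i q)
      refine Eq.trans ?_ this.symm
      exact (congrArg₂ (· + ·) (mev_X Q j q) (mev_X Q i q)).symm
    · exact (mev_X Q p q).symm
  have s3 : ∀ j, ∀ Q : Matrix (Fin n) (Fin n) B, mev (Q.updateRow j 0) f = mev Q f := by
    intro j Q
    by_cases hj : j = i
    · rw [hj]; exact s1' Q
    let Q1 := Q.updateRow i (- Q j)
    have h1 : mev Q1 f = mev Q f := by
      rw [← s1' Q1, ← s1' Q]
      congr 1
      ext p q : 1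
      simp only [Q1, Matrix.updateRow_apply]
      split_ifs <;> rfl
    have h2 := s2' j hj Q1
    rw [← h1, ← h2, ← s1' (Q.updateRow j 0), ← s1' (Q1.updateRow j _)]
    congr 1
    ext p q : 1
    simp only [Q1, Matrix.updateRow_apply, Pi.add_apply]
    split_ifs with h3 h4 <;> simp_all
  have s4 : ∀ s : Finset (Fin n), mev (fun p q => if p ∈ s then 0 else T p q) f = f := by
    intro s
    induction s using Finset.induction_on with
    | empty => simp only [Finset.notMem_empty, if_false]; exact mev_gen f
    | insert j s hj ih =>
      refine Eq.trans ?_ ih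
      rw [← s3 j (fun p q => if p ∈ s then 0 else T p q)]
      congr 1
      ext p q : 1
      refine Eq.trans ?_ (Matrix.updateRow_apply (M := (fun p q => if p ∈ s then 0 else T p q : Matrix (Fin n) (Fin n) B))).symm
      simp only [Finset.mem_insert]
      by_cases h1 : p = j <;> by_cases h2 : p ∈ s <;> simp [h1, h2]
  have s5 := s4 Finset.univ
  simp only [Finset.mem_univ, if_true] at s5
  have s6 : mev (fun p q => 0 : Matrix (Fin n) (Fin n) B) f = C (mev (fun p q => 0 : Matrix (Fin n) (Fin n) L) f) := by
    have := mev_map (Algebra.ofId L B) (fun p q => 0 : Matrix (Fin n) (Fin n) L) f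
    refine Eq.trans ?_ this.symm
    congr 1
    ext p q : 1
    exact (map_zero (Algebra.ofId L B)).symm
  exact ⟨_, s5.symm.trans s6⟩

end detlemma
end Berg

set_option linter.unusedSectionVars false
namespace Berg
section detlemma2
open MvPolynomial
variable {L : Type*} [Field L] {n : ℕ}

theorem map_CT {L R : Type*} [CommRing L] [CommRing R] [Algebra L R] (S : Matrix (Fin n) (Fin n) L) (Q : Matrix (Fin n) (Fin n) R) :
    (S.map (C : L →+* MvPolynomial (Fin n × Fin n) L) * Matrix.mvPolynomialX (Fin n) (Fin n) L).map (fun x => mev Q x) = S.map (algebraMap L R) * Q := by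
  have e : ∀ x : MvPolynomial (Fin n × Fin n) L, mev Q x = (aeval (fun p => Q p.1 p.2) : MvPolynomial (Fin n × Fin n) L →ₐ[L] R) x := fun x => rfl
  ext i j
  simp only [Matrix.map_apply, Matrix.mul_apply, e, map_sum, map_mul]
  refine Finset.sum_congr rfl fun p _ => ?_
  simp [Matrix.mvPolynomialX]

theorem lemDD (f g : MvPolynomial (Fin n × Fin n) L) (N : ℕ)
    (hfg : f * g = (Matrix.mvPolynomialX (Fin n) (Fin n) L).det ^ N) (W : Matrix (Fin n) (Fin n) L)
    (hW : W.det = 0) (hf : mev W f ≠ 0) : ∃ a, f = C a := by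
  obtain ⟨w, hw, hwW⟩ := Matrix.exists_vecMul_eq_zero_iff.2 hW
  obtain ⟨i, hi⟩ := Function.ne_iff.1 hw
  let S : Matrix (Fin n) (Fin n) L := (1 : Matrix (Fin n) (Fin n) L).updateRow i w
  have hS : S.det = w i := by
    have := Matrix.det_updateRow_sum (1 : Matrix (Fin n) (Fin n) L) i w
    rw [Matrix.det_one, smul_eq_mul, mul_one] at this
    have e : ∑ p, w p • (1 : Matrix (Fin n) (Fin n) L) p = w := by
      ext j
      simp [Matrix.one_apply]
    rw [e] at this
    exact this
  have hSu : IsUnit S.det := by rw [hS]; exact isUnit_iff_ne_zero.2 hi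
  have hSi : IsUnit (S⁻¹).det := by
    rw [Matrix.det_nonsing_inv]; exact hSu.ringInverse
  let T := Matrix.mvPolynomialX (Fin n) (Fin n) L
  let Cm : L →+* MvPolynomial (Fin n × Fin n) L := C
  obtain ⟨a, ha⟩ := lemD (mev (S⁻¹.map Cm * T) f) (mev (S⁻¹.map Cm * T) g) ((S⁻¹).det ^ N) (pow_ne_zero _ hSi.ne_zero) N (by
      rw [← mev_mul, hfg, mev_pow, mev_det, Matrix.det_mul, mul_pow, map_pow]
      congr 2
      exact (RingHom.map_det Cm _).symm) (S * W) i (by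
      ext j
      have := congrFun hwW j
      simpa [S, Matrix.mul_apply, Matrix.vecMul, dotProduct] using this) (by
      rw [mev_ev', map_CT]
      have : S⁻¹.map (algebraMap L L) * (S * W) = W := by
        rw [← Matrix.mul_assoc]
        have : S⁻¹.map (algebraMap L L) = S⁻¹ := by ext; rfl
        rw [this, Matrix.nonsing_inv_mul _ hSu, Matrix.one_mul]
      rwa [this])
  refine ⟨a, ?_⟩
  have h2 := congrArg (mev (S.map Cm * T)) ha
  rw [mev_ev, map_CT, mev_C] at h2
  have h3 : S⁻¹.map (algebraMap L (MvPolynomial (Fin n × Fin n) L)) * (S.map Cm * T) = T := by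
    rw [← Matrix.mul_assoc]
    have : S⁻¹.map (algebraMap L (MvPolynomial (Fin n × Fin n) L)) * S.map Cm = (S⁻¹ * S).map Cm := by
      rw [Matrix.map_mul]; rfl
    rw [this, Matrix.nonsing_inv_mul _ hSu, Matrix.map_one _ (map_zero _) (map_one _), Matrix.one_mul]
  rw [h3, mev_gen] at h2
  exact h2

theorem lemDDD {k A : Type*} [CommRing k] [IsDomain k] [CommRing A] [IsDomain A] [Algebra k A]
    (inj : Function.Injective (algebraMap k A)) (f g : MvPolynomial (Fin n × Fin n) k) (N : ℕ)
    (hfg : f * g = (Matrix.mvPolynomialX (Fin n) (Fin n) k).det ^ N) (hf : ¬ IsUnit f) (W : Matrix (Fin n) (Fin n) A)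
    (hW : W.det = 0) : mev W f = 0 := by
  by_contra hne
  let L := FractionRing A
  let φ : k →+* L := algebraMap k L
  have injL : Function.Injective (algebraMap A L) := IsFractionRing.injective A L
  have injφ : Function.Injective φ := by
    have : φ = (algebraMap A L).comp (algebraMap k A) := IsScalarTower.algebraMap_eq k A L
    rw [this]; exact injL.comp inj
  have hdet : MvPolynomial.map φ (Matrix.mvPolynomialX (Fin n) (Fin n) k).det = (Matrix.mvPolynomialX (Fin n) (Fin n) L).det := by
    rw [RingHom.map_det]
    congr 1
    ext i j : 1
    simp [Matrix.mvPolynomialX]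
  obtain ⟨a, ha⟩ := lemDD (MvPolynomial.map φ f) (MvPolynomial.map φ g) N (by
      rw [← map_mul, hfg, map_pow, hdet]) (W.map (algebraMap A L)) (by
      have := RingHom.map_det (algebraMap A L) W
      rw [hW, map_zero] at this
      exact this.symm) (by
      intro h
      apply hne
      apply injL
      rw [map_zero, ← h]
      have h1 : mev (W.map (algebraMap A L)) (MvPolynomial.map φ f) = mev (W.map (algebraMap A L)) f := by
        unfold mev
        exact aeval_map_algebraMap L _ f
      rw [h1]
      exact mev_map (IsScalarTower.toAlgHom k A L) W f)
  have h0 : a = φ (coeff 0 f) := by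
    have := congrArg (coeff 0) ha
    rw [coeff_map, coeff_zero_C] at this
    exact this.symm
  have h1 : f = C (coeff 0 f) := by
    apply MvPolynomial.map_injective φ injφ
    rw [ha, h0, map_C]
  apply hf
  have h2 := congrArg (mev (1 : Matrix (Fin n) (Fin n) k)) hfg
  rw [mev_mul, mev_pow, mev_det, Matrix.det_one, one_pow, h1, mev_C] at h2
  rw [h1]
  exact (IsUnit.of_mul_eq_one _ h2).map C
end detlemma2
end Berg

set_option linter.unusedSectionVars false
namespace Berg
section absE
open Polynomial
variable {A : Type*} [CommRing A] {n : ℕ}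

/-- entrywise value at q -/
noncomputable def m0 (q : A) {a b : Type*} (Y : Matrix a b A[X]) : Matrix a b A := Y.map (fun p => p.eval q)
/-- entrywise derivative at q -/
noncomputable def m1 (q : A) {a b : Type*} (Y : Matrix a b A[X]) : Matrix a b A := Y.map (fun p => (derivative p).eval q)
theorem m0_mul (q : A) {a b c : Type*} [Fintype b] (Y : Matrix a b A[X]) (Z : Matrix b c A[X]) : m0 q (Y * Z) = m0 q Y * m0 q Z := by
  ext i j; simp [m0, Matrix.mul_apply, eval_finsetSum]
theorem m1_mul (q : A) {a b c : Type*} [Fintype b] (Y : Matrix a b A[X]) (Z : Matrix b c A[X]) : m1 q (Y * Z) = m1 q Y * m0 q Z + m0 q Y * m1 q Z := by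
  ext i j; simp [m0, m1, Matrix.mul_apply, eval_finsetSum, derivative_mul, Finset.sum_add_distrib]

theorem charp (q : A) (hn : 0 < n) (u : Matrix (Fin n) Unit A) (v : Matrix Unit (Fin n) A) (huv : v * u = q • 1) :
    (u * v).charmatrix.det = X ^ (n-1) * (X - C q) := by
  have h : u * v = Matrix.vecMulVec (fun i => u i ()) (fun j => v () j) := by
    ext i j; simp [Matrix.mul_apply, Matrix.vecMulVec]
  have h2 : (fun i => u i ()) ⬝ᵥ (fun j => v () j) = q := by
    have := congrFun (congrFun huv ()) ()
    simp [Matrix.mul_apply] at this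
    rw [← this]; simp [dotProduct, mul_comm]
  have h3 := Matrix.charpoly_vecMulVec (fun i => u i ()) (fun j => v () j)
  rw [h2, ← h, Matrix.charpoly] at h3
  rw [h3, Fintype.card_fin, smul_eq_C_mul]
  obtain ⟨m, rfl⟩ : ∃ m, n = m + 1 := ⟨n-1, by omega⟩
  simp only [Nat.add_sub_cancel]
  ring

theorem cancel_comm {R : Type*} [CommRing R] [IsDomain R] (Y M : Matrix (Fin n) (Fin n) R) (d : R) (hd : d ≠ 0) (h : Y * M = d • 1) : M * Y = d • 1 := by
  have hdet : Y.det ≠ 0 := by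
    intro h0
    have := congrArg Matrix.det h
    rw [Matrix.det_mul, h0, zero_mul, Matrix.det_smul, Matrix.det_one, mul_one] at this
    exact pow_ne_zero _ hd this.symm
  have h1 : Y * (M * Y - d • 1) = 0 := by
    rw [Matrix.mul_sub, ← Matrix.mul_assoc, h]; simp
  have h2 := congrArg (fun T => Y.adjugate * T) h1
  simp only [← Matrix.mul_assoc, Matrix.adjugate_mul, Matrix.mul_zero, Matrix.smul_mul, Matrix.one_mul] at h2
  exact sub_eq_zero.1 ((smul_eq_zero.1 h2).resolve_left hdet)

theorem absE [IsDomain A] (hn : 0 < n) (q : A) (hq : q ≠ 0) (u : Matrix (Fin n) Unit A) (v : Matrix Unit (Fin n) A) (huv : v * u = q • 1)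
    (Y Z : Matrix (Fin n) (Fin n) A[X]) (hYZ : (u * v).charmatrix.adjugate = Y * Z)
    (hY : (m0 q Y).det = 0) (hZ : (m0 q Z).det = 0) (E : Matrix (Fin n) (Fin n) A) (hE : E = m0 q Y * m1 q (Z * (u * v).charmatrix)) :
    E * E = q^(n-1) • E ∧ E * u = q^(n-1) • u ∧ E ≠ q^(n-1) • 1 ∧ q • E ≠ u * (v * E) := by
  set T := (u * v).charmatrix with hT
  set c := q^(n-1) with hc
  have c0 : c ≠ 0 := pow_ne_zero _ hq
  set d : A[X] := X ^ (n-1) * (X - C q) with hd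
  have d0 : d ≠ 0 := mul_ne_zero (pow_ne_zero _ X_ne_zero) (X_sub_C_ne_zero q)
  set M := Z * T with hM
  have hYM : Y * M = d • 1 := by
    rw [hM, ← Matrix.mul_assoc, ← hYZ, Matrix.adjugate_mul, hT, charp q hn u v huv]
  have hMY : M * Y = d • 1 := cancel_comm _ _ _ d0 hYM
  have dd0 : m0 q (d • (1 : Matrix (Fin n) (Fin n) A[X])) = 0 := by
    ext i j; simp [m0, hd]
  have dd1 : m1 q (d • (1 : Matrix (Fin n) (Fin n) A[X])) = c • 1 := by
    ext i j
    rw [m1, Matrix.map_apply, Matrix.smul_apply, Matrix.smul_apply, smul_eq_mul, Matrix.one_apply, Matrix.one_apply]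
    split_ifs
    · simp [hd, derivative_mul, hc]
    · simp
  have a1 : m0 q Y * m0 q M = 0 := by rw [← m0_mul, hYM, dd0]
  have a2 : m0 q M * m0 q Y = 0 := by rw [← m0_mul, hMY, dd0]
  have b1 : m1 q Y * m0 q M + m0 q Y * m1 q M = c • 1 := by rw [← m1_mul, hYM, dd1]
  have b2 : m1 q M * m0 q Y + m0 q M * m1 q Y = c • 1 := by rw [← m1_mul, hMY, dd1]
  have hM0 : m0 q M = m0 q Z * m0 q T := m0_mul _ _ _
  have hT0 : m0 q T = q • 1 - u * v := by
    ext i j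
    simp [m0, hT, Matrix.charmatrix_apply, Matrix.one_apply, Matrix.diagonal_apply]
    split_ifs <;> simp
  have hT0u : m0 q T * u = 0 := by
    rw [hT0, Matrix.sub_mul, Matrix.mul_assoc, huv]; simp
  have b2' : m1 q M * m0 q Y = c • 1 - m0 q M * m1 q Y := eq_sub_of_add_eq b2
  have EY : E * m0 q Y = c • m0 q Y := by
    rw [hE, Matrix.mul_assoc, b2', Matrix.mul_sub, ← Matrix.mul_assoc, a1]; simp
  refine ⟨?_, ?_, ?_, ?_⟩
  · nth_rewrite 2 [hE]
    rw [← Matrix.mul_assoc, EY, Matrix.smul_mul, hE]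
  · have : E = c • 1 - m1 q Y * m0 q M := by rw [hE]; exact eq_sub_of_add_eq' b1
    rw [this, Matrix.sub_mul, hM0, Matrix.mul_assoc, Matrix.mul_assoc, hT0u]; simp
  · intro h
    have := congrArg Matrix.det h
    rw [hE, Matrix.det_mul, hY, zero_mul, Matrix.det_smul, Matrix.det_one, mul_one] at this
    exact pow_ne_zero _ c0 this.symm
  · intro h
    have h1 : q • m0 q Y = u * (v * m0 q Y) := by
      have := congrArg (fun T => T * m0 q Y) h
      simp only [Matrix.smul_mul, Matrix.mul_assoc, EY, Matrix.mul_smul] at this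
      rw [smul_comm] at this
      exact smul_right_injective _ c0 this
    obtain ⟨w', hw', hwZ'⟩ := Matrix.exists_vecMul_eq_zero_iff.2 hZ
    let w : Matrix Unit (Fin n) A := fun _ => w'
    have hwZ : w * m0 q Z = 0 := by
      ext i j; exact congrFun hwZ' j
    have hwM : w * m0 q M = 0 := by rw [hM0, ← Matrix.mul_assoc, hwZ, Matrix.zero_mul]
    have h2 : w * (m1 q M * m0 q Y) = c • w := by
      rw [b2', Matrix.mul_sub, ← Matrix.mul_assoc, hwM]; simp
    have h3 : (w * m1 q M * u) * (v * m0 q Y) = (q * c) • w := by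
      rw [mul_smul, ← h2, Matrix.mul_assoc, ← h1, Matrix.mul_smul, Matrix.mul_assoc]
    have hv : v * (m0 q Y * m0 q Z) = c • v := by
      rw [← m0_mul, ← hYZ]
      let vC : Matrix Unit (Fin n) A[X] := v.map C
      have e1 : vC * T = (X - C q) • vC := by
        have f1 : T = (X : A[X]) • 1 - u.map C * vC := by
          rw [← Matrix.map_mul]
          ext i j : 1
          rw [hT, Matrix.charmatrix_apply, Matrix.sub_apply, Matrix.map_apply, Matrix.smul_apply, Matrix.one_apply, Matrix.diagonal_apply]
          split_ifs <;> simp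
        have f2 : vC * u.map C = C q • 1 := by
          rw [← Matrix.map_mul, huv]
          ext i j : 1
          simp
        rw [f1, Matrix.mul_sub, ← Matrix.mul_assoc, f2, sub_smul]
        simp
      have e2 := congrArg (fun S => S * T.adjugate) e1
      simp only [Matrix.mul_assoc, Matrix.mul_adjugate, Matrix.mul_smul, Matrix.mul_one, Matrix.smul_mul] at e2
      rw [hT, charp q hn u v huv, mul_comm, mul_smul] at e2
      have e3 := smul_right_injective _ (X_sub_C_ne_zero q) e2
      have e4 := congrArg (m0 q) e3
      rw [m0_mul] at e4
      have e5 : m0 q vC = v := by ext i j; simp [m0, vC]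
      rw [e5] at e4
      rw [← e4]
      ext i j; simp [m0, vC, hc]; exact mul_comm _ _
    have h4 := congrArg (fun S => S * m0 q Z) h3
    simp only [Matrix.mul_assoc, Matrix.smul_mul, hwZ, smul_zero, hv, Matrix.mul_smul] at h4
    have h5 := congrArg (fun S => S * u) ((smul_eq_zero.1 h4).resolve_left c0)
    simp only [Matrix.mul_assoc, huv, Matrix.mul_smul, Matrix.mul_one, Matrix.zero_mul] at h5
    have h6 := (smul_eq_zero.1 h5).resolve_left hq
    rw [Matrix.mul_assoc w, h6, Matrix.zero_mul] at h3
    have h7 := (smul_eq_zero.1 h3.symm).resolve_left (mul_ne_zero hq c0)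
    exact hw' (congrFun h7 ())
end absE

section star
open Polynomial
variable {A : Type*} [CommRing A] [StarRing A] {n : ℕ} {k : Type*} [CommRing k] [Algebra k A]

theorem star_fix (hk : ∀ c : k, star (algebraMap k A c) = algebraMap k A c) (W : Matrix (Fin n) (Fin n) A) (hW : ∀ i j, star (W i j) = W i j)
    (f : MvPolynomial (Fin n × Fin n) k) : (mev W.charmatrix f).map (starRingEnd A) = mev W.charmatrix f := by
  let φ : A[X] →ₐ[k] A[X] := { mapRingHom (starRingEnd A) with
    commutes' := fun c => by
      show (algebraMap k A[X] c).map (starRingEnd A) = _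
      rw [IsScalarTower.algebraMap_apply k A A[X]]
      show (C (algebraMap k A c)).map (starRingEnd A) = C (algebraMap k A c)
      rw [map_C, starRingEnd_apply, hk] }
  have h := mev_map φ W.charmatrix f
  have e : W.charmatrix.map φ = W.charmatrix := by
    ext i j : 1
    show (W.charmatrix i j).map (starRingEnd A) = _
    rw [Matrix.charmatrix_apply, Polynomial.map_sub, map_C, starRingEnd_apply, hW, Matrix.diagonal_apply]
    split_ifs <;> simp
  rw [e] at h
  exact h

theorem star_eval (p : A[X]) (hp : p.map (starRingEnd A) = p) (q : A) (hq : star q = q) : star (p.eval q) = p.eval q := by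
  have := eval_map_apply (p := p) (starRingEnd A) q
  rw [hp, starRingEnd_apply, starRingEnd_apply, hq] at this
  exact this.symm
theorem star_deriv (p : A[X]) (hp : p.map (starRingEnd A) = p) : (derivative p).map (starRingEnd A) = derivative p := by
  rw [← derivative_map, hp]
end star

theorem mev_mat {n : ℕ} {k R : Type*} [CommRing k] [CommRing R] [Algebra k R] (W : Matrix (Fin n) (Fin n) R)
   (Y Z : Matrix (Fin n) (Fin n) (MvPolynomial (Fin n × Fin n) k))
   (h : (Matrix.mvPolynomialX (Fin n) (Fin n) k).adjugate = Y * Z) :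
   W.adjugate = Y.map (fun f => mev W f) * Z.map (fun f => mev W f) := by
  let φ : MvPolynomial (Fin n × Fin n) k →ₐ[k] R := MvPolynomial.aeval (fun p => W p.1 p.2)
  have h1 := congrArg (fun S => S.map φ) h
  rw [Matrix.map_mul] at h1
  have h2 := AlgHom.map_adjugate φ (Matrix.mvPolynomialX (Fin n) (Fin n) k)
  have h3 : φ.mapMatrix (Matrix.mvPolynomialX (Fin n) (Fin n) k) = W := by
    ext i j : 1
    exact mev_X W i j
  rw [h3] at h2
  rw [← h2]
  exact h1

theorem red {k K A : Type u} [CommRing k] [IsDomain k] [Field K] [CommRing A] [StarRing A] [Algebra K A] [Algebra k A]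
  (S : Setup K A) [CharZero K] [IsNoetherianRing A] [IsLocalRing A] [IsDomain A] {n : ℕ} (hn : Odd n) (hN : S.N = 2*n) (hq : qq S n ≠ 0)
  (inj : Function.Injective (algebraMap k A)) (hk : ∀ c : k, star (algebraMap k A c) = algebraMap k A c)
   (Y Z : Matrix (Fin n) (Fin n) (MvPolynomial (Fin n × Fin n) k))
   (hY : ¬ IsUnit Y) (hZ : ¬ IsUnit Z)
   (h : (Matrix.mvPolynomialX (Fin n) (Fin n) k).adjugate = Y * Z) : False := by
  let q := qq S n
  let u : Matrix (Fin n) Unit A := fun i _ => S.x (2*i)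
  let v : Matrix Unit (Fin n) A := fun _ i => S.x (2*i+1)
  have hu : ∀ i j, star (u i j) = - u i j := fun i j => S.star_x _
  have hv : ∀ i j, star (v i j) = - v i j := fun i j => S.star_x _
  have huv : v * u = q • 1 := by
    ext i j
    have e : (q • (1 : Matrix Unit Unit A)) i j = q := by simp
    rw [e]
    refine (Matrix.mul_apply).trans ?_
    show _ = ∑ i ∈ Finset.range n, S.x (2*i) * S.x (2*i+1)
    rw [Finset.sum_range]
    exact Finset.sum_congr rfl fun _ _ => mul_comm (G := A) _ _
  have hsq : star q = q := by
    simp [q, qq, S.star_x, mul_comm]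
  have hsW : ∀ i j, star ((u * v) i j) = (u * v) i j := by
    intro i j
    simp [Matrix.mul_apply, hu, hv]
  set W := (u * v).charmatrix with hW
  have hdet : Y.det * Z.det = (Matrix.mvPolynomialX (Fin n) (Fin n) k).det ^ (n-1) := by
    rw [← Matrix.det_mul, ← h, Matrix.det_adjugate, Fintype.card_fin]
  let T0 : Matrix (Fin n) (Fin n) A := m0 q W
  have hT0 : T0.det = 0 := by
    have h1 := RingHom.map_det (Polynomial.evalRingHom q) W
    rw [hW, charp q hn.pos u v huv] at h1
    simp at h1
    exact h1.symm
  have key : ∀ V : Matrix (Fin n) (Fin n) (MvPolynomial (Fin n × Fin n) k), (m0 q (V.map (fun f => mev W f))).det = mev T0 V.det := by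
    intro V
    have e1 : ∀ f : MvPolynomial (Fin n × Fin n) k, (mev W f).eval q = mev T0 f := by
      intro f
      exact mev_map ((Polynomial.aeval q : Polynomial A →ₐ[A] A).restrictScalars k) W f
    have e2 : m0 q (V.map (fun f => mev W f)) = V.map (fun f => mev T0 f) := by
      ext i j : 1
      exact e1 _
    rw [e2]
    exact (AlgHom.map_det (MvPolynomial.aeval (fun p => T0 p.1 p.2) : MvPolynomial (Fin n × Fin n) k →ₐ[k] A) V).symm
  have dY : (m0 q (Y.map (fun f => mev W f))).det = 0 := by
    rw [key]
    exact lemDDD inj _ _ _ hdet (fun hh => hY ((Matrix.isUnit_iff_isUnit_det _).2 hh)) _ hT0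
  have dZ : (m0 q (Z.map (fun f => mev W f))).det = 0 := by
    rw [key]
    exact lemDDD inj _ _ _ ((mul_comm _ _).trans hdet) (fun hh => hZ ((Matrix.isUnit_iff_isUnit_det _).2 hh)) _ hT0
  obtain ⟨r1, r2, r3, r4⟩ := absE hn.pos q hq u v huv _ _ (mev_mat W Y Z h) dY dZ _ rfl
  refine core_mat S hn hN hq _ ?_ u v hu hv huv (n-1) r1 r2 r3 r4
  have fx : ∀ f : MvPolynomial (Fin n × Fin n) k, (mev W f).map (starRingEnd A) = mev W f := star_fix hk _ hsW
  have fW : ∀ i j, (W i j).map (starRingEnd A) = W i j := by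
    intro i j
    rw [← mev_X (k := k) W i j]
    exact fx _
  intro i j
  rw [Matrix.mul_apply, star_sum]
  refine Finset.sum_congr rfl fun p _ => ?_
  rw [star_mul, mul_comm]
  congr 1
  · exact star_eval _ (fx _) _ hsq
  · refine star_eval _ (star_deriv _ ?_) _ hsq
    rw [Matrix.mul_apply, Polynomial.map_sum]
    refine Finset.sum_congr rfl fun r _ => ?_
    rw [Polynomial.map_mul, fW]
    congr 1
    exact fx _
end Berg

set_option linter.unusedSectionVars false
namespace Berg
section ring
open MvPolynomial

/-- a star structure from an involution -/
@[reducible] def starOf {A : Type*} [CommRing A] (φ : A →+* A) (h : ∀ a, φ (φ a) = a) : StarRing A where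
  star := φ
  star_involutive := h
  star_mul a b := by rw [map_mul, mul_comm]
  star_add := map_add φ

variable (K : Type u) [Field K] (N : ℕ)

/-- sign change -/
noncomputable def neg : MvPolynomial (Fin N) K →ₐ[K] MvPolynomial (Fin N) K := aeval (fun i => - X i)
theorem neg_X (i) : neg K N (X i) = - X i := aeval_X _ _
theorem neg_neg (p) : neg K N (neg K N p) = p := by
  have : (neg K N).comp (neg K N) = AlgHom.id K _ := by
    ext i : 1; simp [neg_X]
  exact AlgHom.congr_fun this p
theorem coeff_neg (p) : constantCoeff (neg K N p) = constantCoeff p := by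
  have : (constantCoeff : MvPolynomial (Fin N) K →+* K).comp (neg K N).toRingHom = constantCoeff := by
    apply MvPolynomial.ringHom_ext
    · intro c; simp [neg]
    · intro i; simp [neg_X]
  exact RingHom.congr_fun this p

/-- the origin -/
noncomputable def p0 : Ideal (MvPolynomial (Fin N) K) := RingHom.ker (constantCoeff : MvPolynomial (Fin N) K →+* K)
instance : (p0 K N).IsPrime := RingHom.ker_isPrime _
theorem mem_p0 (p) : p ∈ p0 K N ↔ constantCoeff p = 0 := Iff.rfl
theorem p0_comap : p0 K N = (p0 K N).comap (neg K N).toRingHom := by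
  ext p
  rw [Ideal.mem_comap, mem_p0, mem_p0]
  exact (iff_of_eq (congrArg (· = 0) (coeff_neg K N p))).symm

/-- the local ring -/
abbrev LA := Localization.AtPrime (p0 K N)

/-- the involution -/
noncomputable def inv : LA K N →+* LA K N := Localization.localRingHom (p0 K N) (p0 K N) (neg K N).toRingHom (p0_comap K N)
theorem inv_map (p) : inv K N (algebraMap _ _ p) = algebraMap _ _ (neg K N p) := Localization.localRingHom_to_map _ _ _ _ p
theorem inv_inv (a) : inv K N (inv K N a) = a := by
  have : (inv K N).comp (inv K N) = RingHom.id _ := by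
    apply IsLocalization.ringHom_ext (p0 K N).primeCompl
    refine RingHom.ext fun p => ?_
    simp [inv_map, neg_neg]
  exact RingHom.congr_fun this a

noncomputable instance instStarLA : StarRing (LA K N) := starOf (inv K N) (inv_inv K N)
theorem star_def (a : LA K N) : star a = inv K N a := rfl

theorem dec (p : MvPolynomial (Fin N) K) : ∃ g : Fin N → MvPolynomial (Fin N) K, p = C (constantCoeff p) + ∑ i, X i * g i := by
  induction p using MvPolynomial.induction_on with
  | C c => exact ⟨0, by simp⟩
  | add p r hp hr =>
    obtain ⟨g, hg⟩ := hp
    obtain ⟨g', hg'⟩ := hr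
    refine ⟨g + g', ?_⟩
    nth_rewrite 1 [hg, hg']
    simp only [map_add, Pi.add_apply, mul_add, Finset.sum_add_distrib]
    ring
  | mul_X p i h =>
    refine ⟨Pi.single i p, ?_⟩
    rw [Finset.sum_eq_single i]
    · simp [mul_comm]
    · intro j _ hj; simp [hj]
    · simp

/-- the parameters -/
noncomputable def xx (i : ℕ) : LA K N := if h : i < N then algebraMap (MvPolynomial (Fin N) K) _ (X ⟨i, h⟩) else 0
theorem xx_fin (i : Fin N) : xx K N i = algebraMap (MvPolynomial (Fin N) K) _ (X i) := by simp [xx]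

theorem reg_pol (s : Set (Fin N)) (i : Fin N) (hi : i ∉ s) (r : MvPolynomial (Fin N) K)
    (h : X i * r ∈ Ideal.span ((X : Fin N → MvPolynomial (Fin N) K) '' s)) : r ∈ Ideal.span ((X : Fin N → MvPolynomial (Fin N) K) '' s) := by
  rw [mem_ideal_span_X_image] at h ⊢
  intro m hm
  obtain ⟨j, hj, hj'⟩ := h (Finsupp.single i 1 + m) (by
    rw [mem_support_iff, coeff_X_mul]; exact mem_support_iff.1 hm)
  refine ⟨j, hj, ?_⟩
  have : i ≠ j := by rintro rfl; exact hi hj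
  simpa [this] using hj'

theorem span_xx (s : Finset ℕ) (hs : ∀ j ∈ s, j < N) : Ideal.span (xx K N '' s) =
    (Ideal.span ((X : Fin N → MvPolynomial (Fin N) K) '' {i | (i : ℕ) ∈ s})).map (algebraMap _ (LA K N)) := by
  rw [Ideal.map_span, ← Set.image_comp]
  congr 1
  ext a
  constructor
  · rintro ⟨j, hj, rfl⟩
    exact ⟨⟨j, hs j hj⟩, hj, (xx_fin K N ⟨j, hs j hj⟩).symm⟩
  · rintro ⟨j, hj, rfl⟩
    exact ⟨j, hj, xx_fin K N j⟩

theorem c_star (i : ℕ) : star (xx K N i) = - xx K N i := by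
  rw [star_def, xx]
  split_ifs
  · rw [inv_map, neg_X, map_neg]
  · simp
theorem c_starK (c : K) : star (algebraMap K (LA K N) c) = algebraMap K (LA K N) c := by
  rw [star_def, IsScalarTower.algebraMap_apply K (MvPolynomial (Fin N) K) (LA K N), inv_map, AlgHom.commutes]
theorem c_nonunit (i : ℕ) (hi : i < N) : ¬ IsUnit (xx K N i) := by
  intro h
  rw [xx, dif_pos hi] at h
  have h2 := (IsLocalization.AtPrime.isUnit_to_map_iff (LA K N) (p0 K N) (X ⟨i, hi⟩)).1 h
  have h3 : (X ⟨i, hi⟩ : MvPolynomial (Fin N) K) ∈ p0 K N := (mem_p0 K N _).2 (constantCoeff_X K _)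
  exact h2 h3
theorem c_decomp (a : LA K N) : ∃ c : K, ∃ g : ℕ → LA K N, a = algebraMap K (LA K N) c + ∑ i ∈ Finset.range N, xx K N i * g i := by
  obtain ⟨p, t, rfl⟩ := IsLocalization.exists_mk'_eq (p0 K N).primeCompl a
  have ht : constantCoeff t.1 ≠ 0 := t.2
  let c := constantCoeff p / constantCoeff t.1
  obtain ⟨g, hg⟩ := dec K N (p - C c * t.1)
  have h0 : constantCoeff (p - C c * t.1) = 0 := by
    simp only [map_sub, map_mul, constantCoeff_C, c]
    rw [div_mul_cancel₀ _ ht, sub_self]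
  rw [h0, map_zero, zero_add, sub_eq_iff_eq_add] at hg
  refine ⟨c, fun i => if h : i < N then IsLocalization.mk' _ (g ⟨i, h⟩) t else 0, ?_⟩
  rw [IsLocalization.mk'_eq_iff_eq_mul, add_mul, Finset.sum_mul, Finset.sum_range, hg, map_add, map_sum, map_mul, add_comm]
  refine congrArg₂ (· + ·) ?_ ?_
  · rw [IsScalarTower.algebraMap_apply K (MvPolynomial (Fin N) K) (LA K N)]; rfl
  refine Finset.sum_congr rfl fun i _ => ?_
  beta_reduce
  rw [xx_fin, dif_pos i.2, mul_assoc, IsLocalization.mk'_spec, map_mul]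
theorem c_reg (s : Finset ℕ) (i : ℕ) (a : LA K N) (hs : ∀ j ∈ s, j < N) (hi : i < N) (his : i ∉ s)
    (h : xx K N i * a ∈ Ideal.span (xx K N '' s)) : a ∈ Ideal.span (xx K N '' s) := by
  rw [span_xx K N s hs] at h ⊢
  obtain ⟨p, t, rfl⟩ := IsLocalization.exists_mk'_eq (p0 K N).primeCompl a
  rw [xx, dif_pos hi, IsLocalization.mul_mk'_eq_mk'_of_mul, IsLocalization.mk'_mem_map_algebraMap_iff (p0 K N).primeCompl] at h
  rw [IsLocalization.mk'_mem_map_algebraMap_iff (p0 K N).primeCompl]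
  obtain ⟨m, hm, h⟩ := h
  refine ⟨m, hm, reg_pol K N _ ⟨i, hi⟩ his _ ?_⟩
  rwa [mul_left_comm]

/-- concrete set-up -/
noncomputable def conc : Setup K (LA K N) where
  x := xx K N
  N := N
  star_x := c_star K N
  star_K := c_starK K N
  nonunit := c_nonunit K N
  decomp := c_decomp K N
  reg := c_reg K N

theorem conc_qq [CharZero K] (n : ℕ) (hn : 0 < n) : qq (conc K (2*n)) n ≠ 0 := by
  have h : qq (conc K (2*n)) n = algebraMap _ _ (∑ i : Fin n, X ⟨2*i, by omega⟩ * X ⟨2*i+1, by omega⟩ : MvPolynomial (Fin (2*n)) K) := by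
    rw [qq, Finset.sum_range, map_sum]
    refine Finset.sum_congr rfl fun i _ => ?_
    rw [map_mul]
    congr 1
    · exact dif_pos _
    · exact dif_pos _
  rw [h]
  intro h0
  have h1 : (∑ i : Fin n, X ⟨2*i, by omega⟩ * X ⟨2*i+1, by omega⟩ : MvPolynomial (Fin (2*n)) K) = 0 :=
    IsLocalization.injective (LA K (2*n)) (p0 K (2*n)).primeCompl_le_nonZeroDivisors (by rw [h0, map_zero])
  have h2 := congrArg (MvPolynomial.eval (fun _ => (1:K))) h1
  simp at h2
  omega
end ring

theorem final (k : Type u) [CommRing k] [IsDomain k] [CharZero k] (n : ℕ) (hodd : Odd n)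
   (Y Z : Matrix (Fin n) (Fin n) (MvPolynomial (Fin n × Fin n) k))
   (hY : ¬ IsUnit Y) (hZ : ¬ IsUnit Z)
   (h : (Matrix.mvPolynomialX (Fin n) (Fin n) k).adjugate = Y * Z) : False := by
  let K := FractionRing k
  have : CharZero K := inferInstanceAs (CharZero (FractionRing k))
  have : IsDomain (LA K (2*n)) := IsLocalization.isDomain_localization (p0 K (2*n)).primeCompl_le_nonZeroDivisors
  have : IsNoetherianRing (LA K (2*n)) := IsLocalization.isNoetherianRing (p0 K (2*n)).primeCompl _ inferInstance
  have e : ∀ c : k, algebraMap k (LA K (2*n)) c = algebraMap K (LA K (2*n)) (algebraMap k K c) := by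
    intro c
    exact IsScalarTower.algebraMap_apply k K (LA K (2*n)) c
  refine red (k := k) (conc K (2*n)) hodd rfl (conc_qq K n hodd.pos) ?_ ?_ Y Z hY hZ h
  · intro a b hab
    rw [e, e] at hab
    exact IsFractionRing.injective k K ((algebraMap K (LA K (2*n))).injective hab)
  · intro c
    rw [e]
    exact (conc K (2*n)).star_K _
end Berg

theorem adjugate_generic_no_factorization_of_odd
    (k : Type*) [CommRing k] [IsDomain k] [CharZero k]
    (n : ℕ) (hn : 0 < n) (hodd : Odd n)
    (X : Matrix (Fin n) (Fin n) (MvPolynomial (Fin n × Fin n) k))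
    (hX : ∀ i j, X i j = MvPolynomial.X (i, j)) :
    ¬ ∃ Y Z : Matrix (Fin n) (Fin n) (MvPolynomial (Fin n × Fin n) k),
        ¬ IsUnit Y ∧ ¬ IsUnit Z ∧ X.adjugate = Y * Z := by
  rintro ⟨Y, Z, hY, hZ, h⟩
  have hXX : X = Matrix.mvPolynomialX (Fin n) (Fin n) k := by
    ext i j : 1
    rw [hX, Matrix.mvPolynomialX_apply]
  subst hXX
  exact Berg.final k n hodd Y Z hY hZ h
end

section
/- Let R be a commutative integral domain, n a positive integer, and X an n×n matrix over R with det(X) = 0. Then for every alternating n×n matrix A over R (i.e., Aᵀ = −A and all diagonal entries of A are 0), one has adj(X) · A · adj(X)ᵀ = 0. -/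
open Matrix

/-- Entries of a left-kernel vector are proportional to each row of the adjugate. -/
lemma leftKernel_mul_adjugate {R : Type*} [CommRing R] {n : ℕ}
    (X : Matrix (Fin n) (Fin n) R) (w : Fin n → R) (hw : w ᵥ* X = 0) (j a b : Fin n) :
    w a * X.adjugate j b = w b * X.adjugate j a := by
  by_cases hab : a = b
  · rw [hab]
  have hN : ((X.updateRow b (Pi.single j 1)).updateRow a (X b)).det
      = - (X.updateRow a (Pi.single j 1)).det := by
    have : (X.updateRow b (Pi.single j 1)).updateRow a (X b)
        = (X.updateRow a (Pi.single j 1)).submatrix (Equiv.swap a b) id := by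
      ext i k
      by_cases h1 : i = a
      · subst h1
        simp [Matrix.updateRow_apply, Ne.symm hab]
      · by_cases h2 : i = b
        · subst h2
          simp [Matrix.updateRow_apply, h1]
        · simp [Matrix.updateRow_apply, h1, h2, Equiv.swap_apply_of_ne_of_ne h1 h2]
    rw [this, Matrix.det_permute, Equiv.Perm.sign_swap hab]
    simp
  rw [adjugate_apply, adjugate_apply]
  set M := X.updateRow b (Pi.single j 1) with hM
  have key : (M.updateRow a (∑ c, w c • X c)).det = 0 := by
    have : ∑ c, w c • X c = 0 := by
      rw [← hw]; ext k; simp [Matrix.vecMul, dotProduct]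
    rw [this]
    exact Matrix.det_eq_zero_of_row_eq_zero a (by simp)
  have expand : (M.updateRow a (∑ c, w c • X c)).det
      = ∑ c, w c * (M.updateRow a (X c)).det := by
    have := map_sum ((Matrix.detRowAlternating (R := R) (n := Fin n)).toMultilinearMap.toLinearMap M a)
      (fun c => w c • X c) Finset.univ
    simp only [map_smul, smul_eq_mul] at this
    exact this
  rw [expand, Finset.sum_eq_add a b hab] at key
  · have h1 : M.updateRow a (X a) = M := by
      have : X a = M a := by rw [hM, Matrix.updateRow_ne hab]
      rw [this, Matrix.updateRow_eq_self]
    rw [h1, hN] at key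
    linear_combination key
  · rintro c - ⟨hca, hcb⟩
    have : (M.updateRow a (X c)).det = 0 := by
      apply Matrix.det_zero_of_row_eq (Ne.symm hca)
      rw [Matrix.updateRow_self, Matrix.updateRow_ne hca, hM, Matrix.updateRow_ne hcb]
    rw [this, mul_zero]
  · simp
  · simp

/-- If `X` is an `n × n` matrix over an integral domain `R` with `det X = 0`, then for
every alternating `n × n` matrix `A` over `R`, `adj(X) * A * adj(X)ᵀ = 0`. -/
theorem adjugate_mul_alternating_mul_adjugate_transpose_eq_zero
    (R : Type*) [CommRing R] [IsDomain R] (n : ℕ) (hn : 0 < n)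
    (X : Matrix (Fin n) (Fin n) R) (hX : X.det = 0)
    (A : Matrix (Fin n) (Fin n) R)
    (hAalt : Aᵀ = -A) (hAdiag : ∀ i, A i i = 0) :
    X.adjugate * A * (X.adjugate)ᵀ = 0 := by
  ext i j
  have hm : ∀ a b, X.adjugate i a * X.adjugate j b = X.adjugate i b * X.adjugate j a := by
    intro a b
    apply leftKernel_mul_adjugate X (X.adjugate i)
    have h := X.adjugate_mul
    rw [hX, zero_smul] at h
    ext k
    exact congrFun (congrFun h i) k
  have hA : ∀ a b, A b a = - A a b := fun a b => congrFun (congrFun hAalt a) b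
  simp only [Matrix.mul_apply, Matrix.transpose_apply, Finset.sum_mul, Matrix.zero_apply]
  rw [← Finset.sum_product']
  refine Finset.sum_involution (fun p _ => p.swap) ?_ ?_ ?_ ?_
  · rintro ⟨a, b⟩ -
    simp only [Prod.swap]
    rw [hA b a]
    linear_combination (A b a) * hm b a
  · rintro ⟨a, b⟩ - h heq
    simp only [Prod.swap, Prod.mk.injEq] at heq
    apply h
    simp [heq.1, hAdiag]
  · simp
  · simp
end

section
/- Let R be a commutative ring, n a positive integer, X an n×n matrix over R, and A any alternating n×n matrix over R. Then every entry of the matrix adj(X) · A · adj(X)ᵀ is divisible by det(X) in R. -/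
open Matrix

/-- The `2 × 2` minors of the adjugate are divisible by the determinant (Jacobi). -/
theorem det_dvd_adjugate_minor {R : Type*} [CommRing R] {n : ℕ}
    (X : Matrix (Fin n) (Fin n) R) (i j k l : Fin n) (hkl : l ≠ k) :
    X.det ∣ X.adjugate i k * X.adjugate j l - X.adjugate i l * X.adjugate j k := by
  set M := X.updateRow k (Pi.single i 1) with hM
  have hdet : M.det = X.adjugate i k := (adjugate_apply X i k).symm
  have hjk : M.adjugate j k = X.adjugate j k := by
    rw [adjugate_apply, adjugate_apply, hM, updateRow_idem]
  have h1 : ∀ r, (M * X.adjugate) r l =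
      X.det * (1 : Matrix (Fin n) (Fin n) R) r l + (if r = k then X.adjugate i l else 0) := by
    intro r
    by_cases hr : r = k
    · subst hr
      simp [hM, Matrix.mul_apply, Matrix.one_apply, hkl.symm, Pi.single_apply]
    · have : (M * X.adjugate) r l = (X * X.adjugate) r l := by
        simp [hM, Matrix.mul_apply, updateRow_ne hr]
      rw [this, mul_adjugate]
      simp [hr]
  have h2 : (M.adjugate * (M * X.adjugate)) j l = X.adjugate i k * X.adjugate j l := by
    rw [← Matrix.mul_assoc, adjugate_mul, hdet]
    simp
  rw [Matrix.mul_apply] at h2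
  simp only [h1, mul_add, Finset.sum_add_distrib] at h2
  simp [Matrix.one_apply, hjk] at h2
  exact ⟨M.adjugate j l, by linear_combination -h2⟩

/-- For `X` an `n × n` matrix over a commutative ring `R` and `A` an alternating `n × n`
matrix over `R`, every entry of `adj(X) * A * adj(X)ᵀ` is divisible by `det X`. -/
theorem det_dvd_adjugate_mul_alternating_mul_adjugate_transpose
    (R : Type*) [CommRing R] (n : ℕ) (hn : 0 < n)
    (X A : Matrix (Fin n) (Fin n) R)
    (hAalt : Aᵀ = -A) (hAdiag : ∀ i, A i i = 0) :
    ∀ i j, X.det ∣ (X.adjugate * A * (X.adjugate)ᵀ) i j := by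
  intro i j
  rw [← Ideal.mem_span_singleton, ← Ideal.Quotient.eq_zero_iff_mem]
  have e : (X.adjugate * A * (X.adjugate)ᵀ) i j =
      ∑ p : Fin n × Fin n, X.adjugate i p.2 * A p.2 p.1 * X.adjugate j p.1 := by
    rw [Fintype.sum_prod_type, Matrix.mul_apply]
    simp [Matrix.mul_apply, Finset.sum_mul]
  rw [e, map_sum]
  refine Finset.sum_involution (fun p _ => p.swap) ?_ ?_ (by simp) (by simp)
  · rintro ⟨l, k⟩ -
    rw [← map_add, Ideal.Quotient.eq_zero_iff_mem, Ideal.mem_span_singleton]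
    by_cases hkl : l = k
    · subst hkl
      simp [hAdiag]
    · obtain ⟨c, hc⟩ := det_dvd_adjugate_minor X i j k l hkl
      have hA : A l k = - A k l := congrFun (congrFun hAalt k) l
      refine ⟨A k l * c, ?_⟩
      simp only [Prod.swap, hA]
      linear_combination A k l * hc
  · rintro ⟨l, k⟩ - h0 h
    apply h0
    have : k = l := by simpa using congrArg Prod.fst h
    subst this
    simp [hAdiag]
end

section
/- Let R be a commutative ring, n a positive integer, X an n×n matrix over R, and A any alternating n×n matrix over R. Then adj(X)·A is right divisible by Xᵀ, i.e., there exists an n×n matrix Y over R with adj(X)·A = Y·Xᵀ; and A·adj(X) is left divisible by Xᵀ, i.e., there exists an n×n matrix Y′ over R with A·adj(X) = Xᵀ·Y′. -/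
open Matrix

theorem adjAlt_key {R : Type*} [CommRing R] {n : ℕ} (X : Matrix (Fin n) (Fin n) R)
    (i : Fin n) (b c : Fin n → R) :
    ∃ y : Fin n → R, ∀ k, ∑ j, y j * X k j = cramer X b i * c k - cramer X c i * b k := by
  refine ⟨fun j => if j = i then 0 else cramer (X.updateCol i b) c j, fun k => ?_⟩
  have h := congrFun (mulVec_cramer (X.updateCol i b) c) k
  simp only [mulVec, dotProduct, Pi.smul_apply, smul_eq_mul] at h
  rw [← Finset.add_sum_erase _ _ (Finset.mem_univ i)] at h ⊢
  have h1 : cramer (X.updateCol i b) c i = cramer X c i := by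
    simp [cramer_apply]
  have h2 : ∑ j ∈ Finset.univ.erase i,
      (if j = i then 0 else cramer (X.updateCol i b) c j) * X k j =
      ∑ j ∈ Finset.univ.erase i, X.updateCol i b k j * cramer (X.updateCol i b) c j := by
    refine Finset.sum_congr rfl fun j hj => ?_
    have hj' := Finset.ne_of_mem_erase hj
    rw [if_neg hj', updateCol_ne hj', mul_comm]
  rw [h1, updateCol_self] at h
  rw [h2, cramer_apply X b i, ← h]
  beta_reduce
  rw [if_pos rfl]
  ring

theorem adjAlt_left {R : Type*} [CommRing R] {n : ℕ} (X A : Matrix (Fin n) (Fin n) R)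
    (hAalt : Aᵀ = -A) (hAdiag : ∀ i, A i i = 0) :
    ∃ Y : Matrix (Fin n) (Fin n) R, X.adjugate * A = Y * Xᵀ := by
  choose y hy using fun i p q : Fin n => adjAlt_key X i (Pi.single p 1) (Pi.single q 1)
  refine ⟨of fun i j => ∑ p, ∑ q, (if p < q then A p q else 0) * y i p q j, ?_⟩
  have hc : ∀ i p, cramer X (Pi.single p 1) i = X.adjugate i p := by
    intro i p
    simp [cramer_eq_adjugate_mulVec]
  have hA : ∀ p q, A q p = - A p q := fun p q => congrFun (congrFun hAalt p) q
  ext i k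
  have e : (∑ j, (∑ p, ∑ q, (if p < q then A p q else 0) * y i p q j) * X k j)
      = ∑ p, ∑ q, (if p < q then A p q else 0) * ∑ j, y i p q j * X k j := by
    simp only [Finset.sum_mul, Finset.mul_sum]
    rw [Finset.sum_comm]
    refine Finset.sum_congr rfl fun p _ => ?_
    rw [Finset.sum_comm]
    simp only [mul_assoc]
  simp only [mul_apply, transpose_apply, of_apply]
  rw [e]
  simp only [hy, hc, mul_sub, Finset.sum_sub_distrib]
  rw [Finset.sum_comm (f := fun p q => (if p < q then A p q else 0) *
    (X.adjugate i q * (Pi.single p 1 : Fin n → R) k))]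
  simp only [Pi.single_apply, mul_ite, mul_one, mul_zero, Finset.sum_ite_eq, Finset.mem_univ,
    if_true]
  rw [← Finset.sum_sub_distrib]
  refine Finset.sum_congr rfl fun p _ => ?_
  rcases lt_trichotomy p k with h | h | h
  · simp [h, h.not_gt, mul_comm]
  · simp [h, hAdiag]
  · simp [h, h.not_gt, hA k p, mul_comm]

/-- For `X` an `n × n` matrix over a commutative ring `R` and `A` an alternating `n × n`
matrix over `R`, `adj(X) * A` is right divisible by `Xᵀ` and `A * adj(X)` is left
divisible by `Xᵀ`. -/
theorem adjugate_mul_alternating_divisible_by_transpose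
    (R : Type*) [CommRing R] (n : ℕ) (hn : 0 < n)
    (X A : Matrix (Fin n) (Fin n) R)
    (hAalt : Aᵀ = -A) (hAdiag : ∀ i, A i i = 0) :
    (∃ Y : Matrix (Fin n) (Fin n) R, X.adjugate * A = Y * Xᵀ) ∧
    (∃ Y' : Matrix (Fin n) (Fin n) R, A * X.adjugate = Xᵀ * Y') := by
  refine ⟨adjAlt_left X A hAalt hAdiag, ?_⟩
  obtain ⟨Y, hY⟩ := adjAlt_left Xᵀ A hAalt hAdiag
  refine ⟨-Yᵀ, ?_⟩
  have h := congrArg transpose hY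
  rw [transpose_mul, transpose_mul, hAalt, adjugate_transpose, transpose_transpose,
    Matrix.neg_mul] at h
  rw [Matrix.mul_neg, ← h, neg_neg]
end

section
/- Let R be a commutative ring, n a positive integer, X an n×n matrix over R, and A an alternating n×n matrix over R which is invertible (a unit of the matrix ring over R). Then adj(X) is right divisible by Xᵀ·A and left divisible by A·Xᵀ: there exist n×n matrices Y, Y′ over R with adj(X) = Y·(Xᵀ·A) and adj(X) = (A·Xᵀ)·Y′. -/
open Matrix

lemma aux_row {R : Type*} [CommRing R] {n : ℕ} (M : Matrix (Fin n) (Fin n) R) (l : Fin n)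
    (v : Fin n → R) : ∑ j, M.adjugate j l * v j = (M.updateRow l v).det := by
  rw [← cramer_transpose_apply, cramer_eq_adjugate_mulVec, ← adjugate_transpose]
  simp [mulVec, dotProduct]

lemma aux_key {R : Type*} [CommRing R] {n : ℕ} (X : Matrix (Fin n) (Fin n) R)
    (i m k l : Fin n) :
    (if k = l then 0 else
      ((X.updateRow k (Pi.single i 1)).updateRow l (X m)).det) =
    (if m = l then X.adjugate i k else 0) - (if m = k then X.adjugate i l else 0) := by
  by_cases hkl : k = l
  · subst hkl; simp
  rw [if_neg hkl]
  by_cases hml : m = l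
  · subst hml
    have hmk : ¬ m = k := fun h => hkl h.symm
    rw [if_pos rfl, if_neg hmk, sub_zero, adjugate_apply]
    congr 1
    ext a b
    by_cases ha : a = m
    · subst ha; simp [updateRow_apply, hmk]
    · simp [updateRow_apply, ha]
  by_cases hmk : m = k
  · subst hmk
    rw [if_neg hml, if_pos rfl, zero_sub, adjugate_apply]
    have h := det_permute (Equiv.swap m l) (X.updateRow l (Pi.single i 1))
    rw [Equiv.Perm.sign_swap hkl] at h
    simp only [Units.val_neg, Units.val_one, Int.cast_neg, Int.cast_one, neg_mul, one_mul] at h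
    rw [← h]
    congr 1
    ext a b
    by_cases hal : a = l
    · subst hal; simp [updateRow_apply, hkl]
    by_cases ham : a = m
    · subst ham; simp [updateRow_apply, hkl]
    · simp [updateRow_apply, hal, ham, Equiv.swap_apply_of_ne_of_ne]
  · rw [if_neg hml, if_neg hmk, sub_zero]
    apply det_zero_of_row_eq hml
    ext b
    simp [updateRow_apply, hml, hmk]

lemma aux_left {R : Type*} [CommRing R] {n : ℕ} (X W : Matrix (Fin n) (Fin n) R) :
    ∃ Y : Matrix (Fin n) (Fin n) R, Y * Xᵀ = X.adjugate * (W - Wᵀ) := by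
  refine ⟨fun i j => ∑ k, ∑ l, W k l *
    (if k = l then 0 else (X.updateRow k (Pi.single i 1)).adjugate j l), ?_⟩
  ext i m
  have h : ∀ k l, ∑ j, (if k = l then 0 else
      (X.updateRow k (Pi.single i 1)).adjugate j l) * X m j =
      (if m = l then X.adjugate i k else 0) - (if m = k then X.adjugate i l else 0) := by
    intro k l
    rw [← aux_key, ← aux_row]
    split_ifs <;> simp
  calc _ = ∑ j, (∑ k, ∑ l, W k l *
    (if k = l then 0 else (X.updateRow k (Pi.single i 1)).adjugate j l)) * X m j := rfl
    _ = ∑ k, ∑ l, W k l * ∑ j, (if k = l then 0 else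
      (X.updateRow k (Pi.single i 1)).adjugate j l) * X m j := by
      simp_rw [Finset.sum_mul, Finset.mul_sum]
      rw [Finset.sum_comm]
      refine Finset.sum_congr rfl fun k _ => ?_
      rw [Finset.sum_comm]
      simp only [mul_assoc]
    _ = _ := by
      simp_rw [h, mul_sub, Finset.sum_sub_distrib]
      rw [Matrix.sub_apply, Matrix.mul_apply, Matrix.mul_apply]
      congr 1
      · simp [mul_comm]
      · rw [Finset.sum_comm]
        simp [mul_comm]

lemma aux_inv {R : Type*} [CommRing R] {n : ℕ} (A : Matrix (Fin n) (Fin n) R)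
    (hAalt : Aᵀ = -A) (hAdiag : ∀ i, A i i = 0) (hA : IsUnit A) :
    ∃ W B : Matrix (Fin n) (Fin n) R, B = W - Wᵀ ∧ B * A = 1 := by
  obtain ⟨U, hU⟩ : ∃ U : Matrix (Fin n) (Fin n) R, A = U - Uᵀ := by
    refine ⟨fun i j => if i < j then A i j else 0, ?_⟩
    ext i j
    have hij : A j i = - A i j := congrFun (congrFun hAalt i) j
    change A i j = (if i < j then A i j else 0) - (if j < i then A j i else 0)
    rcases lt_trichotomy i j with h | h | h
    · simp [h, h.not_gt]
    · subst h; simp [hAdiag]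
    · simp [h, h.not_gt, hij]
  obtain ⟨u, rfl⟩ := hA
  obtain ⟨B, hB⟩ : ∃ B, B = (↑u⁻¹ : Matrix (Fin n) (Fin n) R) := ⟨_, rfl⟩
  have h1 : B * u = 1 := by rw [hB]; exact u.inv_mul
  have h2 : (u : Matrix (Fin n) (Fin n) R) * Bᵀ = -1 := by
    have := congrArg transpose h1
    rw [transpose_mul, hAalt, transpose_one, neg_mul] at this
    rw [← this, neg_neg]
  refine ⟨-(B * U * Bᵀ), B, ?_, h1⟩
  have h3 : B = -(B * (u * Bᵀ)) := by rw [h2]; simp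
  conv_lhs => rw [h3, hU]
  simp only [transpose_neg, transpose_mul, transpose_transpose]
  noncomm_ring

lemma aux_main {R : Type*} [CommRing R] {n : ℕ} (X A : Matrix (Fin n) (Fin n) R)
    (hAalt : Aᵀ = -A) (hAdiag : ∀ i, A i i = 0) (hA : IsUnit A) :
    ∃ Y : Matrix (Fin n) (Fin n) R, X.adjugate = Y * (Xᵀ * A) := by
  obtain ⟨W, B, hB, hBA⟩ := aux_inv A hAalt hAdiag hA
  obtain ⟨Y, hY⟩ := aux_left X W
  exact ⟨Y, by rw [← mul_assoc, hY, ← hB, mul_assoc, hBA, mul_one]⟩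

/-- (Buchweitz–Leuschke) For `X` an `n × n` matrix over a commutative ring `R` and `A` an
invertible alternating `n × n` matrix over `R`, `adj(X)` is right divisible by `Xᵀ * A`
and left divisible by `A * Xᵀ`. -/
theorem adjugate_divisible_of_invertible_alternating
    (R : Type*) [CommRing R] (n : ℕ) (hn : 0 < n)
    (X A : Matrix (Fin n) (Fin n) R)
    (hAalt : Aᵀ = -A) (hAdiag : ∀ i, A i i = 0) (hA : IsUnit A) :
    (∃ Y : Matrix (Fin n) (Fin n) R, X.adjugate = Y * (Xᵀ * A)) ∧
    (∃ Y' : Matrix (Fin n) (Fin n) R, X.adjugate = (A * Xᵀ) * Y') := by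
  refine ⟨aux_main X A hAalt hAdiag hA, ?_⟩
  obtain ⟨Y, hY⟩ := aux_main Xᵀ A hAalt hAdiag hA
  refine ⟨-Yᵀ, ?_⟩
  have h := congrArg transpose hY
  rw [adjugate_transpose, transpose_transpose, transpose_mul, transpose_mul, hAalt] at h
  rw [h]
  simp
end

section
/- Let R be a commutative integral domain with field of fractions F, n a positive integer, X an n×n matrix over R with det(X) ≠ 0, and A an alternating n×n matrix over R. Regarding X and A as matrices over F (via the canonical embedding), every entry of the matrix X⁻¹ · A · (Xᵀ)⁻¹ lies in det(X)⁻¹·R; that is, for all i, j there exists r ∈ R such that the (i,j) entry of X⁻¹·A·(Xᵀ)⁻¹ equals r/det(X) in F. -/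
open Matrix

lemma det_swap_aux {R : Type*} [CommRing R] {n : ℕ} (X : Matrix (Fin n) (Fin n) R)
    (i j : Fin n) (hij : i ≠ j) (a : Fin n → R) :
    ((X.updateCol i a).updateCol j (fun k => X k i)).det = -(X.updateCol j a).det := by
  have h := det_permute' (Equiv.swap i j) ((X.updateCol i a).updateCol j (fun k => X k i))
  have h2 : ((X.updateCol i a).updateCol j (fun k => X k i)).submatrix id (Equiv.swap i j)
      = X.updateCol j a := by
    ext k c
    simp only [submatrix_apply, id, updateCol_apply, Equiv.swap_apply_def]
    by_cases h1 : c = i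
    · subst h1; simp [hij]
    · by_cases h3 : c = j
      · subst h3; simp [hij, h1]
      · simp [h1, h3]
  rw [h2, Equiv.Perm.sign_swap hij] at h
  rw [h]; simp

/-- The Jacobi identity for 2x2 minors of the adjugate. -/
lemma minor_adj_aux {R : Type*} [CommRing R] {n : ℕ} (X : Matrix (Fin n) (Fin n) R)
    (i j : Fin n) (hij : i ≠ j) (a b : Fin n → R) :
    X.det * ((X.updateCol i a).updateCol j b).det =
      cramer X a i * cramer X b j - cramer X b i * cramer X a j := by
  have h1 : X.det • b = ∑ c, cramer X b c • (fun k => X k c) := by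
    rw [← mulVec_cramer]
    ext k
    simp [mulVec, dotProduct, mul_comm]
  have h2 := congrArg (fun v => cramer (X.updateCol i a) v j) h1
  simp only [map_smul, map_sum, Finset.sum_apply, Pi.smul_apply, smul_eq_mul] at h2
  rw [← cramer_apply, h2, Finset.sum_eq_add j i hij.symm]
  · rw [cramer_row_self (X.updateCol i a) (fun k => X k j) j
      (fun k => by rw [updateCol_ne hij.symm])]
    rw [cramer_apply (X.updateCol i a), det_swap_aux X i j hij, ← cramer_apply, Pi.single_eq_same,
      ← cramer_apply]
    ring
  · intro c _ hc
    rw [cramer_row_self (X.updateCol i a) (fun k => X k c) c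
      (fun k => by rw [updateCol_ne hc.2]), Pi.single_eq_of_ne hc.1.symm, mul_zero]
  · simp
  · simp

lemma minor_dvd_aux {R : Type*} [CommRing R] {n : ℕ} (X : Matrix (Fin n) (Fin n) R)
    (i j k l : Fin n) :
    X.det ∣ X.adjugate i k * X.adjugate j l - X.adjugate i l * X.adjugate j k := by
  by_cases hij : i = j
  · subst hij
    rw [mul_comm, sub_self]
    exact dvd_zero _
  · have h := minor_adj_aux X i j hij (Pi.single k 1) (Pi.single l 1)
    simp only [cramer_eq_adjugate_mulVec, mulVec_single_one, col_apply] at h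
    exact ⟨_, h.symm⟩

lemma adj_dvd_aux {R : Type*} [CommRing R] {n : ℕ} (X A : Matrix (Fin n) (Fin n) R)
    (hAalt : Aᵀ = -A) (hAdiag : ∀ i, A i i = 0) (i j : Fin n) :
    X.det ∣ (X.adjugate * A * X.adjugateᵀ) i j := by
  have hA : ∀ k l, A k l = (if k < l then A k l else 0) - (if l < k then A l k else 0) := by
    intro k l
    have h : A l k = - A k l := congrFun (congrFun hAalt k) l
    rcases lt_trichotomy k l with hkl | hkl | hkl
    · simp [hkl, hkl.not_gt]
    · subst hkl; simp [hAdiag]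
    · simp [hkl, hkl.not_gt, h]
  have h1 : (X.adjugate * A * X.adjugateᵀ) i j =
      ∑ k, ∑ l, (if k < l then A k l else 0) *
        (X.adjugate i k * X.adjugate j l - X.adjugate i l * X.adjugate j k) := by
    have h2 : (X.adjugate * A * X.adjugateᵀ) i j =
        ∑ k, ∑ l, X.adjugate i k * A k l * X.adjugate j l := by
      simp only [mul_apply, transpose_apply, Finset.sum_mul]
      exact Finset.sum_comm
    have h3 : ∑ k, ∑ l, (if k < l then A k l else 0) * (X.adjugate i l * X.adjugate j k) =
        ∑ k, ∑ l, (if l < k then A l k else 0) * (X.adjugate i k * X.adjugate j l) :=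
      Finset.sum_comm
    simp only [mul_sub, Finset.sum_sub_distrib]
    rw [h2, h3]
    simp only [← Finset.sum_sub_distrib]
    refine Finset.sum_congr rfl fun k _ => Finset.sum_congr rfl fun l _ => ?_
    rw [← sub_mul, ← hA]
    ring
  rw [h1]
  exact Finset.dvd_sum fun k _ => Finset.dvd_sum fun l _ =>
    Dvd.dvd.mul_left (minor_dvd_aux X i j k l) _

/-- Let `R` be an integral domain with fraction field `F`, `X` an `n × n` matrix over `R`
with `det X ≠ 0`, and `A` an alternating `n × n` matrix over `R`.  Then every entry of
`X⁻¹ * A * (Xᵀ)⁻¹` (computed over `F`) lies in `det(X)⁻¹ • R`. -/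
theorem entries_inv_mul_alternating_mul_inv_transpose
    (R : Type*) [CommRing R] [IsDomain R] (n : ℕ) (hn : 0 < n)
    (X A : Matrix (Fin n) (Fin n) R) (hX : X.det ≠ 0)
    (hAalt : Aᵀ = -A) (hAdiag : ∀ i, A i i = 0) :
    ∀ i j, ∃ r : R,
      ((X.map (algebraMap R (FractionRing R)))⁻¹ *
        A.map (algebraMap R (FractionRing R)) *
        ((X.map (algebraMap R (FractionRing R)))ᵀ)⁻¹) i j =
      algebraMap R (FractionRing R) r / algebraMap R (FractionRing R) X.det := by
  intro i j
  obtain ⟨r, hr⟩ := adj_dvd_aux X A hAalt hAdiag i j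
  refine ⟨r, ?_⟩
  set f := algebraMap R (FractionRing R) with hf
  have hd : f X.det ≠ 0 := by
    rw [hf, Ne, FaithfulSMul.algebraMap_eq_zero_iff]
    exact hX
  have hdet : (X.map f).det = f X.det := (RingHom.map_det f X).symm
  have hadj : (X.map f).adjugate = X.adjugate.map f := (RingHom.map_adjugate f X).symm
  have key : ((X.map f).adjugate * A.map f * (X.map f).adjugateᵀ) i j = f X.det * f r := by
    rw [hadj, ← transpose_map, ← Matrix.map_mul, ← Matrix.map_mul, map_apply, hr, map_mul]
  rw [← transpose_nonsing_inv, inv_def, hdet, Ring.inverse_eq_inv', transpose_smul,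
    Matrix.smul_mul, Matrix.smul_mul, Matrix.mul_smul, Matrix.smul_apply, Matrix.smul_apply, key]
  simp only [smul_eq_mul]
  field_simp
end
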